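/- arXiv:0704.2713 — 2 statements merged into one kernel-verified Lean document; each statement's English description precedes it below -/
import Mathlib

section
/- Let X be a set of (d+1)(q−1)+1 points in general position in ℝ^d with q > d+1. Then the number of Tverberg partitions of X into q parts is even. -/
/-- A Tverberg partition of a finite point set `X ⊆ ℝ^d` into `q` parts:
a partition of `X` into `q` subsets whose convex hulls have a common point. -/
def IsTverbergPartition (d q : ℕ) (X : Finset (EuclideanSpace ℝ (Fin d)))
    (P : Finset (Finset (EuclideanSpace ℝ (Fin d)))) : Prop :=
  P.card = q ∧ (∀ S ∈ P, S ⊆ X) ∧ (∀ x ∈ X, ∃! S, S ∈ P ∧ x ∈ S) ∧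
  (⋂ S ∈ P, convexHull ℝ (S : Set (EuclideanSpace ℝ (Fin d)))).Nonempty


theorem tv_pivot_aux {ι : Type*} [Fintype ι] [DecidableEq ι] (z0 : ι) (l0 ν : ι → ℝ)
    (hpos : ∀ i, i ≠ z0 → 0 < l0 i) (hex : ∃ i, i ≠ z0) :
    ∃ r : ℝ, ∃ z1, z1 ≠ z0 ∧ ν z1 - r * l0 z1 = 0 ∧ ∀ i, i ≠ z0 → 0 ≤ ν i - r * l0 i := by
  obtain ⟨z1, hz1, hmin⟩ := Finset.exists_min_image (Finset.univ.filter (fun i => i ≠ z0))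
    (fun i => ν i / l0 i) (by obtain ⟨i, hi⟩ := hex; exact ⟨i, by simp [hi]⟩)
  simp only [Finset.mem_filter, Finset.mem_univ, true_and] at hz1 hmin
  refine ⟨ν z1 / l0 z1, z1, hz1, ?_, ?_⟩
  · have := hpos z1 hz1
    field_simp; ring
  · intro i hi
    have h1 := hmin i hi
    have h2 := hpos i hi
    rw [le_div_iff₀ h2] at h1
    linarith

theorem tv_pivot {ι V : Type*} [Fintype ι] [DecidableEq ι] [AddCommGroup V] [Module ℝ V]
    [FiniteDimensional ℝ V] (L : (ι → ℝ) →ₗ[ℝ] V)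
    (hdim : Module.finrank ℝ V + 2 ≤ Fintype.card ι)
    (hgen : ∀ l : ι → ℝ, (∀ i, 0 ≤ l i) → l ≠ 0 → L l = 0 → ∀ i j, l i = 0 → l j = 0 → i = j) :
    Even {z | ∃ l : ι → ℝ, (∀ i, 0 ≤ l i) ∧ l ≠ 0 ∧ L l = 0 ∧ l z = 0}.ncard := by
  by_cases hne : ∃ z0, ∃ l : ι → ℝ, (∀ i, 0 ≤ l i) ∧ l ≠ 0 ∧ L l = 0 ∧ l z0 = 0
  swap
  · have : {z | ∃ l : ι → ℝ, (∀ i, 0 ≤ l i) ∧ l ≠ 0 ∧ L l = 0 ∧ l z = 0} = ∅ := by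
      ext z
      simp only [Set.mem_setOf_eq, Set.mem_empty_iff_false, iff_false]
      exact fun h => hne ⟨z, h⟩
    rw [this]; simp
  obtain ⟨z0, l0, hnn0, hne0, hL0, hz0⟩ := hne
  have hpos : ∀ i, i ≠ z0 → 0 < l0 i := by
    intro i hi
    rcases (hnn0 i).lt_or_eq with h | h
    · exact h
    · exact absurd (hgen l0 hnn0 hne0 hL0 i z0 h.symm hz0) hi
  have hex : ∃ i, i ≠ z0 := by
    by_contra h; push Not at h
    apply hne0; ext i; rw [h i, hz0]; rfl
  have hmul : ∀ ν : ι → ℝ, L ν = 0 → ν z0 = 0 → ∃ r : ℝ, ν = r • l0 := by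
    intro ν hν hνz
    obtain ⟨r, z1, hz1, h1, h2⟩ := tv_pivot_aux z0 l0 ν hpos hex
    refine ⟨r, ?_⟩
    by_contra hcon
    have := hgen (ν - r • l0) ?_ (fun h => hcon (sub_eq_zero.mp h)) (by simp [hν, hL0]) z0 z1
      (by simp [hνz, hz0]) (by simpa using h1)
    · exact hz1 this.symm
    · intro i
      by_cases hi : i = z0
      · subst hi; simp [hνz, hz0]
      · simpa using h2 i hi
  have hμ : ∃ μ : ι → ℝ, L μ = 0 ∧ μ z0 ≠ 0 := by
    by_contra hcon
    push Not at hcon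
    have hker : LinearMap.ker L ≤ Submodule.span ℝ {l0} := by
      intro ν hν
      obtain ⟨r, hr⟩ := hmul ν (by simpa using hν) (hcon ν (by simpa using hν))
      rw [hr]
      exact Submodule.smul_mem _ _ (Submodule.subset_span rfl)
    have h1 := Submodule.finrank_mono hker
    have h2 := finrank_span_le_card (R := ℝ) ({l0} : Set (ι → ℝ))
    simp at h2
    have h3 := LinearMap.finrank_range_add_finrank_ker L
    have h4 := Submodule.finrank_le (LinearMap.range L)
    simp at h3
    omega
  obtain ⟨μ', hμ', hμ'z⟩ := hμ
  set μ : ι → ℝ := (μ' z0)⁻¹ • μ' with hμdef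
  have hLμ : L μ = 0 := by simp [hμdef, hμ']
  have hμz : μ z0 = 1 := by simp [hμdef, hμ'z]
  obtain ⟨r, z1, hz1, h1, h2⟩ := tv_pivot_aux z0 l0 μ hpos hex
  set l1 : ι → ℝ := μ - r • l0 with hl1
  have hl1z0 : l1 z0 = 1 := by simp [hl1, hμz, hz0]
  have hl1z1 : l1 z1 = 0 := by simpa [hl1] using h1
  have hl1nn : ∀ i, 0 ≤ l1 i := by
    intro i
    by_cases hi : i = z0
    · subst hi; rw [hl1z0]; norm_num
    · simpa [hl1] using h2 i hi
  have hl1ne : l1 ≠ 0 := by intro h; rw [h] at hl1z0; simp at hl1z0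
  have hLl1 : L l1 = 0 := by simp [hl1, hLμ, hL0]
  have hset : {z | ∃ l : ι → ℝ, (∀ i, 0 ≤ l i) ∧ l ≠ 0 ∧ L l = 0 ∧ l z = 0} = {z0, z1} := by
    ext z
    simp only [Set.mem_setOf_eq, Set.mem_insert_iff, Set.mem_singleton_iff]
    constructor
    · rintro ⟨l2, hnn2, hne2, hL2, hz2⟩
      by_contra hcon
      push Not at hcon
      have hp : 0 < l2 z0 := by
        rcases (hnn2 z0).lt_or_eq with h | h
        · exact h
        · exact absurd (hgen l2 hnn2 hne2 hL2 z z0 hz2 h.symm) hcon.1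
      obtain ⟨ρ, hρ⟩ := hmul ((l2 z0)⁻¹ • l2 - l1) (by simp [hL2, hLl1]) (by simp [hl1z0, hp.ne'])
      have e1 := congrFun hρ z
      have e2 := congrFun hρ z1
      simp [hz2] at e1
      simp [hl1z1] at e2
      have p1 : 0 < l1 z := by
        rcases (hl1nn z).lt_or_eq with h | h
        · exact h
        · exact absurd (hgen l1 hl1nn hl1ne hLl1 z z1 h.symm hl1z1) hcon.2
      have p2 := hpos z hcon.1
      have p3 := hpos z1 hz1
      have p4 : 0 ≤ (l2 z0)⁻¹ * l2 z1 := mul_nonneg (inv_nonneg.mpr hp.le) (hnn2 z1)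
      rw [e2] at p4
      have p5 : 0 ≤ ρ := nonneg_of_mul_nonneg_left p4 p3
      nlinarith
    · rintro (h | h)
      · subst h; exact ⟨l0, hnn0, hne0, hL0, hz0⟩
      · subst h; exact ⟨l1, hl1nn, hl1ne, hLl1, hl1z1⟩
  rw [hset, Set.ncard_pair hz1.symm]
  exact even_two

def TvPart {ι : Type*} (s : Finset ι) (P : Finset (Finset ι)) : Prop :=
  (∀ F ∈ P, F ⊆ s) ∧ (∀ F ∈ P, ∀ G ∈ P, F ≠ G → Disjoint F G) ∧ ∀ i ∈ s, ∃ F ∈ P, i ∈ F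

theorem tv_expand {ι : Type*} [DecidableEq ι] (h : Finset ι → ZMod 2) (P : Finset (Finset ι))
    (hP : ∀ F ∈ P, ∀ G ∈ P, F ≠ G → Disjoint F G) :
    ∏ F ∈ P, ∑ s ∈ F, h (F.erase s) =
      ∑ M ∈ (P.biUnion id).powerset.filter (fun M => ∀ F ∈ P, (F ∩ M).card = 1),
        ∏ F ∈ P, h (F \ M) := by
  induction P using Finset.induction_on with
  | empty => simp
  | insert F P hF ih =>
    have ih' := ih (fun A hA B hB => hP A (by simp [hA]) B (by simp [hB]))
    have hd : ∀ G ∈ P, Disjoint F G := fun G hG =>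
      hP F (by simp) G (by simp [hG]) (fun h => hF (h ▸ hG))
    rw [Finset.prod_insert hF, ih', Finset.sum_mul_sum, ← Finset.sum_product']
    refine Finset.sum_bij (fun x _ => insert x.1 x.2) ?_ ?_ ?_ ?_
    · rintro ⟨s, M⟩ hx
      simp only [Finset.mem_product, Finset.mem_filter, Finset.mem_powerset] at hx ⊢
      obtain ⟨hs, hM, hc⟩ := hx
      have hFM : F ∩ M = ∅ := by
        ext i
        simp only [Finset.mem_inter, Finset.notMem_empty, iff_false, not_and]
        intro hi hiM
        obtain ⟨G, hG, hiG⟩ := Finset.mem_biUnion.mp (hM hiM)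
        exact Finset.disjoint_left.mp (hd G hG) hi hiG
      refine ⟨?_, ?_⟩
      · intro i hi
        rcases Finset.mem_insert.mp hi with rfl | hi
        · exact Finset.mem_biUnion.mpr ⟨F, by simp, hs⟩
        · obtain ⟨G, hG, hiG⟩ := Finset.mem_biUnion.mp (hM hi)
          exact Finset.mem_biUnion.mpr ⟨G, by simp [hG], hiG⟩
      · intro G hG
        rcases Finset.mem_insert.mp hG with rfl | hG
        · rw [Finset.inter_insert_of_mem hs, hFM]; simp
        · rw [Finset.inter_insert_of_notMem (Finset.disjoint_left.mp (hd G hG) hs)]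
          exact hc G hG
    · rintro ⟨s, M⟩ hx ⟨s', M'⟩ hx' heq
      simp only [Finset.mem_product, Finset.mem_filter, Finset.mem_powerset] at hx hx' heq
      have key : ∀ N, N ⊆ P.biUnion id → ∀ i ∈ F, i ∉ N := by
        intro N hN i hi hiN
        obtain ⟨G, hG, hiG⟩ := Finset.mem_biUnion.mp (hN hiN)
        exact Finset.disjoint_left.mp (hd G hG) hi hiG
      have h1 : s = s' := by
        have : s ∈ insert s' M' := heq ▸ Finset.mem_insert_self _ _
        rcases Finset.mem_insert.mp this with h | h
        · exact h
        · exact absurd h (key M' hx'.2.1 s hx.1)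
      subst h1
      have h2 := congrArg (fun A => Finset.erase A s) heq
      simp only [Finset.erase_insert (key M hx.2.1 s hx.1),
        Finset.erase_insert (key M' hx'.2.1 s hx.1)] at h2
      rw [h2]
    · intro M hM
      simp only [Finset.mem_filter, Finset.mem_powerset] at hM
      obtain ⟨hM, hc⟩ := hM
      obtain ⟨s, hs⟩ := Finset.card_eq_one.mp (hc F (by simp))
      have hsF : s ∈ F ∩ M := by rw [hs]; simp
      have hsF' := Finset.mem_inter.mp hsF
      refine ⟨(s, M \ F), ?_, ?_⟩
      · simp only [Finset.mem_product, Finset.mem_filter, Finset.mem_powerset]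
        refine ⟨hsF'.1, ?_, ?_⟩
        · intro i hi
          have hi' := Finset.mem_sdiff.mp hi
          obtain ⟨G, hG, hiG⟩ := Finset.mem_biUnion.mp (hM hi'.1)
          rcases Finset.mem_insert.mp hG with rfl | hG
          · exact absurd hiG hi'.2
          · exact Finset.mem_biUnion.mpr ⟨G, hG, hiG⟩
        · intro G hG
          rw [← hc G (by simp [hG])]
          congr 1
          ext i
          simp only [Finset.mem_inter, Finset.mem_sdiff]
          have : i ∈ G → i ∉ F := fun h1 h2 => Finset.disjoint_left.mp (hd G hG) h2 h1
          tauto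
      · ext i
        have : i ∈ F ∩ M ↔ i = s := by rw [hs]; simp
        simp only [Finset.mem_insert, Finset.mem_sdiff]
        rw [Finset.mem_inter] at this
        tauto
    · rintro ⟨s, M⟩ hx
      simp only [Finset.mem_product, Finset.mem_filter, Finset.mem_powerset] at hx ⊢
      obtain ⟨hs, hM, hc⟩ := hx
      rw [Finset.prod_insert hF]
      congr 1
      · congr 1
        ext i
        simp only [Finset.mem_erase, Finset.mem_sdiff, Finset.mem_insert]
        have : i ∈ F → i ∉ M := by
          intro hi hiM
          obtain ⟨G, hG, hiG⟩ := Finset.mem_biUnion.mp (hM hiM)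
          exact Finset.disjoint_left.mp (hd G hG) hi hiG
        tauto
      · apply Finset.prod_congr rfl
        intro G hG
        congr 1
        ext i
        simp only [Finset.mem_sdiff, Finset.mem_insert]
        have : i ∈ G → i ≠ s := fun hi hsi =>
          Finset.disjoint_left.mp (hd G hG) hs (hsi ▸ hi)
        tauto

open Pointwise in
theorem TvPart.smul {ι : Type*} [DecidableEq ι] (π : Equiv.Perm ι) {s : Finset ι}
    {P : Finset (Finset ι)} (h : TvPart s P) : TvPart (π • s) (π • P) := by
  obtain ⟨h1, h2, h3⟩ := h
  refine ⟨?_, ?_, ?_⟩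
  · intro F hF
    obtain ⟨F, hF', rfl⟩ := Finset.mem_smul_finset.mp hF
    exact Finset.smul_finset_subset_smul_finset (h1 F hF')
  · intro F hF G hG hne
    obtain ⟨F, hF', rfl⟩ := Finset.mem_smul_finset.mp hF
    obtain ⟨G, hG', rfl⟩ := Finset.mem_smul_finset.mp hG
    have := h2 F hF' G hG' (fun h => hne (by rw [h]))
    rw [Finset.disjoint_left] at this ⊢
    intro i hi hi'
    rw [← Finset.inv_smul_mem_iff] at hi hi'
    exact this hi hi'
  · intro i hi
    rw [← Finset.inv_smul_mem_iff] at hi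
    obtain ⟨F, hF, hi⟩ := h3 _ hi
    refine ⟨π • F, Finset.smul_mem_smul_finset hF, ?_⟩
    rwa [← Finset.inv_smul_mem_iff]

noncomputable def tvSwap {ι : Type*} [DecidableEq ι] (L : Finset ι) : Equiv.Perm ι :=
  open Classical in
  if h : ∃ a b, a ∈ L ∧ b ∈ L ∧ a ≠ b then Equiv.swap h.choose h.choose_spec.choose else 1

theorem tvSwap_spec {ι : Type*} [DecidableEq ι] (L : Finset ι) (hL : 1 < L.card) :
    ∃ a b, a ∈ L ∧ b ∈ L ∧ a ≠ b ∧ tvSwap L = Equiv.swap a b := by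
  have h : ∃ a b, a ∈ L ∧ b ∈ L ∧ a ≠ b := by
    obtain ⟨a, b, h1, h2, h3⟩ := Finset.one_lt_card_iff.mp hL
    exact ⟨a, b, h1, h2, h3⟩
  refine ⟨h.choose, h.choose_spec.choose, h.choose_spec.choose_spec.1,
    h.choose_spec.choose_spec.2.1, h.choose_spec.choose_spec.2.2, ?_⟩
  simp only [tvSwap, h, dite_true]

open Pointwise in
theorem tv_swap_smul_eq {ι : Type*} [DecidableEq ι] {a b : ι} {S : Finset ι}
    (h : a ∈ S ↔ b ∈ S) : Equiv.swap a b • S = S := by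
  ext i
  rw [← Finset.inv_smul_mem_iff, Equiv.swap_inv]
  simp only [Equiv.Perm.smul_def]
  by_cases h1 : i = a
  · subst h1; simp [h]
  by_cases h2 : i = b
  · subst h2; simp [h]
  rw [Equiv.swap_apply_of_ne_of_ne h1 h2]

open Pointwise in
theorem tv_smul_erase {ι : Type*} [DecidableEq ι] (π : Equiv.Perm ι) (S : Finset ι) (z : ι) :
    π • (S.erase z) = (π • S).erase (π z) := by
  ext i
  simp only [← Finset.inv_smul_mem_iff, Finset.mem_erase, Equiv.Perm.smul_def]
  constructor
  · rintro ⟨h1, h2⟩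
    exact ⟨fun h => h1 (by rw [h]; simp), h2⟩
  · rintro ⟨h1, h2⟩
    exact ⟨fun h => h1 (by rw [← h]; simp), h2⟩

open Pointwise in
theorem tv_flip_even {ι : Type*} [Fintype ι] [DecidableEq ι] (n : ℕ) (hn : 2 ≤ n) (W : Finset ι)
    (good : Finset ι → Prop) [DecidablePred good] (hW : n + 1 ≤ W.card)
    (hU : ∀ U, U ⊆ W → U.card = n + 1 → Even (U.filter (fun z => good (U.erase z))).card)
    (S : Finset (ι × Finset (Finset ι)))
    (hS : ∀ x, x ∈ S ↔ x.1 ∈ W ∧ TvPart (W.erase x.1) x.2 ∧ ∀ F ∈ x.2, F.card = n ∧ good F) :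
    Even S.card := by
  classical
  obtain ⟨m, hm⟩ : W.Nonempty := Finset.card_pos.mp (by omega)
  let g : Finset ι → ZMod 2 := fun F => if good F then 1 else 0
  let h : Finset ι → ZMod 2 := fun D => if m ∉ D then g (insert m D) else 0
  have hg : ∀ F, F ⊆ W → F.card = n → g F = ∑ s ∈ F, h (F.erase s) := by
    intro F hF hc
    by_cases hmF : m ∈ F
    · rw [Finset.sum_eq_single_of_mem m hmF]
      · simp [h, Finset.insert_erase hmF]
      · intro b hb hbm
        simp only [h]
        rw [if_neg]
        simpa using ⟨hbm.symm, hmF⟩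
    · have := hU (insert m F) (Finset.insert_subset hm hF) (by rw [Finset.card_insert_of_notMem hmF, hc])
      have h2 : ((Finset.filter (fun z => good ((insert m F).erase z)) (insert m F)).card : ZMod 2) = 0 :=
        (ZMod.natCast_eq_zero_iff_even).mpr this
      rw [Finset.card_filter, Nat.cast_sum, Finset.sum_insert hmF] at h2
      rw [Finset.erase_insert hmF] at h2
      have h3 : ∑ x ∈ F, ((if good ((insert m F).erase x) then 1 else 0 : ℕ) : ZMod 2)
          = ∑ s ∈ F, h (F.erase s) := by
        apply Finset.sum_congr rfl
        intro s hs
        have hms : m ≠ s := fun e => hmF (e ▸ hs)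
        simp only [h, g]
        have hh : m ∉ F.erase s := by simp [hmF]
        rw [if_pos hh, Finset.erase_insert_of_ne hms]
        split_ifs <;> simp
      rw [h3] at h2
      have h4 : g F = ((if good F then 1 else 0 : ℕ) : ZMod 2) := by
        simp only [g]; split_ifs <;> simp
      rw [← h4] at h2
      have := CharTwo.add_eq_zero.mp h2
      exact this
  rw [← ZMod.natCast_eq_zero_iff_even]
  let S0 : Finset (ι × Finset (Finset ι)) := Finset.univ.filter
    (fun x => x.1 ∈ W ∧ TvPart (W.erase x.1) x.2 ∧ ∀ F ∈ x.2, F.card = n)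
  let Ms : ι × Finset (Finset ι) → Finset (Finset ι) := fun x =>
    (x.2.biUnion id).powerset.filter (fun M => ∀ F ∈ x.2, (F ∩ M).card = 1)
  have e1 : (S.card : ZMod 2) = ∑ x ∈ S0, ∏ F ∈ x.2, g F := by
    have : S = S0.filter (fun x => ∀ F ∈ x.2, good F) := by
      ext x
      simp only [hS, S0, Finset.mem_filter, Finset.mem_univ, true_and]
      constructor
      · rintro ⟨a, b, c⟩
        exact ⟨⟨a, b, fun F hF => (c F hF).1⟩, fun F hF => (c F hF).2⟩
      · rintro ⟨⟨a, b, c⟩, e⟩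
        exact ⟨a, b, fun F hF => ⟨c F hF, e F hF⟩⟩
    rw [this, Finset.card_filter, Nat.cast_sum]
    apply Finset.sum_congr rfl
    intro x hx
    simp only [g]
    rw [Finset.prod_ite_zero]
    split_ifs <;> simp
  have e2 : ∑ x ∈ S0, ∏ F ∈ x.2, g F = ∑ x ∈ S0, ∑ M ∈ Ms x, ∏ F ∈ x.2, h (F \ M) := by
    apply Finset.sum_congr rfl
    intro x hx
    simp only [S0, Finset.mem_filter, Finset.mem_univ, true_and] at hx
    obtain ⟨hz, hP, hc⟩ := hx
    have hexp := tv_expand h x.2 hP.2.1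
    simp only [Ms]
    have hpr : ∏ F ∈ x.2, g F = ∏ F ∈ x.2, ∑ s ∈ F, h (F.erase s) := by
      apply Finset.prod_congr rfl
      intro F hF
      exact hg F ((hP.1 F hF).trans (Finset.erase_subset _ _)) (hc F hF)
    rw [hpr]
    convert hexp
  rw [e1, e2, Finset.sum_sigma']
  have fact : ∀ x : (Σ _ : ι × Finset (Finset ι), Finset ι), x ∈ S0.sigma Ms →
      x.1.1 ∈ W ∧ TvPart (W.erase x.1.1) x.1.2 ∧ (∀ F ∈ x.1.2, F.card = n) ∧
      x.2 ⊆ x.1.2.biUnion id ∧ (∀ F ∈ x.1.2, (F ∩ x.2).card = 1) := by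
    intro x hx
    simp only [Finset.mem_sigma, S0, Ms, Finset.mem_filter, Finset.mem_univ, true_and,
      Finset.mem_powerset] at hx
    exact ⟨hx.1.1, hx.1.2.1, hx.1.2.2, hx.2.1, hx.2.2⟩
  have fact2 : ∀ x : (Σ _ : ι × Finset (Finset ι), Finset ι), 
      (x.1.1 ∈ W ∧ TvPart (W.erase x.1.1) x.1.2 ∧ (∀ F ∈ x.1.2, F.card = n) ∧
      x.2 ⊆ x.1.2.biUnion id ∧ (∀ F ∈ x.1.2, (F ∩ x.2).card = 1)) → x ∈ S0.sigma Ms := by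
    intro x hx
    simp only [Finset.mem_sigma, S0, Ms, Finset.mem_filter, Finset.mem_univ, true_and,
      Finset.mem_powerset]
    exact ⟨⟨hx.1, hx.2.1, hx.2.2.1⟩, hx.2.2.2.1, hx.2.2.2.2⟩
  have hMsub : ∀ x ∈ S0.sigma Ms, x.2 ⊆ W.erase x.1.1 := by
    intro x hx i hi
    obtain ⟨h1, h2, h3, h4, h5⟩ := fact x hx
    obtain ⟨F, hF, hiF⟩ := Finset.mem_biUnion.mp (h4 hi)
    exact h2.1 F hF hiF
  have hLsub : ∀ x ∈ S0.sigma Ms, insert x.1.1 x.2 ⊆ W := by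
    intro x hx
    exact Finset.insert_subset (fact x hx).1 ((hMsub x hx).trans (Finset.erase_subset _ _))
  have hcard : ∀ x ∈ S0.sigma Ms, 1 < (insert x.1.1 x.2).card := by
    intro x hx
    obtain ⟨h1, h2, h3, h4, h5⟩ := fact x hx
    have hz : x.1.1 ∉ x.2 := fun hh => by simpa using hMsub x hx hh
    rw [Finset.card_insert_of_notMem hz]
    have hne : (W.erase x.1.1).Nonempty := by
      apply Finset.card_pos.mp
      rw [Finset.card_erase_of_mem h1]; omega
    obtain ⟨i, hi⟩ := hne
    obtain ⟨F, hF, hiF⟩ := h2.2.2 i hi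
    have := h5 F hF
    have h6 := Finset.card_le_card (Finset.inter_subset_right : F ∩ x.2 ⊆ x.2)
    omega
  refine Finset.sum_involution
    (fun x _ => ⟨((tvSwap (insert x.1.1 x.2)) x.1.1, (tvSwap (insert x.1.1 x.2)) • x.1.2),
      (tvSwap (insert x.1.1 x.2)) • x.2⟩) ?_ ?_ ?_ ?_
  · intro x hx
    obtain ⟨h1, h2, h3, h4, h5⟩ := fact x hx
    obtain ⟨a, b, ha, hb, hab, hsw⟩ := tvSwap_spec _ (hcard x hx)
    rw [hsw]
    have : ∏ F ∈ Equiv.swap a b • x.1.2, h (F \ (Equiv.swap a b • x.2)) = ∏ F ∈ x.1.2, h (F \ x.2) := by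
      rw [show Equiv.swap a b • x.1.2 = x.1.2.image (fun F => Equiv.swap a b • F) from rfl]
      rw [Finset.prod_image (fun F _ G _ e => smul_left_cancel _ e)]
      apply Finset.prod_congr rfl
      intro F hF
      rw [← Finset.smul_finset_sdiff, tv_swap_smul_eq]
      have hzF : x.1.1 ∉ F := fun hh => by simpa using h2.1 F hF hh
      have key : ∀ c ∈ insert x.1.1 x.2, c ∉ F \ x.2 := by
        intro c hc hcF
        rcases Finset.mem_insert.mp hc with e | e
        · exact hzF (e ▸ (Finset.mem_sdiff.mp hcF).1)
        · exact (Finset.mem_sdiff.mp hcF).2 e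
      exact iff_of_false (key a ha) (key b hb)
    rw [this]
    exact CharTwo.add_self_eq_zero _
  · intro x hx _ heq
    obtain ⟨h1, h2, h3, h4, h5⟩ := fact x hx
    obtain ⟨a, b, ha, hb, hab, hsw⟩ := tvSwap_spec _ (hcard x hx)
    rw [hsw] at heq
    have q1 := congrArg (fun y => y.1.1) heq
    have q2 := congrArg (fun y => y.1.2) heq
    simp only at q1 q2
    have hza : x.1.1 ≠ a := by
      intro e; rw [e] at q1; simp at q1; exact hab q1.symm
    have hzb : x.1.1 ≠ b := by
      intro e; rw [e] at q1; simp at q1; exact hab q1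
    have haM : a ∈ x.2 := (Finset.mem_insert.mp ha).resolve_left hza.symm
    have hbM : b ∈ x.2 := (Finset.mem_insert.mp hb).resolve_left hzb.symm
    obtain ⟨F, hF, haF⟩ := Finset.mem_biUnion.mp (h4 haM)
    obtain ⟨G, hG, hbG⟩ := Finset.mem_biUnion.mp (h4 hbM)
    simp only [id] at haF hbG
    have hbF : b ∉ F := by
      intro hbF
      obtain ⟨c, hc⟩ := Finset.card_eq_one.mp (h5 F hF)
      have t1 : a ∈ F ∩ x.2 := Finset.mem_inter.mpr ⟨haF, haM⟩
      have t2 : b ∈ F ∩ x.2 := Finset.mem_inter.mpr ⟨hbF, hbM⟩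
      rw [hc, Finset.mem_singleton] at t1 t2
      exact hab (t1.trans t2.symm)
    have hFG : F ≠ G := fun e => hbF (e ▸ hbG)
    have hswF : Equiv.swap a b • F ∈ x.1.2 := by
      rw [← q2]; exact Finset.smul_mem_smul_finset hF
    have hbsw : b ∈ Equiv.swap a b • F := by
      rw [← Finset.inv_smul_mem_iff, Equiv.swap_inv]; simpa using haF
    have hGeq : Equiv.swap a b • F = G := by
      by_contra hne
      exact Finset.disjoint_left.mp (h2.2.1 _ hswF _ hG hne) hbsw hbG
    obtain ⟨c, hcF, hca⟩ := Finset.exists_mem_ne (s := F) (by rw [h3 F hF]; omega) a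
    have hcb : c ≠ b := fun e => hbF (e ▸ hcF)
    have hcG : c ∈ G := by
      rw [← hGeq, ← Finset.inv_smul_mem_iff, Equiv.swap_inv, Equiv.Perm.smul_def,
        Equiv.swap_apply_of_ne_of_ne hca hcb]
      exact hcF
    exact Finset.disjoint_left.mp (h2.2.1 _ hF _ hG hFG) hcF hcG
  · intro x hx
    obtain ⟨h1, h2, h3, h4, h5⟩ := fact x hx
    obtain ⟨a, b, ha, hb, hab, hsw⟩ := tvSwap_spec _ (hcard x hx)
    rw [hsw]
    have hWsw : Equiv.swap a b • W = W :=
      tv_swap_smul_eq (iff_of_true (hLsub x hx ha) (hLsub x hx hb))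
    apply fact2
    refine ⟨?_, ?_, ?_, ?_, ?_⟩
    · rw [← hWsw]; exact Finset.smul_mem_smul_finset h1
    · have := h2.smul (Equiv.swap a b)
      rwa [tv_smul_erase, hWsw] at this
    · intro F hF
      obtain ⟨F, hF', rfl⟩ := Finset.mem_smul_finset.mp hF
      rw [Finset.card_smul_finset]; exact h3 F hF'
    · intro i hi
      obtain ⟨i, hi', rfl⟩ := Finset.mem_smul_finset.mp hi
      obtain ⟨F, hF, hiF⟩ := Finset.mem_biUnion.mp (h4 hi')
      exact Finset.mem_biUnion.mpr ⟨_, Finset.smul_mem_smul_finset hF,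
        Finset.smul_mem_smul_finset hiF⟩
    · intro F hF
      obtain ⟨F, hF', rfl⟩ := Finset.mem_smul_finset.mp hF
      simp only
      rw [← Finset.smul_finset_inter, Finset.card_smul_finset]
      exact h5 F hF'
  · intro x hx
    obtain ⟨a, b, ha, hb, hab, hsw⟩ := tvSwap_spec _ (hcard x hx)
    have hL : insert (tvSwap (insert x.1.1 x.2) x.1.1) (tvSwap (insert x.1.1 x.2) • x.2)
        = insert x.1.1 x.2 := by
      rw [show insert (tvSwap (insert x.1.1 x.2) x.1.1) (tvSwap (insert x.1.1 x.2) • x.2)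
        = tvSwap (insert x.1.1 x.2) • (insert x.1.1 x.2) from
          (Finset.smul_finset_insert _ _ _).symm, hsw]
      exact tv_swap_smul_eq (iff_of_true ha hb)
    simp only [hL]
    rw [hsw]
    have hinv : ∀ {α : Type _} [MulAction (Equiv.Perm ι) α] (y : α),
        Equiv.swap a b • Equiv.swap a b • y = y := by
      intro α _ y
      rw [smul_smul, Equiv.swap_mul_self, one_smul]
    rw [hinv, hinv]
    simp


theorem tv_lab {J ι L : Type*} [DecidableEq J] [DecidableEq ι] [Fintype L] [DecidableEq L]
    [Nonempty L] (S : J → Finset ι) (R : J → Finset L) (P : Finset J)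
    (hdis : ∀ F ∈ P, ∀ G ∈ P, F ≠ G → Disjoint (S F) (S G))
    (hcap : ∀ F ∈ P, (S F).card + (R F).card ≤ Fintype.card L) :
    ∀ A : Finset L, A.card ≤ ∑ F ∈ P, (Fintype.card L - (S F).card - (R F).card) →
    ∃ t : ι → L, (∀ F ∈ P, Set.InjOn t (S F) ∧ ∀ i ∈ S F, t i ∉ R F) ∧
      ∀ k ∈ A, ∃ F ∈ P, ∀ i ∈ S F, t i ≠ k := by
  induction P using Finset.induction_on with
  | empty =>
    intro A hA
    simp at hA
    subst hA
    exact ⟨fun _ => Classical.arbitrary L, by simp, by simp⟩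
  | insert F P hF ih =>
    intro A hA
    have ih' := ih (fun A hA B hB => hdis A (by simp [hA]) B (by simp [hB]))
      (fun A hA => hcap A (by simp [hA]))
    rw [Finset.sum_insert hF] at hA
    have hcF := hcap F (by simp)
    obtain ⟨B, hBA, hBc⟩ := Finset.exists_subset_card_eq
      (s := A) (n := min A.card (Fintype.card L - (S F).card - (R F).card)) (min_le_left _ _)
    obtain ⟨t', ht', hk'⟩ := ih' (A \ B) (by rw [Finset.card_sdiff_of_subset hBA]; omega)
    have hcc : (S F).card ≤ ((R F ∪ B)ᶜ).card := by
      rw [Finset.card_compl]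
      have := Finset.card_union_le (R F) B
      omega
    obtain ⟨f⟩ : Nonempty ((S F) ↪ ((R F ∪ B)ᶜ : Finset L)) :=
      Function.Embedding.nonempty_of_card_le
        (by rw [Fintype.card_coe, Fintype.card_coe]; exact hcc)
    let t : ι → L := fun i => if h : i ∈ S F then (f ⟨i, h⟩ : L) else t' i
    have htF : ∀ i (h : i ∈ S F), t i = f ⟨i, h⟩ := fun i h => by simp [t, h]
    have htG : ∀ G ∈ P, ∀ i ∈ S G, t i = t' i := by
      intro G hG i hi
      have hne : F ≠ G := fun e => hF (e ▸ hG)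
      have : i ∉ S F := fun h =>
        Finset.disjoint_left.mp (hdis F (by simp) G (by simp [hG]) hne) h hi
      simp [t, this]
    have hav : ∀ i ∈ S F, t i ∉ R F ∧ t i ∉ B := by
      intro i hi
      rw [htF i hi]
      have := (f ⟨i, hi⟩).2
      simpa [not_or] using this
    refine ⟨t, ?_, ?_⟩
    · intro G hG
      rcases Finset.mem_insert.mp hG with rfl | hG
      · refine ⟨?_, fun i hi => (hav i hi).1⟩
        intro i hi j hj hij
        rw [htF i hi, htF j hj] at hij
        have := f.injective (Subtype.ext hij)
        simpa using this
      · refine ⟨?_, ?_⟩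
        · intro i hi j hj hij
          rw [htG G hG i hi, htG G hG j hj] at hij
          exact (ht' G hG).1 hi hj hij
        · intro i hi
          rw [htG G hG i hi]
          exact (ht' G hG).2 i hi
    · intro k hk
      by_cases hkB : k ∈ B
      · exact ⟨F, by simp, fun i hi e => (hav i hi).2 (e ▸ hkB)⟩
      · obtain ⟨G, hG, h⟩ := hk' k (by simp [hk, hkB])
        exact ⟨G, by simp [hG], fun i hi => by rw [htG G hG i hi]; exact h i hi⟩

def tvHat {R κ : Type*} [CommRing R] {d : ℕ} (x : κ → Fin d → R) (j : κ) : Option (Fin d) → R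
  | none => 1
  | some k => x j k

def tvMat {R κ ι : Type*} [CommRing R] [DecidableEq ι] {d : ℕ} (P : Finset (Finset ι))
    (c : ι → Prop) (e : ι → κ) (x : κ → Fin d → R) :
    Matrix ({F // F ∈ P} × Option (Fin d)) ({i // c i} ⊕ Option (Fin d)) R :=
  Matrix.of fun Fk y => Sum.elim (fun i : {i // c i} =>
    if i.1 ∈ Fk.1.1 then tvHat x (e i.1) Fk.2 else 0) (fun l => if Fk.2 = l then -1 else 0) y

theorem tvMat_map {R R' κ ι : Type*} [CommRing R] [CommRing R'] [DecidableEq ι] {d : ℕ}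
    (P : Finset (Finset ι)) (c : ι → Prop) (e : ι → κ) (x : κ → Fin d → R) (φ : R →+* R') :
    (tvMat P c e x).map φ = tvMat P c e (fun j k => φ (x j k)) := by
  ext ⟨F, k⟩ y
  rcases y with i | l
  · simp only [tvMat, Matrix.map_apply, Matrix.of_apply, Sum.elim_inl]
    split_ifs
    · cases k <;> simp [tvHat]
    · simp
  · simp only [tvMat, Matrix.map_apply, Matrix.of_apply, Sum.elim_inr]
    split_ifs <;> simp

theorem tvMat_mulVec {κ ι : Type*} [Fintype ι] [DecidableEq ι] {d : ℕ}
    (P : Finset (Finset ι)) (c : ι → Prop) [Fintype {i // c i}] (e : ι → κ) (x : κ → Fin d → ℝ)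
    (l : ι → ℝ) (hl : ∀ i, l i ≠ 0 → (∃ F ∈ P, i ∈ F) → c i) (w : Option (Fin d) → ℝ) (Fk) :
    (tvMat P c e x).mulVec (Sum.elim (fun i => l i.1) w) Fk =
      (∑ i ∈ Fk.1.1, l i * tvHat x (e i) Fk.2) - w Fk.2 := by
  classical
  obtain ⟨⟨F, hF⟩, k⟩ := Fk
  simp only [Matrix.mulVec, dotProduct, Fintype.sum_sum_type, tvMat, Matrix.of_apply,
    Sum.elim_inl, Sum.elim_inr]
  rw [sub_eq_add_neg]
  congr 1
  · have h1 : ∑ i : {i // c i}, (if i.1 ∈ F then tvHat x (e i.1) k else 0) * l i.1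
      = ∑ i ∈ Finset.univ.filter c, (if i ∈ F then tvHat x (e i) k else 0) * l i := by
      rw [← Finset.sum_subtype (p := c) (Finset.univ.filter c) (by simp)
        (fun i => (if i ∈ F then tvHat x (e i) k else 0) * l i)]
    rw [h1, Finset.sum_filter, ← Finset.sum_filter_add_sum_filter_not Finset.univ (fun i => i ∈ F)]
    rw [Finset.sum_eq_zero (s := Finset.univ.filter (fun i => i ∉ F))]
    · rw [add_zero]
      have : Finset.univ.filter (fun i => i ∈ F) = F := by ext; simp
      rw [this]
      apply Finset.sum_congr rfl
      intro i hi
      by_cases hli : l i = 0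
      · simp [hli]
      · rw [if_pos (hl i hli ⟨F, hF, hi⟩), if_pos hi, mul_comm]
    · intro i hi
      simp at hi
      simp [hi]
  · simp

theorem tv_generic {κ ι : Type*} [Fintype ι] [DecidableEq ι] {d : ℕ} (u : κ → Fin d → ℝ)
    (hu : AlgebraicIndependent ℚ (fun p : κ × Fin d => u p.1 p.2)) (e : ι → κ)
    (P : Finset (Finset ι)) (s : Finset ι) (t : κ → Option (Fin d))
    (ht1 : ∀ F ∈ P, ∀ i ∈ F, ∀ j ∈ F, i ∈ s → j ∈ s → t (e i) = t (e j) → i = j)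
    (ht2 : ∀ k, ∃ F ∈ P, ∀ i ∈ F, i ∈ s → t (e i) ≠ k)
    (l : ι → ℝ) (hl : ∀ i, i ∉ s → l i = 0) (w : Option (Fin d) → ℝ)
    (hrel : ∀ F ∈ P, ∀ k, ∑ i ∈ F, l i * tvHat u (e i) k = w k) :
    ∀ F ∈ P, ∀ i ∈ F, l i = 0 := by
  classical
  by_contra hcon
  push Not at hcon
  obtain ⟨F0, hF0, i0, hi0, hli0⟩ := hcon
  let c : ι → Prop := fun i => i ∈ s ∧ ∃ F ∈ P, i ∈ F
  let D : MvPolynomial (κ × Fin d) ℚ :=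
    ((tvMat P c e (fun j k => (MvPolynomial.X (j, k) : MvPolynomial (κ × Fin d) ℚ))).transpose *
      (tvMat P c e (fun j k => (MvPolynomial.X (j, k) : MvPolynomial (κ × Fin d) ℚ)))).det
  have hD : ∀ x : κ → Fin d → ℝ, MvPolynomial.aeval (fun p : κ × Fin d => x p.1 p.2) D =
      ((tvMat P c e x).transpose * tvMat P c e x).det := by
    intro x
    have := RingHom.map_det (MvPolynomial.aeval (R := ℚ) (fun p : κ × Fin d => x p.1 p.2)).toRingHom
      ((tvMat P c e (fun j k => (MvPolynomial.X (j, k) : MvPolynomial (κ × Fin d) ℚ))).transpose *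
      (tvMat P c e (fun j k => (MvPolynomial.X (j, k) : MvPolynomial (κ × Fin d) ℚ))))
    refine this.trans ?_
    rw [RingHom.mapMatrix_apply, Matrix.map_mul, Matrix.transpose_map, tvMat_map]
    congr 3 <;> (try ext) <;> simp
  have hcl : ∀ i, l i ≠ 0 → (∃ F ∈ P, i ∈ F) → c i := fun i h1 h2 =>
    ⟨by_contra fun h => h1 (hl i h), h2⟩
  have hu0 : ((tvMat P c e u).transpose * tvMat P c e u).det = 0 := by
    rw [← Matrix.exists_mulVec_eq_zero_iff]
    refine ⟨Sum.elim (fun i => l i.1) w, ?_, ?_⟩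
    · intro h
      have := congrFun h (Sum.inl ⟨i0, hcl i0 hli0 ⟨F0, hF0, hi0⟩⟩)
      exact hli0 (by simpa using this)
    · rw [← Matrix.mulVec_mulVec]
      have : (tvMat P c e u).mulVec (Sum.elim (fun i => l i.1) w) = 0 := by
        ext Fk
        rw [tvMat_mulVec P c e u l hcl w Fk, hrel Fk.1.1 Fk.1.2 Fk.2]
        simp
      rw [this, Matrix.mulVec_zero]
  rw [← hD] at hu0
  have hD0 : D = 0 := hu.eq_zero_of_aeval_eq_zero D hu0
  let x : κ → Fin d → ℝ := fun j k => if t j = some k then 1 else 0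
  have hx0 := hD x
  rw [hD0, map_zero] at hx0
  obtain ⟨y, hy0, hy⟩ := Matrix.exists_mulVec_eq_zero_iff.mpr hx0.symm
  have hMy : (tvMat P c e x).mulVec y = 0 := by
    have h1 : y ∈ LinearMap.ker ((tvMat P c e x).transpose * tvMat P c e x).mulVecLin := by
      rw [LinearMap.mem_ker, Matrix.mulVecLin_apply]
      exact hy
    rw [Matrix.ker_mulVecLin_transpose_mul_self] at h1
    simpa using h1
  let l' : ι → ℝ := fun i => if h : c i then y (Sum.inl ⟨i, h⟩) else 0
  let w' : Option (Fin d) → ℝ := fun k => y (Sum.inr k)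
  have hy' : y = Sum.elim (fun i => l' i.1) w' := by
    ext z
    rcases z with ⟨i, hi⟩ | k
    · simp [l', hi]
    · simp [w']
  have hl's : ∀ i, i ∉ s → l' i = 0 := by
    intro i hi
    simp only [l']
    rw [dif_neg]
    exact fun h => hi h.1
  have hrel' : ∀ F ∈ P, ∀ k, ∑ i ∈ F, l' i * tvHat x (e i) k = w' k := by
    intro F hF k
    have h1 := congrFun hMy (⟨F, hF⟩, k)
    rw [hy', tvMat_mulVec P c e x l' (fun i h1 h2 => ⟨by_contra fun h => h1 (hl's i h), h2⟩)] at h1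
    simpa [sub_eq_zero] using h1
  have s1 : ∀ k : Fin d, w' (some k) = 0 := by
    intro k
    obtain ⟨F, hF, hk⟩ := ht2 (some k)
    rw [← hrel' F hF]
    apply Finset.sum_eq_zero
    intro i hi
    by_cases his : i ∈ s
    · simp [tvHat, x, hk i hi his]
    · simp [hl's i his]
  have s2 : ∀ F ∈ P, ∀ i ∈ F, t (e i) ≠ none → l' i = 0 := by
    intro F hF i hi hne
    by_cases his : i ∈ s
    swap
    · exact hl's i his
    obtain ⟨k, hk⟩ := Option.ne_none_iff_exists'.mp hne
    have h1 := hrel' F hF (some k)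
    rw [s1, Finset.sum_eq_single_of_mem i hi] at h1
    · simpa [tvHat, x, hk] using h1
    · intro j hj hji
      by_cases hjs : j ∈ s
      · have : t (e j) ≠ some k := fun h => hji (ht1 F hF j hj i hi hjs his (h.trans hk.symm))
        simp [tvHat, x, this]
      · simp [hl's j hjs]
  have s3 : w' none = 0 := by
    obtain ⟨F, hF, hk⟩ := ht2 none
    rw [← hrel' F hF]
    apply Finset.sum_eq_zero
    intro i hi
    by_cases his : i ∈ s
    · simp [s2 F hF i hi (hk i hi his)]
    · simp [hl's i his]
  have s4 : ∀ F ∈ P, ∀ i ∈ F, l' i = 0 := by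
    intro F hF i hi
    by_cases hne : t (e i) = none
    swap
    · exact s2 F hF i hi hne
    by_cases his : i ∈ s
    swap
    · exact hl's i his
    have h1 := hrel' F hF none
    rw [s3, Finset.sum_eq_single_of_mem i hi] at h1
    · simpa [tvHat] using h1
    · intro j hj hji
      by_cases hjs : j ∈ s
      · rw [s2 F hF j hj, zero_mul]
        exact fun h => hji (ht1 F hF j hj i hi hjs his (h.trans hne.symm))
      · simp [hl's j hjs]
  apply hy0
  rw [hy']
  ext z
  rcases z with ⟨i, hi⟩ | k
  · obtain ⟨F, hF, hiF⟩ := hi.2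
    simpa using s4 F hF i hiF
  · cases k
    · simpa using s3
    · simpa using s1 _

theorem tv_single {ι : Type*} {d : ℕ} [DecidableEq ι] (v : ι → EuclideanSpace ℝ (Fin d))
    (S : Finset ι) (p : EuclideanSpace ℝ (Fin d)) (hp : p ∈ convexHull ℝ (v '' S)) :
    ∃ w : ι → ℝ, (∀ i, 0 ≤ w i) ∧ (∀ i, w i ≠ 0 → i ∈ S) ∧ ∑ i ∈ S, w i = 1 ∧
      ∑ i ∈ S, w i • v i = p ∧ (S.filter (fun i => w i ≠ 0)).card ≤ d + 1 := by
  classical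
  rw [convexHull_eq_union] at hp
  simp only [Set.mem_iUnion] at hp
  obtain ⟨T, hT, hai, hp⟩ := hp
  have hTc : T.card ≤ d + 1 := by
    have := hai.card_le_finrank_succ
    simp only [Fintype.card_coe] at this
    refine this.trans ?_
    have h2 := Submodule.finrank_le (vectorSpan ℝ (Set.range (Subtype.val : T → EuclideanSpace ℝ (Fin d))))
    rw [finrank_euclideanSpace_fin] at h2
    omega
  rw [Finset.mem_convexHull'] at hp
  obtain ⟨w, hw0, hw1, hwp⟩ := hp
  have hsec : ∀ τ ∈ T, ∃ i ∈ S, v i = τ := fun τ hτ => by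
    have := hT hτ
    simpa using this
  have : Nonempty ι := by
    have hTne : T.Nonempty := by
      rw [Finset.nonempty_iff_ne_empty]
      intro h
      rw [h] at hw1
      simp at hw1
    obtain ⟨τ, hτ⟩ := hTne
    obtain ⟨i, -, -⟩ := hsec τ hτ
    exact ⟨i⟩
  choose! σ hσS hσ using hsec
  have hinj : Set.InjOn σ (T : Set (EuclideanSpace ℝ (Fin d))) := by
    intro a ha b hb hab
    rw [← hσ a ha, ← hσ b hb, hab]
  have hsub : T.image σ ⊆ S := by
    intro i hi
    obtain ⟨τ, hτ, rfl⟩ := Finset.mem_image.mp hi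
    exact hσS τ hτ
  refine ⟨fun i => if i ∈ T.image σ then w (v i) else 0, ?_, ?_, ?_, ?_, ?_⟩
  · intro i
    simp only
    split_ifs with h
    · obtain ⟨τ, hτ, rfl⟩ := Finset.mem_image.mp h
      rw [hσ τ hτ]; exact hw0 τ hτ
    · exact le_rfl
  · intro i hi
    by_contra h
    apply hi
    exact if_neg (fun h' => h (hsub h'))
  · rw [← Finset.sum_subset hsub (by intro i _ h; simp only [if_neg h]), Finset.sum_image hinj, ← hw1]
    apply Finset.sum_congr rfl
    intro τ hτ
    rw [if_pos (Finset.mem_image_of_mem _ hτ), hσ τ hτ]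
  · rw [← Finset.sum_subset hsub (by intro i _ h; simp only [if_neg h, zero_smul]),
      Finset.sum_image hinj, ← hwp]
    apply Finset.sum_congr rfl
    intro τ hτ
    simp only
    rw [if_pos (Finset.mem_image_of_mem _ hτ), hσ τ hτ]
  · refine le_trans (Finset.card_le_card (t := T.image σ) ?_) (Finset.card_image_le.trans hTc)
    intro i hi
    by_contra h
    simp only [Finset.mem_filter] at hi
    exact hi.2 (if_neg h)

theorem tv_glue {ι : Type*} {d : ℕ} [DecidableEq ι] (v : ι → EuclideanSpace ℝ (Fin d))
    (P : Finset (Finset ι)) (hP : ∀ F ∈ P, ∀ G ∈ P, F ≠ G → Disjoint F G)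
    (s : Finset ι) (p : EuclideanSpace ℝ (Fin d))
    (hp : ∀ F ∈ P, p ∈ convexHull ℝ (v '' (F ∩ s : Finset ι))) :
    ∃ l : ι → ℝ, (∀ i, 0 ≤ l i) ∧ (∀ i, l i ≠ 0 → i ∈ s ∧ ∃ F ∈ P, i ∈ F) ∧
      ∀ F ∈ P, ∑ i ∈ F, l i = 1 ∧ ∑ i ∈ F, l i • v i = p ∧
        (F.filter (fun i => l i ≠ 0)).card ≤ d + 1 := by
  classical
  have := fun F (hF : F ∈ P) => tv_single v (F ∩ s) p (hp F hF)
  choose! w hw0 hwS hw1 hwp hwc using this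
  have hzero : ∀ F ∈ P, ∀ i, i ∉ F → w F i = 0 := by
    intro F hF i hi
    by_contra h
    exact hi (Finset.mem_inter.mp (hwS F hF i h)).1
  have hl : ∀ F ∈ P, ∀ i ∈ F, ∑ G ∈ P, w G i = w F i := by
    intro F hF i hi
    apply Finset.sum_eq_single_of_mem F hF
    intro G hG hGF
    exact hzero G hG i (fun h => Finset.disjoint_left.mp (hP G hG F hF hGF) h hi)
  refine ⟨fun i => ∑ F ∈ P, w F i, ?_, ?_, ?_⟩
  · intro i
    exact Finset.sum_nonneg (fun F hF => hw0 F hF i)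
  · intro i hi
    obtain ⟨F, hF, h⟩ := Finset.exists_ne_zero_of_sum_ne_zero hi
    have := Finset.mem_inter.mp (hwS F hF i h)
    exact ⟨this.2, F, hF, this.1⟩
  · intro F hF
    have hsub : F ∩ s ⊆ F := Finset.inter_subset_left
    have hz : ∀ i ∈ F, i ∉ F ∩ s → w F i = 0 := fun i _ h => by
      by_contra h'
      exact h (hwS F hF i h')
    refine ⟨?_, ?_, ?_⟩
    · rw [Finset.sum_congr rfl (hl F hF), ← Finset.sum_subset hsub hz]
      exact hw1 F hF
    · have h1 : ∑ i ∈ F, (∑ G ∈ P, w G i) • v i = ∑ i ∈ F, w F i • v i :=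
        Finset.sum_congr rfl (fun i hi => by rw [hl F hF i hi])
      have h2 : ∑ i ∈ F ∩ s, w F i • v i = ∑ i ∈ F, w F i • v i :=
        Finset.sum_subset hsub (fun i h1 h2 => by rw [hz i h1 h2, zero_smul])
      rw [h1, ← h2]
      exact hwp F hF
    · refine le_trans (Finset.card_le_card ?_) (hwc F hF)
      intro i hi
      simp only [Finset.mem_filter] at hi ⊢
      rw [hl F hF i hi.1] at hi
      exact ⟨hwS F hF i hi.2, hi.2⟩


theorem tv_lemA {κ ι : Type*} [Fintype ι] [DecidableEq ι] {d : ℕ} (u : κ → Fin d → ℝ)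
    (hu : AlgebraicIndependent ℚ (fun p : κ × Fin d => u p.1 p.2)) (e : ι → κ)
    (P : Finset (Finset ι)) (hP : ∀ F ∈ P, ∀ G ∈ P, F ≠ G → Disjoint F G) (s : Finset ι)
    (he : ∀ i ∈ s, ∀ j ∈ s, e i = e j → i = j)
    (hc : ∀ F ∈ P, (F ∩ s).card ≤ d + 1)
    (hsum : d + 1 ≤ ∑ F ∈ P, (d + 1 - (F ∩ s).card))
    (l : ι → ℝ) (hl : ∀ i, i ∉ s → l i = 0) (w : Option (Fin d) → ℝ)
    (hrel : ∀ F ∈ P, ∀ k, ∑ i ∈ F, l i * tvHat u (e i) k = w k) :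
    ∀ F ∈ P, ∀ i ∈ F, l i = 0 := by
  classical
  obtain ⟨t0, h1, h2⟩ := tv_lab (L := Option (Fin d)) (fun F : Finset ι => F ∩ s) (fun _ => ∅) P
    (fun F hF G hG h => (hP F hF G hG h).mono Finset.inter_subset_left Finset.inter_subset_left)
    (fun F hF => by simpa using hc F hF) Finset.univ (by simpa using hsum)
  let t : κ → Option (Fin d) := fun k =>
    if h : ∃ i, i ∈ s ∧ e i = k then t0 (Classical.choose h) else none
  have ht : ∀ i ∈ s, t (e i) = t0 i := by
    intro i hi
    have h : ∃ j, j ∈ s ∧ e j = e i := ⟨i, hi, rfl⟩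
    have h3 := Classical.choose_spec h
    simp only [t, dif_pos h]
    rw [he _ h3.1 _ hi h3.2]
  refine tv_generic u hu e P s t ?_ ?_ l hl w hrel
  · intro F hF i hi j hj his hjs hij
    rw [ht i his, ht j hjs] at hij
    exact (h1 F hF).1 (by simp [hi, his]) (by simp [hj, hjs]) hij
  · intro k
    obtain ⟨F, hF, h⟩ := h2 k (by simp)
    refine ⟨F, hF, fun i hi his => ?_⟩
    rw [ht i his]
    exact h i (by simp [hi, his])

/-- merging the clone: total relation after moving the weight of the clone -/
theorem tv_update_sum {ι : Type*} [DecidableEq ι] (F : Finset ι) (l : ι → ℝ) (h : ι → ℝ)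
    (i : ι) (hi : i ∈ F) (c : ℝ) :
    ∑ j ∈ F, Function.update l i c j * h j = ∑ j ∈ F, l j * h j + (c - l i) * h i := by
  rw [← Finset.add_sum_erase _ _ hi, ← Finset.add_sum_erase F (fun j => l j * h j) hi]
  rw [Finset.sum_congr rfl (g := fun j => l j * h j)]
  · simp; ring
  · intro j hj
    rw [Function.update_of_ne (Finset.ne_of_mem_erase hj)]

theorem tv_update_sum_not {ι : Type*} [DecidableEq ι] (F : Finset ι) (l : ι → ℝ) (h : ι → ℝ)
    (i : ι) (hi : i ∉ F) (c : ℝ) :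
    ∑ j ∈ F, Function.update l i c j * h j = ∑ j ∈ F, l j * h j := by
  apply Finset.sum_congr rfl
  intro j hj
  rw [Function.update_of_ne]
  rintro rfl
  exact hi hj

theorem tv_star {κ : Type*} [Fintype κ] [DecidableEq κ] {d : ℕ}
    (u : κ → EuclideanSpace ℝ (Fin d))
    (hu : AlgebraicIndependent ℚ (fun p : κ × Fin d => u p.1 p.2)) (a : κ)
    (P : Finset (Finset (Option κ))) (hP : ∀ F ∈ P, ∀ G ∈ P, F ≠ G → Disjoint F G)
    (s0 : Finset (Option κ)) (p : EuclideanSpace ℝ (Fin d))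
    (hp : ∀ F ∈ P, p ∈ convexHull ℝ ((fun o : Option κ => u (o.getD a)) '' (F ∩ s0 : Finset (Option κ))))
    (hpa : p ≠ u a) :
    ∑ F ∈ P, (d + 1 - (F ∩ s0).card) ≤ d := by
  classical
  by_contra hcon
  push Not at hcon
  obtain ⟨l, hl0, hls, hlF⟩ := tv_glue _ P hP s0 p hp
  let e : Option κ → κ := fun o => o.getD a
  let u' : κ → Fin d → ℝ := fun k j => u k j
  let s : Finset (Option κ) := Finset.univ.filter (fun i => l i ≠ 0)
  have hs : ∀ i, i ∈ s ↔ l i ≠ 0 := fun i => by simp [s]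
  have hls' : ∀ i, i ∉ s → l i = 0 := fun i hi => by simpa [hs] using hi
  have hFs : ∀ F : Finset (Option κ), F ∩ s = F.filter (fun i => l i ≠ 0) := fun F => by
    ext i; simp [s]
  have hc : ∀ F ∈ P, (F ∩ s).card ≤ d + 1 := fun F hF => by rw [hFs]; exact (hlF F hF).2.2
  have hsum : d + 1 ≤ ∑ F ∈ P, (d + 1 - (F ∩ s).card) := by
    refine le_trans hcon (Finset.sum_le_sum (fun F hF => ?_))
    have : (F ∩ s).card ≤ (F ∩ s0).card := by
      apply Finset.card_le_card
      intro i hi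
      simp only [Finset.mem_inter] at hi ⊢
      exact ⟨hi.1, (hls i ((hs i).1 hi.2)).1⟩
    omega
  have hPne : P.Nonempty := by
    rw [Finset.nonempty_iff_ne_empty]
    rintro rfl
    simp at hsum
  let w : Option (Fin d) → ℝ := fun k => match k with
    | none => 1
    | some j => p j
  have hrel : ∀ F ∈ P, ∀ k, ∑ i ∈ F, l i * tvHat u' (e i) k = w k := by
    intro F hF k
    cases k with
    | none => simpa [tvHat, w] using (hlF F hF).1
    | some j =>
      have := congrArg (fun x : EuclideanSpace ℝ (Fin d) => x j) (hlF F hF).2.1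
      simpa [tvHat, w, u', e] using this
  have key : ∀ (s' : Finset (Option κ)) (l' : Option κ → ℝ),
      (∀ i ∈ s', ∀ j ∈ s', e i = e j → i = j) → (∀ F ∈ P, (F ∩ s').card ≤ (F ∩ s).card) →
      (∀ i, i ∉ s' → l' i = 0) → (∀ F ∈ P, ∀ k, ∑ i ∈ F, l' i * tvHat u' (e i) k = w k) →
      False := by
    intro s' l' he hcs hl' hrel'
    have := tv_lemA u' hu e P hP s' he (fun F hF => (hcs F hF).trans (hc F hF))
      (hsum.trans (Finset.sum_le_sum fun F hF => by have := hcs F hF; omega)) l' hl' w hrel'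
    obtain ⟨F, hF⟩ := hPne
    have h2 := hrel' F hF none
    rw [Finset.sum_eq_zero (fun i hi => by rw [this F hF i hi, zero_mul])] at h2
    simp [w] at h2
  have einj : ∀ s' : Finset (Option κ), ¬ (some a ∈ s' ∧ none ∈ s') →
      ∀ i ∈ s', ∀ j ∈ s', e i = e j → i = j := by
    intro s' hs' i hi j hj hij
    cases i with
    | none =>
      cases j with
      | none => rfl
      | some j =>
        simp [e] at hij
        subst hij
        exact absurd ⟨hj, hi⟩ hs'
    | some i =>
      cases j with
      | none =>
        simp [e] at hij
        subst hij
        exact absurd ⟨hi, hj⟩ hs'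
      | some j => simpa [e] using hij
  by_cases hboth : some a ∈ s ∧ none ∈ s
  swap
  · exact key s l (einj s hboth) (fun _ _ => le_rfl) hls' hrel
  obtain ⟨has, hys⟩ := hboth
  obtain ⟨-, F1, hF1, haF1⟩ := hls _ ((hs _).1 has)
  obtain ⟨-, F2, hF2, hyF2⟩ := hls _ ((hs _).1 hys)
  have hs1 : ∀ F : Finset (Option κ), (F ∩ s.erase none).card ≤ (F ∩ s).card := fun F =>
    Finset.card_le_card (Finset.inter_subset_inter_left (Finset.erase_subset _ _))
  have hs2 : ¬ (some a ∈ s.erase none ∧ none ∈ s.erase none) := by simp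
  have hother : ∀ F ∈ P, ∀ i, i ∈ F → ∀ G ∈ P, F ≠ G → i ∉ G := fun F hF i hi G hG h =>
    Finset.disjoint_left.mp (hP F hF G hG h) hi
  have hea : ∀ k, tvHat u' (e none) k = tvHat u' a k := fun k => rfl
  have hea' : ∀ k, tvHat u' (e (some a)) k = tvHat u' a k := fun k => rfl
  by_cases h12 : F1 = F2
  · subst h12
    refine key (s.erase none) (Function.update (Function.update l none 0) (some a) (l (some a) + l none))
      (einj _ hs2) (fun F _ => hs1 F) ?_ ?_
    · intro i hi
      by_cases h : i = none
      · subst h; simp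
      · have : i ∉ s := fun h' => hi (Finset.mem_erase.mpr ⟨h, h'⟩)
        have hia : i ≠ some a := by rintro rfl; exact this has
        rw [Function.update_of_ne hia, Function.update_of_ne h]
        exact hls' i this
    · intro F hF k
      by_cases hFF : F1 = F
      · subst hFF
        rw [tv_update_sum _ _ _ _ haF1, tv_update_sum _ _ _ _ hyF2, hrel _ hF1, hea, hea']
        simp
      · rw [tv_update_sum_not _ _ _ _ (hother F1 hF1 _ haF1 F hF hFF),
          tv_update_sum_not _ _ _ _ (hother F1 hF1 _ hyF2 F hF hFF), hrel _ hF]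
  by_cases hB : ∃ F3 ∈ P, F3 ≠ F1 ∧ F3 ≠ F2 ∧ (F3 ∩ s).card ≤ d
  · obtain ⟨F3, hF3, h31, h32, hc3⟩ := hB
    let S : Finset (Option κ) → Finset (Option κ) := fun F => (F ∩ s) \ {some a, none}
    let R : Finset (Option κ) → Finset (Option (Fin d)) := fun F =>
      if F = F1 ∨ F = F2 ∨ F = F3 then {none} else ∅
    have hS1 : (S F1).card + 1 = (F1 ∩ s).card := by
      have : S F1 = (F1 ∩ s).erase (some a) := by
        ext i
        simp only [S, Finset.mem_sdiff, Finset.mem_inter, Finset.mem_insert, Finset.mem_singleton,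
          Finset.mem_erase]
        constructor
        · rintro ⟨h1, h2⟩; exact ⟨fun h => h2 (Or.inl h), h1⟩
        · rintro ⟨h1, h2⟩
          refine ⟨h2, ?_⟩
          rintro (h | h)
          · exact h1 h
          · subst h; exact hother F2 hF2 _ hyF2 F1 hF1 (Ne.symm h12) h2.1
      rw [this, Finset.card_erase_add_one (by simp [haF1, has])]
    have hS2 : (S F2).card + 1 = (F2 ∩ s).card := by
      have : S F2 = (F2 ∩ s).erase none := by
        ext i
        simp only [S, Finset.mem_sdiff, Finset.mem_inter, Finset.mem_insert, Finset.mem_singleton,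
          Finset.mem_erase]
        constructor
        · rintro ⟨h1, h2⟩; exact ⟨fun h => h2 (Or.inr h), h1⟩
        · rintro ⟨h1, h2⟩
          refine ⟨h2, ?_⟩
          rintro (h | h)
          · subst h; exact hother F1 hF1 _ haF1 F2 hF2 h12 h2.1
          · exact h1 h
      rw [this, Finset.card_erase_add_one (by simp [hyF2, hys])]
    have hSle : ∀ F, (S F).card ≤ (F ∩ s).card := fun F => Finset.card_le_card Finset.sdiff_subset
    have hR1 : (R F1).card = 1 := by simp [R]
    have hR2 : (R F2).card = 1 := by simp [R]
    have hR3 : (R F3).card = 1 := by simp [R]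
    have hRo : ∀ F, F ≠ F1 → F ≠ F2 → F ≠ F3 → (R F).card = 0 := fun F h1 h2 h3 => by
      simp [R, h1, h2, h3]
    obtain ⟨t0, ht1, ht2⟩ := tv_lab (L := Option (Fin d)) S R P
      (fun F hF G hG h => (hP F hF G hG h).mono
        (Finset.sdiff_subset.trans Finset.inter_subset_left)
        (Finset.sdiff_subset.trans Finset.inter_subset_left))
      (fun F hF => by
        have hcF := hc F hF
        have := hSle F
        simp only [Fintype.card_option, Fintype.card_fin]
        by_cases h1 : F = F1
        · rw [h1] at hcF this ⊢; omega
        by_cases h2 : F = F2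
        · rw [h2] at hcF this ⊢; omega
        by_cases h3 : F = F3
        · rw [h3] at hcF this ⊢; omega
        have := hRo F h1 h2 h3
        omega) (Finset.univ.erase none) (by
        rw [Finset.card_erase_of_mem (Finset.mem_univ _)]
        simp only [Finset.card_univ, Fintype.card_option, Fintype.card_fin]
        rw [← Finset.add_sum_erase _ _ hF3] at hsum ⊢
        have : ∑ F ∈ P.erase F3, (d + 1 - (F ∩ s).card) ≤
            ∑ F ∈ P.erase F3, (d + 1 - (S F).card - (R F).card) := by
          apply Finset.sum_le_sum
          intro F hF
          have h3 := Finset.ne_of_mem_erase hF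
          have := hSle F
          by_cases h1 : F = F1
          · rw [h1] at *; omega
          by_cases h2 : F = F2
          · rw [h2] at *; omega
          have := hRo F h1 h2 h3
          omega
        have := hSle F3
        omega)
    let t : κ → Option (Fin d) := fun j => if j = a then none else t0 (some j)
    have htS : ∀ i, i ≠ some a → i ≠ none → t (e i) = t0 i := by
      intro i h1 h2
      cases i with
      | none => exact absurd rfl h2
      | some i =>
        have : i ≠ a := fun h => h1 (by rw [h])
        simp [t, e, this]
    have hta : t (e (some a)) = none := by simp [t, e]
    have hty : t (e none) = none := by simp [t, e]
    have hmS : ∀ F i, i ∈ F → i ∈ s → i ≠ some a → i ≠ none → i ∈ S F := by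
      intro F i h1 h2 h3 h4
      simp [S, h1, h2, h3, h4]
    have hRn : ∀ F, (F = F1 ∨ F = F2 ∨ F = F3) → none ∈ R F := fun F h => by simp [R, h]
    have hsp : ∀ F ∈ P, ∀ i ∈ F, (i = some a ∨ i = none) → (F = F1 ∨ F = F2) := by
      intro F hF i hi h
      by_contra hne
      push Not at hne
      rcases h with h | h
      · rw [h] at hi; exact hother F hF _ hi F1 hF1 hne.1 haF1
      · rw [h] at hi; exact hother F hF _ hi F2 hF2 hne.2 hyF2
    have hzero := tv_generic u' hu e P s t ?_ ?_ l hls' w hrel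
    · obtain ⟨F, hF⟩ := hPne
      have h2 := hrel F hF none
      rw [Finset.sum_eq_zero (fun i hi => by rw [hzero F hF i hi, zero_mul])] at h2
      simp [w] at h2
    · have half : ∀ F ∈ P, ∀ i ∈ F, ∀ j ∈ F, i ∈ s → j ∈ s → t (e i) = t (e j) →
          (i = some a ∨ i = none) → i = j := by
        intro F hF i hi j hj his hjs hij hsi
        have hFF := hsp F hF i hi hsi
        by_cases hsj : j = some a ∨ j = none
        · rcases hsi with h | h <;> rcases hsj with h' | h'
          · rw [h, h']
          · exfalso
            rw [h] at hi; rw [h'] at hj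
            have e1 : F = F1 := by
              by_contra hne; exact hother F hF _ hi F1 hF1 hne haF1
            have e2 : F = F2 := by
              by_contra hne; exact hother F hF _ hj F2 hF2 hne hyF2
            exact h12 (e1.symm.trans e2)
          · exfalso
            rw [h] at hi; rw [h'] at hj
            have e1 : F = F1 := by
              by_contra hne; exact hother F hF _ hj F1 hF1 hne haF1
            have e2 : F = F2 := by
              by_contra hne; exact hother F hF _ hi F2 hF2 hne hyF2
            exact h12 (e1.symm.trans e2)
          · rw [h, h']
        · exfalso
          push Not at hsj
          rw [htS j hsj.1 hsj.2] at hij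
          have hin : t (e i) = none := by rcases hsi with h | h <;> rw [h] <;> assumption
          refine (ht1 F hF).2 j (hmS F j hj hjs hsj.1 hsj.2) ?_
          rw [← hij, hin]
          exact hRn F (by tauto)
      intro F hF i hi j hj his hjs hij
      by_cases hsi : i = some a ∨ i = none
      · exact half F hF i hi j hj his hjs hij hsi
      by_cases hsj : j = some a ∨ j = none
      · exact (half F hF j hj i hi hjs his hij.symm hsj).symm
      push Not at hsi hsj
      rw [htS i hsi.1 hsi.2, htS j hsj.1 hsj.2] at hij
      exact (ht1 F hF).1 (hmS F i hi his hsi.1 hsi.2) (hmS F j hj hjs hsj.1 hsj.2) hij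
    · intro k
      cases k with
      | none =>
        refine ⟨F3, hF3, fun i hi his => ?_⟩
        by_cases hsi : i = some a ∨ i = none
        · rcases hsp F3 hF3 i hi hsi with h | h
          · exact absurd h h31
          · exact absurd h h32
        push Not at hsi
        rw [htS i hsi.1 hsi.2]
        intro h
        refine (ht1 F3 hF3).2 i (hmS F3 i hi his hsi.1 hsi.2) ?_
        rw [h]
        exact hRn F3 (by tauto)
      | some k =>
        obtain ⟨F, hF, h⟩ := ht2 (some k) (by simp)
        refine ⟨F, hF, fun i hi his => ?_⟩
        by_cases hsi : i = some a ∨ i = none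
        · have hin : t (e i) = none := by rcases hsi with h | h <;> rw [h] <;> assumption
          rw [hin]; simp
        push Not at hsi
        rw [htS i hsi.1 hsi.2]
        exact h i (hmS F i hi his hsi.1 hsi.2)
  · push Not at hB
    have hsub : ({F1, F2} : Finset (Finset (Option κ))) ⊆ P := by
      intro F hF
      simp only [Finset.mem_insert, Finset.mem_singleton] at hF
      rcases hF with rfl | rfl <;> assumption
    have hs2' : d + 1 ≤ ∑ F ∈ ({F1, F2} : Finset (Finset (Option κ))), (d + 1 - (F ∩ s).card) := by
      refine le_trans hsum (le_of_eq (Finset.sum_subset hsub ?_).symm)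
      intro F hF hne
      simp only [Finset.mem_insert, Finset.mem_singleton, not_or] at hne
      have := hB F hF hne.1 hne.2
      omega
    let l' : Option κ → ℝ :=
      Function.update (Function.update l none 0) (some a) (l (some a) - l none)
    have h0 := tv_lemA u' hu e {F1, F2} (fun F hF G hG => hP F (hsub hF) G (hsub hG)) (s.erase none)
      (einj _ hs2) (fun F hF => (hs1 F).trans (hc F (hsub hF)))
      (hs2'.trans (Finset.sum_le_sum fun F hF => by have := hs1 F; omega)) l' (by
        intro i hi
        by_cases h : i = none
        · subst h; simp [l']
        · have : i ∉ s := fun h' => hi (Finset.mem_erase.mpr ⟨h, h'⟩)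
          have hia : i ≠ some a := by rintro rfl; exact this has
          simp only [l']
          rw [Function.update_of_ne hia, Function.update_of_ne h]
          exact hls' i this) (fun k => w k - l none * tvHat u' a k) (by
        intro F hF k
        simp only [Finset.mem_insert, Finset.mem_singleton] at hF
        rcases hF with rfl | rfl
        · simp only [l']
          rw [tv_update_sum _ _ _ _ haF1,
            tv_update_sum_not _ _ _ _ (hother F2 hF2 _ hyF2 _ hF1 (Ne.symm h12)), hrel _ hF1, hea']
          simp; ring
        · simp only [l']
          rw [tv_update_sum_not _ _ _ _ (hother F1 hF1 _ haF1 _ hF2 h12),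
            tv_update_sum _ _ _ _ hyF2, hrel _ hF2, hea]
          ring)
    have hz : ∀ i ∈ F2, i ≠ none → l i = 0 := by
      intro i hi hne
      have h1 := h0 F2 (by simp) i hi
      have hia : i ≠ some a := by
        rintro rfl
        exact hother F1 hF1 _ haF1 F2 hF2 h12 hi
      simp only [l'] at h1
      rwa [Function.update_of_ne hia, Function.update_of_ne hne] at h1
    obtain ⟨e1, e2, -⟩ := hlF F2 hF2
    rw [Finset.sum_eq_single_of_mem none hyF2 (fun i hi h => hz i hi h)] at e1
    rw [Finset.sum_eq_single_of_mem none hyF2 (fun i hi h => by rw [hz i hi h, zero_smul]),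
      e1, one_smul] at e2
    exact hpa e2.symm


def TvStar {ι : Type*} [DecidableEq ι] {d : ℕ} (v : ι → EuclideanSpace ℝ (Fin d))
    (pa : EuclideanSpace ℝ (Fin d)) : Prop :=
  ∀ (P : Finset (Finset ι)), (∀ F ∈ P, ∀ G ∈ P, F ≠ G → Disjoint F G) →
    ∀ (s0 : Finset ι) (p : EuclideanSpace ℝ (Fin d)),
    (∀ F ∈ P, p ∈ convexHull ℝ (v '' (F ∩ s0 : Finset ι))) → p ≠ pa →
    ∑ F ∈ P, (d + 1 - (F ∩ s0).card) ≤ d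

def TvNe {ι : Type*} [DecidableEq ι] {d : ℕ} (v : ι → EuclideanSpace ℝ (Fin d))
    (pa : EuclideanSpace ℝ (Fin d)) : Prop :=
  ∀ (P : Finset (Finset ι)), (∀ F ∈ P, ∀ G ∈ P, F ≠ G → Disjoint F G) → 3 ≤ P.card →
    ∀ p : EuclideanSpace ℝ (Fin d), (∀ F ∈ P, p ∈ convexHull ℝ (v '' (F : Set ι))) → p ≠ pa

theorem tv_mono {ι : Type*} {d : ℕ} (v : ι → EuclideanSpace ℝ (Fin d)) {F G : Finset ι}
    (h : F ⊆ G) {p : EuclideanSpace ℝ (Fin d)} (hp : p ∈ convexHull ℝ (v '' (F : Set ι))) :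
    p ∈ convexHull ℝ (v '' (G : Set ι)) :=
  convexHull_mono (Set.image_mono (by exact_mod_cast h)) hp

theorem tv_mem {ι : Type*} [DecidableEq ι] {d : ℕ} (v : ι → EuclideanSpace ℝ (Fin d))
    (S s : Finset ι) (l : ι → ℝ) (hl : ∀ i, 0 ≤ l i) (hs : ∀ i, l i ≠ 0 → i ∈ s) (r : ℝ)
    (hr : 0 < r) (p : EuclideanSpace ℝ (Fin d)) (h1 : ∑ i ∈ S, l i = r)
    (h2 : ∑ i ∈ S, l i • v i = r • p) : p ∈ convexHull ℝ (v '' (S ∩ s : Finset ι)) := by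
  have e1 : ∑ i ∈ S ∩ s, l i = r := by
    rw [← h1]
    apply Finset.sum_subset Finset.inter_subset_left
    intro i hi his
    by_contra h
    exact his (Finset.mem_inter.mpr ⟨hi, hs i h⟩)
  have e2 : ∑ i ∈ S ∩ s, l i • v i = r • p := by
    rw [← h2]
    apply Finset.sum_subset Finset.inter_subset_left
    intro i hi his
    by_contra h
    refine his (Finset.mem_inter.mpr ⟨hi, hs i (fun h0 => h ?_)⟩)
    rw [h0, zero_smul]
  have := Finset.centerMass_mem_convexHull (R := ℝ) (s := v '' (S ∩ s : Finset ι)) (S ∩ s) (w := l) (z := v)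
    (fun i _ => hl i) (by rw [e1]; exact hr) (fun i hi => Set.mem_image_of_mem _ hi)
  rw [Finset.centerMass, e1, e2, smul_smul, inv_mul_cancel₀ hr.ne', one_smul] at this
  exact this

theorem TvPart.card_inter {ι : Type*} [DecidableEq ι] {s : Finset ι} {P : Finset (Finset ι)}
    (hP : TvPart s P) (s0 : Finset ι) (h0 : s0 ⊆ s) : ∑ F ∈ P, (F ∩ s0).card = s0.card := by
  rw [← Finset.card_biUnion]
  · congr 1
    ext i
    simp only [Finset.mem_biUnion, Finset.mem_inter]
    constructor
    · rintro ⟨F, -, -, h⟩; exact h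
    · intro h
      obtain ⟨F, hF, hi⟩ := hP.2.2 i (h0 h)
      exact ⟨F, hF, hi, h⟩
  · intro F hF G hG h
    exact (hP.2.1 F hF G hG h).mono Finset.inter_subset_left Finset.inter_subset_left

theorem TvPart.card_sum {ι : Type*} [DecidableEq ι] {s : Finset ι} {P : Finset (Finset ι)}
    (hP : TvPart s P) : ∑ F ∈ P, F.card = s.card := by
  rw [← hP.card_inter s (Finset.Subset.refl _)]
  apply Finset.sum_congr rfl
  intro F hF
  rw [Finset.inter_eq_left.mpr (hP.1 F hF)]

theorem tv_sizes {ι : Type*} [Fintype ι] [DecidableEq ι] {d q : ℕ}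
    (v : ι → EuclideanSpace ℝ (Fin d)) (pa : EuclideanSpace ℝ (Fin d)) (hstar : TvStar v pa)
    (hne : TvNe v pa) (hd : 1 ≤ d) (hq : d + 1 < q)
    (hι : Fintype.card ι = (d + 1) * (q - 1) + 2) (z : ι) (P : Finset (Finset ι))
    (hPc : P.card = q) (hP : TvPart (Finset.univ.erase z) P) (p : EuclideanSpace ℝ (Fin d))
    (hp : ∀ F ∈ P, p ∈ convexHull ℝ (v '' (F : Set ι))) :
    p ≠ pa ∧ (∀ F ∈ P, F.card ≤ d + 1) ∧ ∑ F ∈ P, (d + 1 - F.card) = d := by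
  have hpa := hne P hP.2.1 (by omega) p hp
  refine ⟨hpa, ?_⟩
  have h1 := hstar P hP.2.1 Finset.univ p (by simpa using hp) hpa
  simp only [Finset.inter_univ] at h1
  have h2 := hP.card_sum
  rw [Finset.card_erase_of_mem (Finset.mem_univ _), Finset.card_univ, hι] at h2
  have h3 : ∑ F ∈ P, (d + 1 - F.card) + ∑ F ∈ P, F.card =
      q * (d + 1) + ∑ F ∈ P, (F.card - (d + 1)) := by
    have : q * (d + 1) = ∑ F ∈ P, (d + 1) := by simp [hPc]
    rw [this, ← Finset.sum_add_distrib, ← Finset.sum_add_distrib]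
    apply Finset.sum_congr rfl
    intro F _
    omega
  obtain ⟨q, rfl⟩ : ∃ q', q = q' + 1 := ⟨q - 1, by omega⟩
  simp only [Nat.add_sub_cancel] at h2
  have h4 : ∑ F ∈ P, (F.card - (d + 1)) = 0 ∧ ∑ F ∈ P, (d + 1 - F.card) = d := by
    have h5 : (q + 1) * (d + 1) = (d + 1) * q + d + 1 := by ring
    rw [h5, h2] at h3
    omega
  refine ⟨fun F hF => ?_, h4.2⟩
  have := (Finset.sum_eq_zero_iff.mp h4.1) F hF
  omega

theorem tv_pivotQ {ι : Type*} [Fintype ι] [DecidableEq ι] {d q : ℕ}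
    (v : ι → EuclideanSpace ℝ (Fin d)) (pa : EuclideanSpace ℝ (Fin d)) (hstar : TvStar v pa)
    (hne : TvNe v pa) (hd : 1 ≤ d) (hq : d + 1 < q)
    (hι : Fintype.card ι = (d + 1) * (q - 1) + 2) (Q : Finset (Finset ι))
    (hQc : Q.card = q) (hQ : TvPart Finset.univ Q) :
    Even {z : ι | ∃ p, ∀ F ∈ Q, p ∈ convexHull ℝ (v '' (F.erase z : Finset ι))}.ncard := by
  classical
  obtain ⟨F0, hF0⟩ : Q.Nonempty := by
    rw [← Finset.card_pos]; omega
  let A : Finset ι → ((ι → ℝ) →ₗ[ℝ] ℝ) := fun F => ∑ i ∈ F, LinearMap.proj i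
  let B : Finset ι → ((ι → ℝ) →ₗ[ℝ] EuclideanSpace ℝ (Fin d)) := fun F =>
    ∑ i ∈ F, (LinearMap.proj i : (ι → ℝ) →ₗ[ℝ] ℝ).smulRight (v i)
  have hA : ∀ F l, A F l = ∑ i ∈ F, l i := fun F l => by simp [A]
  have hB : ∀ F l, B F l = ∑ i ∈ F, l i • v i := fun F l => by simp [B]
  let L : (ι → ℝ) →ₗ[ℝ] ({F // F ∈ Q.erase F0} → ℝ × EuclideanSpace ℝ (Fin d)) :=
    LinearMap.pi fun F => LinearMap.prod (A F.1 - A F0) (B F.1 - B F0)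
  have hL : ∀ l, L l = 0 ↔ ∀ F ∈ Q, ∑ i ∈ F, l i = ∑ i ∈ F0, l i ∧
      ∑ i ∈ F, l i • v i = ∑ i ∈ F0, l i • v i := by
    intro l
    constructor
    · intro h F hF
      by_cases hFF : F = F0
      · rw [hFF]; exact ⟨rfl, rfl⟩
      have h1 := congrFun h ⟨F, Finset.mem_erase.mpr ⟨hFF, hF⟩⟩
      simp only [L, LinearMap.pi_apply, LinearMap.prod_apply, Function.prod_apply, LinearMap.sub_apply,
        hA, hB, Pi.zero_apply, Prod.mk_eq_zero, sub_eq_zero] at h1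
      exact h1
    · intro h
      funext F
      have h1 := h F.1 (Finset.mem_of_mem_erase F.2)
      simp only [L, LinearMap.pi_apply, LinearMap.prod_apply, Function.prod_apply, LinearMap.sub_apply,
        hA, hB, Pi.zero_apply, Prod.mk_eq_zero, sub_eq_zero]
      exact h1
  have hnorm : ∀ l : ι → ℝ, (∀ i, 0 ≤ l i) → l ≠ 0 → L l = 0 → ∃ p, ∀ s : Finset ι,
      (∀ i, l i ≠ 0 → i ∈ s) → ∀ F ∈ Q, p ∈ convexHull ℝ (v '' (F ∩ s : Finset ι)) := by
    intro l h0 hn hl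
    rw [hL] at hl
    obtain ⟨i, hi⟩ := Function.ne_iff.mp hn
    obtain ⟨F, hF, hiF⟩ := hQ.2.2 i (Finset.mem_univ _)
    have hr : 0 < ∑ i ∈ F0, l i := by
      rw [← (hl F hF).1]
      exact Finset.sum_pos' (fun j _ => h0 j) ⟨i, hiF, lt_of_le_of_ne (h0 i) (Ne.symm hi)⟩
    refine ⟨(∑ i ∈ F0, l i)⁻¹ • ∑ i ∈ F0, l i • v i, fun s hs G hG => ?_⟩
    refine tv_mem v G s l h0 hs _ hr _ (hl G hG).1 ?_
    rw [smul_smul, mul_inv_cancel₀ hr.ne', one_smul]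
    exact (hl G hG).2
  have hpiv := tv_pivot L ?_ ?_
  · convert hpiv using 3
    ext z
    constructor
    · rintro ⟨p, hp⟩
      obtain ⟨l, h0, h1, h2⟩ := tv_glue v Q hQ.2.1 (Finset.univ.erase z) p (by
        intro F hF
        rw [Finset.inter_erase, Finset.inter_univ]
        exact hp F hF)
      refine ⟨l, h0, ?_, ?_, ?_⟩
      · rintro rfl
        have := (h2 F0 hF0).1
        simp at this
      · rw [hL]
        intro F hF
        rw [(h2 F hF).1, (h2 F hF).2.1, (h2 F0 hF0).1, (h2 F0 hF0).2.1]
        exact ⟨rfl, rfl⟩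
      · by_contra h
        have := (h1 z h).1
        simp at this
    · rintro ⟨l, h0, hn, hl, hz⟩
      obtain ⟨p, hp⟩ := hnorm l h0 hn hl
      refine ⟨p, fun F hF => ?_⟩
      have := hp (Finset.univ.erase z) (fun i hi => by
        simp only [Finset.mem_erase, Finset.mem_univ, and_true]
        rintro rfl
        exact hi hz) F hF
      rwa [Finset.inter_erase, Finset.inter_univ] at this
  · rw [hι]
    simp only [Module.finrank_pi_fintype, Module.finrank_prod, Module.finrank_self,
      finrank_euclideanSpace_fin, Finset.sum_const, Finset.card_univ, Fintype.card_coe,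
      Finset.card_erase_of_mem hF0, hQc, smul_eq_mul]
    apply le_of_eq; ring
  · intro l h0 hn hl i j hi hj
    by_contra hij
    obtain ⟨p, hp⟩ := hnorm l h0 hn hl
    have hp' := hp ((Finset.univ.erase i).erase j) (fun k hk => by
      simp only [Finset.mem_erase, Finset.mem_univ, and_true]
      constructor
      · rintro rfl; exact hk hj
      · rintro rfl; exact hk hi)
    have hpa := hne Q hQ.2.1 (by omega) p (fun F hF => tv_mono v Finset.inter_subset_left (hp' F hF))
    have h1 := hstar Q hQ.2.1 _ p hp' hpa
    have h2 := hQ.card_inter ((Finset.univ.erase i).erase j) (Finset.subset_univ _)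
    rw [Finset.card_erase_of_mem (by simp [Ne.symm hij]),
      Finset.card_erase_of_mem (by simp), Finset.card_univ, hι] at h2
    have h3 : q * (d + 1) ≤ ∑ F ∈ Q, (d + 1 - (F ∩ (Finset.univ.erase i).erase j).card) +
        ∑ F ∈ Q, (F ∩ (Finset.univ.erase i).erase j).card := by
      have : q * (d + 1) = ∑ F ∈ Q, (d + 1) := by simp [hQc]
      rw [this, ← Finset.sum_add_distrib]
      apply Finset.sum_le_sum
      intro F _
      omega
    obtain ⟨q, rfl⟩ : ∃ q', q = q' + 1 := ⟨q - 1, by omega⟩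
    simp only [Nat.add_sub_cancel] at h2
    have h5 : (q + 1) * (d + 1) = (d + 1) * q + d + 1 := by ring
    rw [h5, h2] at h3
    omega


open Classical in
noncomputable def tvSet {ι : Type*} [Fintype ι] {d : ℕ}
    (v : ι → EuclideanSpace ℝ (Fin d)) (q : ℕ) (z : ι) : Finset (Finset (Finset ι)) :=
  Finset.univ.filter (fun P => P.card = q ∧ TvPart (Finset.univ.erase z) P ∧
    ∃ p, ∀ F ∈ P, p ∈ convexHull ℝ (v '' (F : Set ι)))

theorem mem_tvSet {ι : Type*} [Fintype ι] [DecidableEq ι] {d : ℕ}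
    (v : ι → EuclideanSpace ℝ (Fin d)) (q : ℕ) (z : ι) (P : Finset (Finset ι)) :
    P ∈ tvSet v q z ↔ P.card = q ∧ TvPart (Finset.univ.erase z) P ∧
    ∃ p, ∀ F ∈ P, p ∈ convexHull ℝ (v '' (F : Set ι)) := by
  simp only [tvSet, Finset.mem_filter, Finset.mem_univ, true_and]
  have : @Finset.erase ι (fun a b => Classical.propDecidable _) Finset.univ z = Finset.univ.erase z := by
    congr!
  rw [this]

def tvIns {ι : Type*} [DecidableEq ι] (z : ι) (F : Finset ι) (P : Finset (Finset ι)) :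
    Finset (Finset ι) := insert (insert z F) (P.erase F)

theorem mem_tvIns {ι : Type*} [DecidableEq ι] {z : ι} {F G : Finset ι} {P : Finset (Finset ι)} :
    G ∈ tvIns z F P ↔ G = insert z F ∨ (G ≠ F ∧ G ∈ P) := by
  simp [tvIns]

theorem TvPart.unique {ι : Type*} {s : Finset ι} {P : Finset (Finset ι)} (hP : TvPart s P)
    {F G : Finset ι} (hF : F ∈ P) (hG : G ∈ P) {i : ι} (hi : i ∈ F) (hi2 : i ∈ G) : F = G := by
  by_contra h
  exact Finset.disjoint_left.mp (hP.2.1 F hF G hG h) hi hi2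

theorem TvPart.notMem {ι : Type*} [Fintype ι] [DecidableEq ι] {z : ι} {P : Finset (Finset ι)}
    (hP : TvPart (Finset.univ.erase z) P) {F : Finset ι} (hF : F ∈ P) : z ∉ F := fun h => by
  have := hP.1 F hF h
  simp at this

theorem tvIns_card {ι : Type*} [Fintype ι] [DecidableEq ι] {z : ι} {F : Finset ι}
    {P : Finset (Finset ι)} (hP : TvPart (Finset.univ.erase z) P) (hF : F ∈ P) :
    (tvIns z F P).card = P.card := by
  rw [tvIns, Finset.card_insert_of_notMem, Finset.card_erase_add_one hF]
  intro h
  exact hP.notMem (Finset.mem_of_mem_erase h) (Finset.mem_insert_self _ _)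

theorem tvIns_part {ι : Type*} [Fintype ι] [DecidableEq ι] {z : ι} {F : Finset ι}
    {P : Finset (Finset ι)} (hP : TvPart (Finset.univ.erase z) P) (hF : F ∈ P) :
    TvPart Finset.univ (tvIns z F P) := by
  have hd : ∀ G, G ≠ F → G ∈ P → Disjoint (insert z F) G := by
    intro G h1 h2
    rw [Finset.disjoint_insert_left]
    exact ⟨hP.notMem h2, hP.2.1 F hF G h2 (Ne.symm h1)⟩
  refine ⟨fun _ _ => Finset.subset_univ _, ?_, ?_⟩
  · intro G hG H hH hne
    rw [mem_tvIns] at hG hH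
    rcases hG with rfl | hG <;> rcases hH with rfl | hH
    · exact absurd rfl hne
    · exact hd H hH.1 hH.2
    · exact (hd G hG.1 hG.2).symm
    · exact hP.2.1 G hG.2 H hH.2 hne
  · intro i _
    by_cases hi : i = z
    · exact ⟨insert z F, by simp [mem_tvIns], by simp [hi]⟩
    · obtain ⟨G, hG, hiG⟩ := hP.2.2 i (by simp [hi])
      by_cases h : G = F
      · exact ⟨insert z F, by simp [mem_tvIns], by simp [← h, hiG]⟩
      · exact ⟨G, by simp [mem_tvIns, h, hG], hiG⟩

theorem tvIns_image {ι : Type*} [Fintype ι] [DecidableEq ι] {z : ι} {F : Finset ι}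
    {P : Finset (Finset ι)} (hP : TvPart (Finset.univ.erase z) P) (hF : F ∈ P) :
    (tvIns z F P).image (fun G => G.erase z) = P := by
  ext G
  simp only [Finset.mem_image, mem_tvIns]
  constructor
  · rintro ⟨H, rfl | ⟨-, h⟩, rfl⟩
    · rwa [Finset.erase_insert (hP.notMem hF)]
    · rwa [Finset.erase_eq_of_notMem (hP.notMem h)]
  · intro hG
    by_cases h : G = F
    · exact ⟨insert z F, Or.inl rfl, by rw [Finset.erase_insert (hP.notMem hF), h]⟩
    · exact ⟨G, Or.inr ⟨h, hG⟩, Finset.erase_eq_of_notMem (hP.notMem hG)⟩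

theorem tvIns_inj {ι : Type*} [Fintype ι] [DecidableEq ι] {z : ι} {F F' : Finset ι}
    {P P' : Finset (Finset ι)} (hP : TvPart (Finset.univ.erase z) P) (hF : F ∈ P)
    (hP' : TvPart (Finset.univ.erase z) P') (hF' : F' ∈ P') (h : tvIns z F P = tvIns z F' P') :
    F = F' ∧ P = P' := by
  refine ⟨?_, by rw [← tvIns_image hP hF, ← tvIns_image hP' hF', h]⟩
  have h1 : insert z F ∈ tvIns z F' P' := by rw [← h, mem_tvIns]; exact Or.inl rfl
  rw [mem_tvIns] at h1
  rcases h1 with h1 | h1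
  · have := congrArg (fun S => Finset.erase S z) h1
    simpa [Finset.erase_insert (hP.notMem hF), Finset.erase_insert (hP'.notMem hF')] using this
  · exact absurd (Finset.mem_insert_self _ _) (hP'.notMem h1.2)

theorem tvIns_surj {ι : Type*} [Fintype ι] [DecidableEq ι] {d : ℕ}
    (v : ι → EuclideanSpace ℝ (Fin d)) (q : ℕ) (Q : Finset (Finset ι)) (hQc : Q.card = q)
    (hQ : TvPart Finset.univ Q) (z : ι) (p : EuclideanSpace ℝ (Fin d))
    (hp : ∀ F ∈ Q, p ∈ convexHull ℝ (v '' (F.erase z : Finset ι))) :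
    ∃ P ∈ tvSet v q z, ∃ F ∈ P, tvIns z F P = Q := by
  obtain ⟨G, hG, hzG⟩ := hQ.2.2 z (Finset.mem_univ _)
  have hnon : ∀ F ∈ Q, (F.erase z).Nonempty := by
    intro F hF
    have h1 : (convexHull ℝ (v '' (F.erase z : Finset ι))).Nonempty := ⟨p, hp F hF⟩
    rw [convexHull_nonempty_iff, Set.image_nonempty] at h1
    exact_mod_cast h1
  have hinj : ∀ A ∈ Q, ∀ B ∈ Q, A.erase z = B.erase z → A = B := by
    intro A hA B hB h
    obtain ⟨i, hi⟩ := hnon A hA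
    have hi' := hi
    rw [h] at hi'
    exact hQ.unique hA hB (Finset.mem_of_mem_erase hi) (Finset.mem_of_mem_erase hi')
  have hz : ∀ H ∈ Q, H ≠ G → z ∉ H := fun H hH hne hzH => hne (hQ.unique hH hG hzH hzG)
  refine ⟨Q.image (fun F => F.erase z), ?_, G.erase z, Finset.mem_image_of_mem _ hG, ?_⟩
  · rw [mem_tvSet]
    refine ⟨?_, ⟨?_, ?_, ?_⟩, p, ?_⟩
    · rw [Finset.card_image_of_injOn, hQc]
      intro A hA B hB h
      exact hinj A hA B hB h
    · intro F hF
      obtain ⟨A, hA, rfl⟩ := Finset.mem_image.mp hF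
      exact Finset.erase_subset_erase _ (Finset.subset_univ _)
    · intro F hF F' hF' hne
      obtain ⟨A, hA, rfl⟩ := Finset.mem_image.mp hF
      obtain ⟨B, hB, rfl⟩ := Finset.mem_image.mp hF'
      refine (hQ.2.1 A hA B hB (fun h => hne (by rw [h]))).mono (Finset.erase_subset _ _)
        (Finset.erase_subset _ _)
    · intro i hi
      obtain ⟨A, hA, hiA⟩ := hQ.2.2 i (Finset.mem_univ _)
      exact ⟨A.erase z, Finset.mem_image_of_mem _ hA,
        Finset.mem_erase.mpr ⟨Finset.ne_of_mem_erase hi, hiA⟩⟩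
    · intro F hF
      obtain ⟨A, hA, rfl⟩ := Finset.mem_image.mp hF
      exact hp A hA
  · ext H
    rw [mem_tvIns, Finset.insert_erase hzG]
    constructor
    · rintro (rfl | ⟨h1, h2⟩)
      · exact hG
      · obtain ⟨A, hA, rfl⟩ := Finset.mem_image.mp h2
        have : A ≠ G := fun h => h1 (by rw [h])
        rwa [Finset.erase_eq_of_notMem (hz A hA this)]
    · intro hH
      by_cases h : H = G
      · exact Or.inl h
      · refine Or.inr ⟨?_, Finset.mem_image.mpr ⟨H, hH, Finset.erase_eq_of_notMem (hz H hH h)⟩⟩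
        intro h'
        apply h
        apply hinj H hH G hG
        rw [Finset.erase_eq_of_notMem (hz H hH h), h']

open Classical in
noncomputable def tvPairs {ι : Type*} [Fintype ι] {d : ℕ}
    (v : ι → EuclideanSpace ℝ (Fin d)) (q : ℕ) : Finset (ι × Finset (Finset ι)) :=
  Finset.univ.filter (fun b => b.2 ∈ tvSet v q b.1)

theorem tv_count_one {ι : Type*} [Fintype ι] [DecidableEq ι] {z w : ι} (hzw : w ≠ z)
    {P : Finset (Finset ι)} (hP : TvPart (Finset.univ.erase z) P) :
    (P.filter (fun F => ∃ G ∈ tvIns z F P, w ∈ G ∧ z ∈ G)).card = 1 := by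
  obtain ⟨F, hF, hw⟩ := hP.2.2 w (by simp [hzw])
  rw [Finset.card_eq_one]
  refine ⟨F, ?_⟩
  ext H
  simp only [Finset.mem_filter, Finset.mem_singleton]
  constructor
  · rintro ⟨hH, G, hG, hwG, hzG⟩
    rw [mem_tvIns] at hG
    rcases hG with rfl | hG
    · rw [Finset.mem_insert] at hwG
      exact hP.unique hH hF (hwG.resolve_left hzw) hw
    · exact absurd hzG (hP.notMem hG.2)
  · rintro rfl
    exact ⟨hF, insert z H, by simp [mem_tvIns], by simp [hw], by simp⟩

theorem tv_count_other {ι : Type*} [DecidableEq ι] {z x y : ι} (hx : x ≠ z) (hy : y ≠ z)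
    {P : Finset (Finset ι)} :
    (P.filter (fun F => ∃ G ∈ tvIns z F P, x ∈ G ∧ y ∈ G)).card =
      if ∃ F ∈ P, x ∈ F ∧ y ∈ F then P.card else 0 := by
  have hiff : ∀ F ∈ P, (∃ G ∈ tvIns z F P, x ∈ G ∧ y ∈ G) ↔ ∃ F ∈ P, x ∈ F ∧ y ∈ F := by
    intro F hF
    constructor
    · rintro ⟨G, hG, h1, h2⟩
      rw [mem_tvIns] at hG
      rcases hG with rfl | hG
      · rw [Finset.mem_insert] at h1 h2
        exact ⟨F, hF, h1.resolve_left hx, h2.resolve_left hy⟩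
      · exact ⟨G, hG.2, h1, h2⟩
    · rintro ⟨G, hG, h1, h2⟩
      by_cases h : G = F
      · exact ⟨insert z F, by simp [mem_tvIns], by simp [← h, h1], by simp [← h, h2]⟩
      · exact ⟨G, by simp [mem_tvIns, h, hG], h1, h2⟩
  rw [Finset.filter_congr hiff]
  split_ifs with h
  · rw [Finset.filter_true_of_mem (fun _ _ => h)]
  · rw [Finset.filter_false_of_mem (fun _ _ => h), Finset.card_empty]

open Classical in
theorem tv_edges {ι : Type*} [Fintype ι] [DecidableEq ι] {d q : ℕ}
    (v : ι → EuclideanSpace ℝ (Fin d)) (pa : EuclideanSpace ℝ (Fin d)) (hstar : TvStar v pa)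
    (hne : TvNe v pa) (hd : 1 ≤ d) (hq : d + 1 < q)
    (hι : Fintype.card ι = (d + 1) * (q - 1) + 2) (x y : ι) (hxy : x ≠ y) :
    Even ((tvSet v q y).card + (tvSet v q x).card + q * ((tvPairs v q).filter
      (fun b => (x ≠ b.1 ∧ y ≠ b.1) ∧ ∃ F ∈ b.2, x ∈ F ∧ y ∈ F)).card) := by
  let cond : ι × Finset (Finset ι) → Finset ι → Prop := fun b F =>
    ∃ G ∈ tvIns b.1 F b.2, x ∈ G ∧ y ∈ G
  let T : Finset (Σ _ : ι × Finset (Finset ι), Finset ι) :=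
    (tvPairs v q).sigma (fun b => b.2.filter (cond b))
  have hpair : ∀ b, b ∈ tvPairs v q ↔ b.2 ∈ tvSet v q b.1 := fun b => by simp [tvPairs]
  have hTm : ∀ t, t ∈ T ↔ t.1.2 ∈ tvSet v q t.1.1 ∧ t.2 ∈ t.1.2 ∧ cond t.1 t.2 := by
    intro t
    simp only [T, Finset.mem_sigma, hpair, Finset.mem_filter]
  have hT1 : T.card = (tvSet v q y).card + (tvSet v q x).card + q * ((tvPairs v q).filter
      (fun b => (x ≠ b.1 ∧ y ≠ b.1) ∧ ∃ F ∈ b.2, x ∈ F ∧ y ∈ F)).card := by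
    have hfib : ∀ z, ((tvPairs v q).filter (fun b => b.1 = z)).card = (tvSet v q z).card := by
      intro z
      refine Finset.card_bij (fun b _ => b.2) ?_ ?_ ?_
      · rintro ⟨z', P⟩ hb
        simp only [Finset.mem_filter, hpair] at hb
        rw [← hb.2]; exact hb.1
      · rintro ⟨z', P⟩ hb ⟨z'', P'⟩ hb' h
        simp only [Finset.mem_filter] at hb hb' h
        rw [hb.2, hb'.2, h]
      · intro P hP
        exact ⟨(z, P), by simp [hpair, hP], rfl⟩
    rw [← hfib, ← hfib]
    simp only [T, Finset.card_sigma]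
    have : ∀ b ∈ tvPairs v q, (b.2.filter (cond b)).card =
        ((if b.1 = y then 1 else 0) + (if b.1 = x then 1 else 0)) + q * (if (x ≠ b.1 ∧ y ≠ b.1) ∧
          ∃ F ∈ b.2, x ∈ F ∧ y ∈ F then 1 else 0) := by
      rintro ⟨z, P⟩ hb
      rw [hpair, mem_tvSet] at hb
      obtain ⟨hc, hP, -⟩ := hb
      simp only at hc hP
      by_cases h1 : z = y
      · subst h1
        have h2 := tv_count_one hxy hP
        have h3 : z ≠ x := Ne.symm hxy
        simp only [h3, if_true, if_false, ne_eq, not_true, and_false, false_and, mul_zero, add_zero]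
        exact h2
      · by_cases h2 : z = x
        · subst h2
          have h4 := tv_count_one (Ne.symm hxy) hP
          simp only [h1, if_true, if_false, ne_eq, not_true, false_and, mul_zero, add_zero, zero_add]
          rw [← h4]
          congr 1
          apply Finset.filter_congr
          intro F _
          simp only [cond, and_comm]
        · have h3 := tv_count_other (P := P) (Ne.symm h2) (Ne.symm h1)
          have h5 : x ≠ z := Ne.symm h2
          have h6 : y ≠ z := Ne.symm h1
          simp only [h1, h2, h5, h6, if_false, ne_eq, not_false_eq_true, and_self, true_and, zero_add,
            mul_ite, mul_one, mul_zero]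
          rw [← hc]
          convert h3 using 2
    rw [Finset.sum_congr rfl this, Finset.sum_add_distrib, Finset.sum_add_distrib,
      ← Finset.mul_sum, Finset.card_filter, Finset.card_filter, Finset.card_filter]
  rw [← hT1]
  let f : (Σ _ : ι × Finset (Finset ι), Finset ι) → Finset (Finset ι) :=
    fun t => tvIns t.1.1 t.2 t.1.2
  rw [Finset.card_eq_sum_card_image f T]
  apply Finset.even_sum
  intro Q hQ
  obtain ⟨t, ht, htQ⟩ := Finset.mem_image.mp hQ
  rw [hTm, mem_tvSet] at ht
  obtain ⟨⟨hc, hP, -⟩, hF, hcond⟩ := ht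
  have hQp : TvPart Finset.univ Q := by rw [← htQ]; exact tvIns_part hP hF
  have hQc : Q.card = q := by rw [← htQ, ← hc]; exact tvIns_card hP hF
  have hQxy : ∃ G ∈ Q, x ∈ G ∧ y ∈ G := by rw [← htQ]; exact hcond
  have hpiv := tv_pivotQ v pa hstar hne hd hq hι Q hQc hQp
  rw [Set.ncard_eq_toFinset_card'] at hpiv
  refine (congrArg Even ?_).mpr hpiv
  refine Finset.card_bij (fun t _ => t.1.1) ?_ ?_ ?_
  · rintro ⟨⟨z, P⟩, F⟩ ht
    rw [Finset.mem_filter, hTm, mem_tvSet] at ht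
    obtain ⟨⟨⟨hc, hP, p, hp⟩, hF, -⟩, hfQ⟩ := ht
    simp only [Set.mem_toFinset]
    refine ⟨p, fun G hG => ?_⟩
    rw [← hfQ] at hG
    apply hp
    rw [← tvIns_image hP hF]
    exact Finset.mem_image_of_mem _ hG
  · rintro ⟨⟨z, P⟩, F⟩ ht ⟨⟨z', P'⟩, F'⟩ ht' hzz
    simp only at hzz
    subst hzz
    rw [Finset.mem_filter, hTm, mem_tvSet] at ht ht'
    have := tvIns_inj ht.1.1.2.1 ht.1.2.1 ht'.1.1.2.1 ht'.1.2.1 (ht.2.trans ht'.2.symm)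
    simp only at this
    rw [this.1, this.2]
  · intro z hz
    simp only [Set.mem_toFinset] at hz
    obtain ⟨p, hp⟩ := hz
    obtain ⟨P, hP, F, hF, hins⟩ := tvIns_surj v q Q hQc hQp z p hp
    refine ⟨⟨(z, P), F⟩, ?_, rfl⟩
    rw [Finset.mem_filter, hTm]
    exact ⟨⟨hP, hF, by simp only [cond]; rw [hins]; exact hQxy⟩, hins⟩


theorem tv_uniq_aux {ι : Type*} [Fintype ι] [DecidableEq ι] {d : ℕ}
    (v : ι → EuclideanSpace ℝ (Fin d)) (pa : EuclideanSpace ℝ (Fin d)) (hstar : TvStar v pa)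
    (K : Finset (Finset ι)) (hK : ∀ F ∈ K, ∀ G ∈ K, F ≠ G → Disjoint F G)
    (hc : ∀ F ∈ K, F.card ≤ d + 1) (hKne : K.Nonempty)
    (hsum : d ≤ ∑ F ∈ K, (d + 1 - F.card)) (l l' : ι → ℝ) (h0 : ∀ i, 0 ≤ l i)
    (h0' : ∀ i, 0 ≤ l' i) (hs : ∀ i, l i ≠ 0 → ∃ F ∈ K, i ∈ F)
    (p p' : EuclideanSpace ℝ (Fin d)) (hpp : p ≠ p')
    (h1 : ∀ F ∈ K, ∑ i ∈ F, l i = 1 ∧ ∑ i ∈ F, l i • v i = p)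
    (h1' : ∀ F ∈ K, ∑ i ∈ F, l' i = 1 ∧ ∑ i ∈ F, l' i • v i = p') :
    ∃ t : ℝ, 1 ≤ t ∧ p + t • (p' - p) = pa := by
  classical
  let D : Finset ι := Finset.univ.filter (fun i => l' i < l i)
  have hD : D.Nonempty := by
    by_contra hne
    rw [Finset.not_nonempty_iff_eq_empty] at hne
    have hle : ∀ i, l i ≤ l' i := by
      intro i
      by_contra h
      have : i ∈ D := by simp only [D, Finset.mem_filter, Finset.mem_univ, true_and]; exact not_le.mp h
      rw [hne] at this
      simp at this
    obtain ⟨F, hF⟩ := hKne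
    have heq : ∀ i ∈ F, l i = l' i := by
      apply (Finset.sum_eq_sum_iff_of_le (fun i _ => hle i)).mp
      rw [(h1 F hF).1, (h1' F hF).1]
    apply hpp
    rw [← (h1 F hF).2, ← (h1' F hF).2]
    exact Finset.sum_congr rfl (fun i hi => by rw [heq i hi])
  obtain ⟨i0, hi0, hmin⟩ := Finset.exists_min_image D (fun i => l i / (l i - l' i)) hD
  have hi0' : l' i0 < l i0 := by simpa [D] using hi0
  let t : ℝ := l i0 / (l i0 - l' i0)
  have hpos : 0 < l i0 - l' i0 := by linarith
  have ht1 : 1 ≤ t := by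
    rw [le_div_iff₀ hpos]
    have := h0' i0
    linarith
  refine ⟨t, ht1, ?_⟩
  by_contra hne
  let m : ι → ℝ := fun i => l i + t * (l' i - l i)
  have hm0 : ∀ i, 0 ≤ m i := by
    intro i
    by_cases h : l' i < l i
    · have hpi : 0 < l i - l' i := by linarith
      have := hmin i (by simpa [D] using h)
      have h2 : t * (l i - l' i) ≤ l i := by
        rw [← le_div_iff₀ hpi]; exact this
      simp only [m]; nlinarith
    · have := h0 i
      push Not at h
      have : 0 ≤ t * (l' i - l i) := mul_nonneg (by linarith) (by linarith)
      simp only [m]; linarith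
  have hmi0 : m i0 = 0 := by
    have : t * (l i0 - l' i0) = l i0 := div_mul_cancel₀ _ hpos.ne'
    simp only [m]; linarith
  obtain ⟨F0, hF0, hiF0⟩ := hs i0 (by have := h0' i0; intro h; linarith)
  have hst := hstar K hK (Finset.univ.erase i0) (p + t • (p' - p)) (by
    intro F hF
    refine tv_mem v F _ m hm0 ?_ 1 one_pos _ ?_ ?_
    · intro i hi
      simp only [Finset.mem_erase, Finset.mem_univ, and_true]
      rintro rfl
      exact hi hmi0
    · simp only [m]
      rw [Finset.sum_add_distrib, ← Finset.mul_sum, Finset.sum_sub_distrib, (h1 F hF).1, (h1' F hF).1]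
      ring
    · simp only [m]
      rw [one_smul, ← (h1 F hF).2, ← (h1' F hF).2, ← Finset.sum_sub_distrib, Finset.smul_sum,
        ← Finset.sum_add_distrib]
      apply Finset.sum_congr rfl
      intro i _
      rw [← sub_smul, smul_smul, ← add_smul]) hne
  rw [← Finset.add_sum_erase _ _ hF0] at hst hsum
  have h2 : ∑ F ∈ K.erase F0, (d + 1 - F.card) ≤
      ∑ F ∈ K.erase F0, (d + 1 - (F ∩ Finset.univ.erase i0).card) := by
    apply Finset.sum_le_sum
    intro F _
    have : (F ∩ Finset.univ.erase i0).card ≤ F.card := Finset.card_le_card Finset.inter_subset_left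
    omega
  rw [Finset.inter_erase, Finset.inter_univ, Finset.card_erase_of_mem hiF0] at hst
  have := hc F0 hF0
  have := Finset.card_pos.mpr ⟨i0, hiF0⟩
  omega

theorem tv_uniq {ι : Type*} [Fintype ι] [DecidableEq ι] {d : ℕ} (hd : 1 ≤ d)
    (v : ι → EuclideanSpace ℝ (Fin d)) (pa : EuclideanSpace ℝ (Fin d)) (hstar : TvStar v pa)
    (K : Finset (Finset ι)) (hK : ∀ F ∈ K, ∀ G ∈ K, F ≠ G → Disjoint F G)
    (hc : ∀ F ∈ K, F.card ≤ d + 1)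
    (hsum : d ≤ ∑ F ∈ K, (d + 1 - F.card)) (p p' : EuclideanSpace ℝ (Fin d))
    (hp : ∀ F ∈ K, p ∈ convexHull ℝ (v '' (F : Set ι)))
    (hp' : ∀ F ∈ K, p' ∈ convexHull ℝ (v '' (F : Set ι))) : p = p' := by
  by_contra hne
  have hKne : K.Nonempty := by
    rw [Finset.nonempty_iff_ne_empty]
    rintro rfl
    simp at hsum
    omega
  obtain ⟨l, h0, hs, h1⟩ := tv_glue v K hK Finset.univ p (by simpa using hp)
  obtain ⟨l', h0', hs', h1'⟩ := tv_glue v K hK Finset.univ p' (by simpa using hp')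
  obtain ⟨t, ht, e⟩ := tv_uniq_aux v pa hstar K hK hc hKne hsum l l' h0 h0' (fun i hi => (hs i hi).2)
    p p' hne (fun F hF => ⟨(h1 F hF).1, (h1 F hF).2.1⟩) (fun F hF => ⟨(h1' F hF).1, (h1' F hF).2.1⟩)
  obtain ⟨t', ht', e'⟩ := tv_uniq_aux v pa hstar K hK hc hKne hsum l' l h0' h0 (fun i hi => (hs' i hi).2)
    p' p (Ne.symm hne) (fun F hF => ⟨(h1' F hF).1, (h1' F hF).2.1⟩)
    (fun F hF => ⟨(h1 F hF).1, (h1 F hF).2.1⟩)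
  have h2 : (t + t' - 1) • (p' - p) = 0 := by
    have h3 := e.trans e'.symm
    have : (t + t' - 1) • (p' - p) = (p + t • (p' - p)) - (p' + t' • (p - p')) := by module
    rw [this, h3, sub_self]
  rcases smul_eq_zero.mp h2 with h | h
  · linarith
  · exact hne (sub_eq_zero.mp h).symm

theorem tv_pivotU {ι : Type*} [Fintype ι] [DecidableEq ι] {d : ℕ}
    (v : ι → EuclideanSpace ℝ (Fin d)) (pa : EuclideanSpace ℝ (Fin d)) (hstar : TvStar v pa)
    (K : Finset (Finset ι)) (hK : ∀ F ∈ K, ∀ G ∈ K, F ≠ G → Disjoint F G)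
    (hsum : d ≤ ∑ F ∈ K, (d + 1 - F.card)) (p : EuclideanSpace ℝ (Fin d))
    (hp : ∀ F ∈ K, p ∈ convexHull ℝ (v '' (F : Set ι))) (hpa : p ≠ pa)
    (U : Finset ι) (hUK : ∀ F ∈ K, Disjoint U F) (hU : U.card = d + 2)
    [DecidablePred fun F : Finset ι => p ∈ convexHull ℝ (v '' (F : Set ι))] :
    Even (U.filter (fun z => p ∈ convexHull ℝ (v '' (U.erase z : Finset ι)))).card := by
  let L : ({i // i ∈ U} → ℝ) →ₗ[ℝ] EuclideanSpace ℝ (Fin d) :=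
    ∑ i, (LinearMap.proj i : ({i // i ∈ U} → ℝ) →ₗ[ℝ] ℝ).smulRight (v i.1 - p)
  have hL : ∀ l : ι → ℝ, L (fun i => l i.1) = ∑ i ∈ U, l i • v i - (∑ i ∈ U, l i) • p := by
    intro l
    simp only [L, LinearMap.sum_apply, LinearMap.smulRight_apply, LinearMap.proj_apply]
    rw [Finset.sum_coe_sort U (fun i => l i • (v i - p))]
    simp only [smul_sub, Finset.sum_sub_distrib, Finset.sum_smul]
  have hmem : ∀ l : {i // i ∈ U} → ℝ, (∀ i, 0 ≤ l i) → l ≠ 0 → L l = 0 →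
      ∀ s : Finset ι, (∀ i, l i ≠ 0 → i.1 ∈ s) → p ∈ convexHull ℝ (v '' (U ∩ s : Finset ι)) := by
    intro l h0 hn hl s hs
    let m : ι → ℝ := fun i => if h : i ∈ U then l ⟨i, h⟩ else 0
    have hm : ∀ i : {i // i ∈ U}, m i.1 = l i := fun i => by simp [m]
    have hlm : l = fun i : {i // i ∈ U} => m i.1 := by ext i; rw [hm]
    have hm0 : ∀ i, 0 ≤ m i := by
      intro i
      simp only [m]
      split_ifs
      · exact h0 _
      · exact le_rfl
    rw [hlm, hL, sub_eq_zero] at hl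
    obtain ⟨i, hi⟩ := Function.ne_iff.mp hn
    refine tv_mem v U s m hm0 ?_ _ ?_ p rfl hl
    · intro j hj
      simp only [m] at hj
      split_ifs at hj with h
      · exact hs ⟨j, h⟩ hj
      · exact absurd rfl hj
    · refine Finset.sum_pos' (fun j _ => hm0 j) ⟨i.1, i.2, ?_⟩
      rw [hm]
      exact lt_of_le_of_ne (h0 i) (Ne.symm hi)
  have hpiv := tv_pivot L ?_ ?_
  · rw [← Set.ncard_image_of_injective _ Subtype.val_injective] at hpiv
    rw [← Set.ncard_coe_finset]
    refine (congrArg (fun s => Even (Set.ncard s)) ?_).mp hpiv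
    ext z
    simp only [Set.mem_image, Finset.coe_filter]
    constructor
    · rintro ⟨z, ⟨l, h0, hn, hl, hz⟩, rfl⟩
      refine ⟨z.2, ?_⟩
      have := hmem l h0 hn hl (Finset.univ.erase z.1) (fun i hi => by
        simp only [Finset.mem_erase, Finset.mem_univ, and_true]
        intro h
        exact hi (by rw [← hz]; congr 1; exact Subtype.ext h))
      rwa [Finset.inter_erase, Finset.inter_univ] at this
    · rintro ⟨hz, hpz⟩
      obtain ⟨w, h0, hs, h1, h2, -⟩ := tv_single v (U.erase z) p hpz
      have hwz : w z = 0 := by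
        by_contra h
        have := hs z h
        simp at this
      refine ⟨⟨z, hz⟩, ⟨fun i => w i.1, fun i => h0 i, ?_, ?_, hwz⟩, rfl⟩
      · intro h
        have : ∑ i ∈ U.erase z, w i = 0 := by
          apply Finset.sum_eq_zero
          intro i hi
          exact congrFun h ⟨i, Finset.mem_of_mem_erase hi⟩
        rw [h1] at this
        exact one_ne_zero this
      · rw [hL, ← Finset.add_sum_erase _ _ hz, ← Finset.add_sum_erase U w hz, h1, h2, hwz]
        simp
  · rw [finrank_euclideanSpace_fin, Fintype.card_coe, hU]
  · intro l h0 hn hl i j hi hj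
    by_contra hij
    have hij' : i.1 ≠ j.1 := fun h => hij (Subtype.ext h)
    have hD := hmem l h0 hn hl ((Finset.univ.erase i.1).erase j.1) (fun k hk => by
      simp only [Finset.mem_erase, Finset.mem_univ, and_true]
      constructor
      · intro h; exact hk (by rw [← hj]; congr 1; exact Subtype.ext h)
      · intro h; exact hk (by rw [← hi]; congr 1; exact Subtype.ext h))
    rw [Finset.inter_erase, Finset.inter_erase, Finset.inter_univ] at hD
    have hDc : ((U.erase i.1).erase j.1).card = d := by
      rw [Finset.card_erase_of_mem (Finset.mem_erase.mpr ⟨Ne.symm hij', j.2⟩),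
        Finset.card_erase_of_mem i.2, hU]
      omega
    generalize hDD : (U.erase i.1).erase j.1 = D at *
    have hDU : D ⊆ U := by
      rw [← hDD]
      exact (Finset.erase_subset _ _).trans (Finset.erase_subset _ _)
    have hDK : ∀ F ∈ K, Disjoint D F := fun F hF => (hUK F hF).mono_left hDU
    have hDn : D ∉ K := by
      intro h
      have h1 := hDK D h
      rw [Finset.disjoint_self_iff_empty] at h1
      rw [h1] at hD
      simp at hD
    have := hstar (insert D K) (by
      intro F hF G hG hne
      rw [Finset.mem_insert] at hF hG
      rcases hF with rfl | hF <;> rcases hG with rfl | hG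
      · exact absurd rfl hne
      · exact hDK G hG
      · exact (hDK F hF).symm
      · exact hK F hF G hG hne) Finset.univ p (by
      intro F hF
      rw [Finset.inter_univ]
      rw [Finset.mem_insert] at hF
      rcases hF with rfl | hF
      · exact hD
      · exact hp F hF) hpa
    rw [Finset.sum_insert hDn] at this
    simp only [Finset.inter_univ, hDc] at this
    omega


open Classical in
theorem tv_V_even {ι : Type*} [Fintype ι] [DecidableEq ι] {d q : ℕ}
    (v : ι → EuclideanSpace ℝ (Fin d)) (pa : EuclideanSpace ℝ (Fin d)) (hstar : TvStar v pa)
    (hne : TvNe v pa) (hd : 1 ≤ d) (hq : d + 1 < q)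
    (hι : Fintype.card ι = (d + 1) * (q - 1) + 2) (x y : ι) :
    Even ((tvPairs v q).filter
      (fun b => (x ≠ b.1 ∧ y ≠ b.1) ∧ ∃ F ∈ b.2, x ∈ F ∧ y ∈ F)).card := by
  set V := (tvPairs v q).filter
      (fun b => (x ≠ b.1 ∧ y ≠ b.1) ∧ ∃ F ∈ b.2, x ∈ F ∧ y ∈ F) with hV
  have hVm : ∀ b, b ∈ V ↔ b.2 ∈ tvSet v q b.1 ∧ (x ≠ b.1 ∧ y ≠ b.1) ∧ ∃ F ∈ b.2, x ∈ F ∧ y ∈ F := by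
    intro b
    simp [hV, tvPairs]
  clear_value V
  let pr : Finset ι → Prop := fun F => F.card ≠ d + 1 ∨ x ∈ F
  let f : ι × Finset (Finset ι) → Finset (Finset ι) := fun b => b.2.filter pr
  rw [Finset.card_eq_sum_card_image f V]
  apply Finset.even_sum
  intro K hKm
  obtain ⟨⟨z0, P0⟩, hb0, hK0⟩ := Finset.mem_image.mp hKm
  rw [hVm, mem_tvSet] at hb0
  obtain ⟨⟨hc0, hP0, p0, hp0⟩, -, F0, hF0, hxF0, hyF0⟩ := hb0
  simp only at hc0 hP0 hp0 hF0
  obtain ⟨hpa, hsz, hsum⟩ := tv_sizes v pa hstar hne hd hq hι z0 P0 hc0 hP0 p0 hp0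
  simp only [f] at hK0
  have hKmem : ∀ F, F ∈ K ↔ F ∈ P0 ∧ pr F := fun F => by rw [← hK0, Finset.mem_filter]
  have hKP : K ⊆ P0 := fun F hF => ((hKmem F).1 hF).1
  have hKd : ∀ F ∈ K, ∀ G ∈ K, F ≠ G → Disjoint F G := fun F hF G hG =>
    hP0.2.1 F (hKP hF) G (hKP hG)
  have hF0K : F0 ∈ K := (hKmem F0).2 ⟨hF0, Or.inr hxF0⟩
  have hKc : ∀ F ∈ K, F.card ≤ d + 1 := fun F hF => hsz F (hKP hF)
  have hKs : ∑ F ∈ K, (d + 1 - F.card) = d := by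
    refine Eq.trans (Finset.sum_subset hKP ?_) hsum
    intro F hF hn
    rw [hKmem] at hn
    simp only [hF, true_and, pr, not_or, not_not] at hn
    omega
  have hKp : ∀ F ∈ K, p0 ∈ convexHull ℝ (v '' (F : Set ι)) := fun F hF => hp0 F (hKP hF)
  have huniq : ∀ p, (∀ F ∈ K, p ∈ convexHull ℝ (v '' (F : Set ι))) → p = p0 := fun p hp =>
    tv_uniq hd v pa hstar K hKd hKc hKs.ge p p0 hp hKp
  let W : Finset ι := Finset.univ \ K.biUnion id
  have hW : ∀ i, i ∈ W ↔ ∀ F ∈ K, i ∉ F := fun i => by simp [W]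
  let S : Finset (ι × Finset (Finset ι)) := Finset.univ.filter (fun b => b.1 ∈ W ∧
    TvPart (W.erase b.1) b.2 ∧ ∀ F ∈ b.2, F.card = d + 1 ∧ p0 ∈ convexHull ℝ (v '' (F : Set ι)))
  have hS : ∀ b, b ∈ S ↔ b.1 ∈ W ∧ TvPart (W.erase b.1) b.2 ∧
      ∀ F ∈ b.2, F.card = d + 1 ∧ p0 ∈ convexHull ℝ (v '' (F : Set ι)) := fun b => by simp [S]
  have hmap : ∀ z P, P ∈ tvSet v q z → P.filter pr = K → (z, P \ K) ∈ S := by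
    intro z P hP hPK
    rw [mem_tvSet] at hP
    obtain ⟨hc, hP, p, hp⟩ := hP
    have hKP' : K ⊆ P := by rw [← hPK]; exact Finset.filter_subset _ _
    have hpp : p = p0 := huniq p (fun F hF => hp F (hKP' hF))
    rw [hS]
    refine ⟨?_, ⟨?_, ?_, ?_⟩, ?_⟩
    · rw [hW]
      intro F hF
      exact hP.notMem (hKP' hF)
    · intro F hF i hi
      simp only [Finset.mem_sdiff] at hF
      rw [Finset.mem_erase, hW]
      refine ⟨?_, fun G hG hiG => hF.2 ?_⟩
      · rintro rfl; exact hP.notMem hF.1 hi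
      · rw [hP.unique hF.1 (hKP' hG) hi hiG]; exact hG
    · intro F hF G hG h
      exact hP.2.1 F (Finset.mem_sdiff.mp hF).1 G (Finset.mem_sdiff.mp hG).1 h
    · intro i hi
      rw [Finset.mem_erase, hW] at hi
      obtain ⟨F, hF, hiF⟩ := hP.2.2 i (by simpa using hi.1)
      exact ⟨F, Finset.mem_sdiff.mpr ⟨hF, fun h => hi.2 F h hiF⟩, hiF⟩
    · intro F hF
      simp only [Finset.mem_sdiff] at hF
      refine ⟨?_, hpp ▸ hp F hF.1⟩
      have := hF.2
      rw [← hPK, Finset.mem_filter] at this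
      simp only [hF.1, true_and, pr, not_or, not_not] at this
      exact this.1
  have hm0 := hmap z0 P0 (by rw [mem_tvSet]; exact ⟨hc0, hP0, p0, hp0⟩) hK0
  rw [hS] at hm0
  simp only at hm0
  have hSeven : Even S.card := by
    refine tv_flip_even (d + 1) (by omega) W
      (fun F => p0 ∈ convexHull ℝ (v '' (F : Set ι))) ?_ ?_ S hS
    · have hKcard : K.card ≤ d + 1 := by
        have h1 : ∑ F ∈ K.erase F0, 1 ≤ ∑ F ∈ K.erase F0, (d + 1 - F.card) := by
          apply Finset.sum_le_sum
          intro F hF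
          rw [Finset.mem_erase] at hF
          have h2 := (hKmem F).1 hF.2
          have h3 := hsz F h2.1
          rcases h2.2 with h4 | h4
          · omega
          · exact absurd (hP0.unique h2.1 hF0 h4 hxF0) hF.1
        rw [← Finset.add_sum_erase _ _ hF0K] at hKs
        have h5 := Finset.card_erase_add_one hF0K
        simp only [Finset.sum_const, smul_eq_mul, mul_one] at h1
        omega
      obtain ⟨F, hF⟩ : (P0 \ K).Nonempty := by
        rw [← Finset.card_pos, Finset.card_sdiff_of_subset hKP]
        omega
      have h1 := Finset.card_le_card (hm0.2.1.1 F hF)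
      rw [(hm0.2.2 F hF).1] at h1
      have h2 := Finset.card_erase_add_one hm0.1
      omega
    · intro U hUW hUc
      refine tv_pivotU v pa hstar K hKd hKs.ge p0 hKp hpa U ?_ hUc
      intro F hF
      rw [Finset.disjoint_left]
      intro i hi
      exact (hW i).1 (hUW hi) F hF
  refine (congrArg Even ?_).mpr hSeven
  refine Finset.card_bij (fun b _ => (b.1, b.2 \ K)) ?_ ?_ ?_
  · rintro ⟨z, P⟩ hb
    rw [Finset.mem_filter, hVm] at hb
    exact hmap z P hb.1.1 hb.2
  · rintro ⟨z, P⟩ hb ⟨z', P'⟩ hb' h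
    rw [Finset.mem_filter] at hb hb'
    have e1 : K ⊆ P := by rw [← hb.2]; exact Finset.filter_subset _ _
    have e2 : K ⊆ P' := by rw [← hb'.2]; exact Finset.filter_subset _ _
    simp only [Prod.mk.injEq] at h
    rw [h.1, ← Finset.sdiff_union_of_subset e1, h.2, Finset.sdiff_union_of_subset e2]
  · rintro ⟨z, P'⟩ hb
    rw [hS] at hb
    obtain ⟨hzW, hP', hg⟩ := hb
    simp only at hzW hP' hg
    have hPW : ∀ F ∈ P', ∀ i ∈ F, i ∈ W := fun F hF i hi => Finset.mem_of_mem_erase (hP'.1 F hF hi)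
    have hdis : ∀ F ∈ P', ∀ G ∈ K, Disjoint F G := by
      intro F hF G hG
      rw [Finset.disjoint_left]
      intro i hi
      exact (hW i).1 (hPW F hF i hi) G hG
    have hKP' : Disjoint K P' := by
      rw [Finset.disjoint_left]
      intro F hF hF'
      have h1 := hdis F hF' F hF
      rw [Finset.disjoint_self_iff_empty] at h1
      have h2 := (hg F hF').1
      rw [h1] at h2
      simp at h2
    have hzK : ∀ F ∈ K, z ∉ F := (hW z).1 hzW
    have hfil : (K ∪ P').filter pr = K := by
      ext F
      rw [Finset.mem_filter, Finset.mem_union]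
      constructor
      · rintro ⟨h | h, hpr⟩
        · exact h
        · exfalso
          rcases hpr with h1 | h1
          · exact h1 (hg F h).1
          · exact (hW x).1 (hPW F h x h1) F0 hF0K hxF0
      · intro h
        exact ⟨Or.inl h, ((hKmem F).1 h).2⟩
    refine ⟨(z, K ∪ P'), ?_, ?_⟩
    · rw [Finset.mem_filter, hVm, mem_tvSet]
      refine ⟨⟨⟨?_, ⟨?_, ?_, ?_⟩, p0, ?_⟩, ⟨?_, ?_⟩, F0, Finset.mem_union_left _ hF0K, hxF0, hyF0⟩, hfil⟩
      · simp only
        rw [Finset.card_union_of_disjoint hKP']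
        have h1 := hP'.card_sum
        have h2 := hm0.2.1.card_sum
        rw [Finset.sum_congr rfl (fun F hF => (hg F hF).1)] at h1
        rw [Finset.sum_congr rfl (fun F hF => (hm0.2.2 F hF).1)] at h2
        rw [Finset.card_erase_of_mem hzW] at h1
        rw [Finset.card_erase_of_mem hm0.1, ← h1] at h2
        simp only [Finset.sum_const, smul_eq_mul] at h2
        have h3 := Nat.eq_of_mul_eq_mul_right (Nat.succ_pos d) h2
        rw [← h3, Finset.card_sdiff_of_subset hKP, ← hc0]
        have := Finset.card_le_card hKP
        omega
      · intro F hF i hi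
        simp only [Finset.mem_erase, Finset.mem_univ, and_true]
        rcases Finset.mem_union.mp hF with h | h
        · rintro rfl; exact hzK F h hi
        · exact Finset.ne_of_mem_erase (hP'.1 F h hi)
      · intro F hF G hG hFG
        rcases Finset.mem_union.mp hF with h | h <;> rcases Finset.mem_union.mp hG with h' | h'
        · exact hKd F h G h' hFG
        · exact (hdis G h' F h).symm
        · exact hdis F h G h'
        · exact hP'.2.1 F h G h' hFG
      · intro i hi
        have hiz := Finset.ne_of_mem_erase hi
        by_cases hiW : i ∈ W
        · obtain ⟨F, hF, hiF⟩ := hP'.2.2 i (Finset.mem_erase.mpr ⟨hiz, hiW⟩)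
          exact ⟨F, Finset.mem_union_right _ hF, hiF⟩
        · rw [hW] at hiW
          push Not at hiW
          obtain ⟨F, hF, hiF⟩ := hiW
          exact ⟨F, Finset.mem_union_left _ hF, hiF⟩
      · intro F hF
        rcases Finset.mem_union.mp hF with h | h
        · exact hKp F h
        · exact (hg F h).2
      · rintro rfl; exact hzK F0 hF0K hxF0
      · rintro rfl; exact hzK F0 hF0K hyF0
    · simp only [Prod.mk.injEq, true_and]
      rw [Finset.union_sdiff_left, Finset.sdiff_eq_self_of_disjoint hKP'.symm]


open Pointwise in
theorem tv_swap_even {ι : Type*} [Fintype ι] [DecidableEq ι] {d q : ℕ}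
    (v : ι → EuclideanSpace ℝ (Fin d)) (pa : EuclideanSpace ℝ (Fin d)) (hstar : TvStar v pa)
    (hne : TvNe v pa) (hd : 1 ≤ d) (hq : d + 1 < q)
    (hι : Fintype.card ι = (d + 1) * (q - 1) + 2) (x a b : ι) (hab : a ≠ b) (hxa : x ≠ a)
    (hxb : x ≠ b) (hv : v a = v b) : Even (tvSet v q x).card := by
  classical
  set σ : Equiv.Perm ι := Equiv.swap a b with hσ
  have hvσ : ∀ i, v (σ i) = v i := by
    intro i
    by_cases h1 : i = a
    · subst h1; simp [σ, hv]
    by_cases h2 : i = b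
    · subst h2; simp [σ, hv]
    rw [hσ, Equiv.swap_apply_of_ne_of_ne h1 h2]
  have hσσ : σ * σ = 1 := by simp [σ]
  have hmaps : ∀ P ∈ tvSet v q x, σ • P ∈ tvSet v q x := by
    intro P hP
    rw [mem_tvSet] at hP ⊢
    obtain ⟨hc, hP, p, hp⟩ := hP
    refine ⟨by rw [Finset.card_smul_finset, hc], ?_, p, ?_⟩
    · have := hP.smul σ
      rwa [tv_smul_erase, Finset.smul_finset_univ, hσ,
        Equiv.swap_apply_of_ne_of_ne hxa hxb, ← hσ] at this
    · intro F hF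
      obtain ⟨G, hG, rfl⟩ := Finset.mem_smul_finset.mp hF
      have : v '' ((σ • G : Finset ι) : Set ι) = v '' (G : Set ι) := by
        rw [Finset.coe_smul_finset]
        ext e
        constructor
        · rintro ⟨i, hi, rfl⟩
          obtain ⟨j, hj, rfl⟩ := Set.mem_smul_set.mp hi
          exact ⟨j, hj, (hvσ j).symm⟩
        · rintro ⟨i, hi, rfl⟩
          exact ⟨σ i, Set.mem_smul_set.mpr ⟨i, hi, rfl⟩, hvσ i⟩
      rw [this]
      exact hp G hG
  have hfix : ∀ P ∈ tvSet v q x, σ • P ≠ P := by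
    intro P hPm hfix
    rw [mem_tvSet] at hPm
    obtain ⟨hc, hP, p, hp⟩ := hPm
    obtain ⟨hpa, hsz, hsum⟩ := tv_sizes v pa hstar hne hd hq hι x P hc hP p hp
    obtain ⟨Fa, hFa, haF⟩ := hP.2.2 a (by simp [Ne.symm hxa])
    obtain ⟨Fb, hFb, hbF⟩ := hP.2.2 b (by simp [Ne.symm hxb])
    by_cases hF : Fa = Fb
    · subst hF
      have := hstar P hP.2.1 (Finset.univ.erase b) p (by
        intro F hF
        rw [Finset.inter_erase, Finset.inter_univ]
        refine convexHull_mono ?_ (hp F hF)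
        rintro _ ⟨i, hi, rfl⟩
        by_cases hib : i = b
        · subst hib
          have : F = Fa := hP.unique hF hFa hi hbF
          subst this
          exact ⟨a, by simp [hab, haF], hv⟩
        · exact ⟨i, by simpa [hib] using hi, rfl⟩) hpa
      rw [← Finset.add_sum_erase _ _ hFa] at this hsum
      rw [Finset.inter_erase, Finset.inter_univ, Finset.card_erase_of_mem hbF] at this
      have h2 : ∑ F ∈ P.erase Fa, (d + 1 - F.card) ≤
          ∑ F ∈ P.erase Fa, (d + 1 - (F ∩ Finset.univ.erase b).card) := by
        apply Finset.sum_le_sum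
        intro F _
        have : (F ∩ Finset.univ.erase b).card ≤ F.card :=
          Finset.card_le_card Finset.inter_subset_left
        omega
      have := hsz Fa hFa
      have := Finset.card_pos.mpr ⟨b, hbF⟩
      omega
    · have h1 : σ • Fa = Fb := by
        have hm : σ • Fa ∈ P := by
          rw [← hfix]
          exact Finset.smul_mem_smul_finset hFa
        refine hP.unique hm hFb ?_ hbF
        refine Finset.mem_smul_finset.mpr ⟨a, haF, ?_⟩
        simp [σ]
      have h2 : Fa = {a} := by
        ext i
        rw [Finset.mem_singleton]
        constructor
        · intro hi
          by_contra hia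
          have hib : i ≠ b := by
            rintro rfl
            exact hF (hP.unique hFa hFb hi hbF)
          have : i ∈ Fb := by
            rw [← h1]
            refine Finset.mem_smul_finset.mpr ⟨i, hi, ?_⟩
            rw [Equiv.Perm.smul_def, hσ, Equiv.swap_apply_of_ne_of_ne hia hib]
          exact hF (hP.unique hFa hFb hi this)
        · rintro rfl; exact haF
      have hca : Fa.card = 1 := by rw [h2]; simp
      have hcb : Fb.card = 1 := by rw [← h1, Finset.card_smul_finset, hca]
      rw [← Finset.add_sum_erase _ _ hFa,
        ← Finset.add_sum_erase _ _ (Finset.mem_erase.mpr ⟨Ne.symm hF, hFb⟩)] at hsum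
      omega
  have hz : ∑ P ∈ tvSet v q x, (1 : ZMod 2) = 0 := by
    refine Finset.sum_involution (fun P _ => σ • P) ?_ ?_ hmaps ?_
    · intro P _; decide
    · intro P hP _; exact hfix P hP
    · intro P _
      rw [smul_smul, hσσ, one_smul]
  rw [Finset.sum_const, nsmul_eq_mul, mul_one] at hz
  exact (ZMod.natCast_eq_zero_iff_even).mp hz

theorem tv_clone_ne {κ : Type*} [Fintype κ] [DecidableEq κ] {d : ℕ}
    (u : κ → EuclideanSpace ℝ (Fin d)) (a : κ) (j : Fin d) (ha : ∀ k, k ≠ a → u k j < u a j) :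
    TvNe (fun o : Option κ => u (o.getD a)) (u a) := by
  intro P hP hc p hp
  have hone : ∀ i : Option κ, (P.filter (fun F => i ∈ F)).card ≤ 1 := by
    intro i
    rw [Finset.card_le_one]
    intro F hF G hG
    rw [Finset.mem_filter] at hF hG
    by_contra h
    exact Finset.disjoint_left.mp (hP F hF.1 G hG.1 h) hF.2 hG.2
  obtain ⟨F, hF, h1, h2⟩ : ∃ F ∈ P, some a ∉ F ∧ none ∉ F := by
    by_contra hcon
    push Not at hcon
    have hsub : P ⊆ P.filter (fun F => some a ∈ F) ∪ P.filter (fun F => none ∈ F) := by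
      intro F hF
      rw [Finset.mem_union, Finset.mem_filter, Finset.mem_filter]
      by_cases h : some a ∈ F
      · exact Or.inl ⟨hF, h⟩
      · exact Or.inr ⟨hF, hcon F hF h⟩
    have h3 := (Finset.card_le_card hsub).trans (Finset.card_union_le _ _)
    have := hone (some a)
    have := hone none
    omega
  have hconv : Convex ℝ {e : EuclideanSpace ℝ (Fin d) | e j < u a j} :=
    convex_halfSpace_lt (f := fun e : EuclideanSpace ℝ (Fin d) => e j)
      ⟨fun _ _ => rfl, fun _ _ => rfl⟩ _
  have hlt := convexHull_min (t := {e : EuclideanSpace ℝ (Fin d) | e j < u a j}) (by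
    rintro _ ⟨i, hi, rfl⟩
    cases i with
    | none => exact absurd hi h2
    | some k =>
      refine ha k ?_
      rintro rfl
      exact h1 hi) hconv (hp F hF)
  intro h
  rw [h] at hlt
  exact lt_irrefl (u a j) hlt

theorem tv_clone_star {κ : Type*} [Fintype κ] [DecidableEq κ] {d : ℕ}
    (u : κ → EuclideanSpace ℝ (Fin d))
    (hu : AlgebraicIndependent ℚ (fun p : κ × Fin d => u p.1 p.2)) (a : κ) :
    TvStar (fun o : Option κ => u (o.getD a)) (u a) := by
  intro P hP s0 p hp hpa
  exact tv_star u hu a P hP s0 p hp hpa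

theorem tv_transfer (d q : ℕ) (X : Finset (EuclideanSpace ℝ (Fin d))) (a : {x // x ∈ X}) :
    {P : Finset (Finset (EuclideanSpace ℝ (Fin d))) | IsTverbergPartition d q X P}.ncard =
      (tvSet (fun o : Option {x // x ∈ X} => ((o.getD a : {x // x ∈ X}) : EuclideanSpace ℝ (Fin d)))
        q none).card := by
  classical
  set v := fun o : Option {x // x ∈ X} => ((o.getD a : {x // x ∈ X}) : EuclideanSpace ℝ (Fin d))
    with hv
  let A : Finset (Option {x // x ∈ X}) → Finset (EuclideanSpace ℝ (Fin d)) := fun F => F.image v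
  let B : Finset (EuclideanSpace ℝ (Fin d)) → Finset (Option {x // x ∈ X}) := fun S =>
    Finset.univ.filter (fun i => ∃ k : {x // x ∈ X}, i = some k ∧ k.1 ∈ S)
  have memB : ∀ S (k : {x // x ∈ X}), some k ∈ B S ↔ k.1 ∈ S := by
    intro S k
    simp only [B, Finset.mem_filter, Finset.mem_univ, true_and]
    constructor
    · rintro ⟨k', h, h2⟩
      rw [Option.some.inj h]; exact h2
    · exact fun h => ⟨k, rfl, h⟩
  have noneB : ∀ S, none ∉ B S := by
    intro S h
    simp [B] at h
  have memA : ∀ F, none ∉ F → ∀ k : {x // x ∈ X}, k.1 ∈ A F ↔ some k ∈ F := by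
    intro F hF k
    simp only [A, Finset.mem_image]
    constructor
    · rintro ⟨i, hi, h⟩
      cases i with
      | none => exact absurd hi hF
      | some l =>
        have : l = k := Subtype.ext h
        rwa [← this]
    · exact fun h => ⟨some k, h, rfl⟩
  have subA : ∀ F, A F ⊆ X := by
    intro F y hy
    simp only [A, Finset.mem_image] at hy
    obtain ⟨i, -, rfl⟩ := hy
    exact (i.getD a).2
  have AB : ∀ S, S ⊆ X → A (B S) = S := by
    intro S hS
    ext y
    constructor
    · intro hy
      have := (memA (B S) (noneB S) ⟨y, subA _ hy⟩).1 hy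
      exact (memB S ⟨y, subA _ hy⟩).1 this
    · intro hy
      exact (memA (B S) (noneB S) ⟨y, hS hy⟩).2 ((memB S ⟨y, hS hy⟩).2 hy)
  have BA : ∀ F, none ∉ F → B (A F) = F := by
    intro F hF
    ext i
    cases i with
    | none => exact ⟨fun h => absurd h (noneB _), fun h => absurd h hF⟩
    | some k => rw [memB, memA F hF]
  have cA : ∀ F, ((A F : Finset _) : Set (EuclideanSpace ℝ (Fin d))) = v '' (F : Set _) := by
    intro F
    simp [A]
  have key : {P | IsTverbergPartition d q X P} =
      (fun P : Finset (Finset (Option {x // x ∈ X})) => P.image A) '' (tvSet v q none : Set _) := by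
    ext Q
    simp only [Set.mem_setOf_eq, Set.mem_image, Finset.mem_coe]
    constructor
    · rintro ⟨h1, h2, h3, p, hp⟩
      have hAB : (Q.image B).image A = Q := by
        rw [Finset.image_image]
        ext S
        simp only [Finset.mem_image, Function.comp]
        constructor
        · rintro ⟨T, hT, rfl⟩
          rw [AB T (h2 T hT)]; exact hT
        · exact fun h => ⟨S, h, AB S (h2 S h)⟩
      refine ⟨Q.image B, ?_, hAB⟩
      rw [mem_tvSet]
      refine ⟨?_, ⟨?_, ?_, ?_⟩, p, ?_⟩
      · rw [Finset.card_image_of_injOn, h1]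
        intro S hS T hT h
        rw [← AB S (h2 S hS), ← AB T (h2 T hT)]
        exact congrArg A h
      · intro F hF i hi
        obtain ⟨S, hS, rfl⟩ := Finset.mem_image.1 hF
        simp only [Finset.mem_erase, Finset.mem_univ, and_true]
        rintro rfl
        exact noneB S hi
      · intro F hF G hG hne
        obtain ⟨S, hS, rfl⟩ := Finset.mem_image.1 hF
        obtain ⟨T, hT, rfl⟩ := Finset.mem_image.1 hG
        rw [Finset.disjoint_left]
        intro i hi hi2
        cases i with
        | none => exact noneB _ hi
        | some k =>
          have e := (h3 k.1 k.2).unique ⟨hS, (memB S k).1 hi⟩ ⟨hT, (memB T k).1 hi2⟩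
          exact hne (congrArg B e)
      · intro i hi
        cases i with
        | none => simp at hi
        | some k =>
          obtain ⟨S, ⟨hS, hk⟩, -⟩ := h3 k.1 k.2
          exact ⟨B S, Finset.mem_image_of_mem _ hS, (memB S k).2 hk⟩
      · intro F hF
        obtain ⟨S, hS, rfl⟩ := Finset.mem_image.1 hF
        rw [← cA, AB S (h2 S hS)]
        exact Set.mem_iInter₂.1 hp S hS
    · rintro ⟨P, hP, rfl⟩
      rw [mem_tvSet] at hP
      obtain ⟨h1, h2, p, hp⟩ := hP
      refine ⟨?_, ?_, ?_, p, ?_⟩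
      · rw [Finset.card_image_of_injOn, h1]
        intro F hF G hG h
        rw [← BA F (h2.notMem hF), ← BA G (h2.notMem hG)]
        exact congrArg B h
      · intro S hS
        obtain ⟨F, hF, rfl⟩ := Finset.mem_image.1 hS
        exact subA F
      · intro y hy
        obtain ⟨F, hF, hi⟩ := h2.2.2 (some ⟨y, hy⟩) (by simp)
        refine ⟨A F, ⟨Finset.mem_image_of_mem _ hF, (memA F (h2.notMem hF) ⟨y, hy⟩).2 hi⟩, ?_⟩
        rintro S ⟨hS, hyS⟩
        obtain ⟨G, hG, rfl⟩ := Finset.mem_image.1 hS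
        rw [h2.unique hF hG hi ((memA G (h2.notMem hG) ⟨y, hy⟩).1 hyS)]
      · refine Set.mem_iInter₂.2 ?_
        intro S hS
        obtain ⟨F, hF, rfl⟩ := Finset.mem_image.1 hS
        rw [cA]
        exact hp F hF
  have hinj : Set.InjOn (fun P : Finset (Finset (Option {x // x ∈ X})) => P.image A)
      (tvSet v q none : Set _) := by
    have h : ∀ P ∈ tvSet v q none, (P.image A).image B = P := by
      intro P hP
      have h2 := ((mem_tvSet _ _ _ _).1 hP).2.1
      rw [Finset.image_image]
      ext S
      simp only [Finset.mem_image, Function.comp]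
      constructor
      · rintro ⟨T, hT, rfl⟩
        rw [BA T (h2.notMem hT)]; exact hT
      · exact fun h => ⟨S, h, BA S (h2.notMem h)⟩
    intro P hP Q hQ e
    rw [← h P hP, ← h Q hQ]
    exact congrArg (fun R => Finset.image B R) e
  rw [key, Set.ncard_image_of_injOn hinj, Set.ncard_coe_finset]

/-- For `(d+1)(q−1)+1` points in general position in ℝ^d with `q > d + 1`,
the number of Tverberg partitions into `q` parts is even. -/
theorem tverberg_partitions_even (d q : ℕ) (hd : 1 ≤ d) (hq : d + 1 < q)
    (X : Finset (EuclideanSpace ℝ (Fin d))) (hcard : X.card = (d + 1) * (q - 1) + 1)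
    (hgen : AlgebraicIndependent ℚ
      (fun p : {x // x ∈ X} × Fin d => (p.1 : EuclideanSpace ℝ (Fin d)) p.2)) :
    Even {P : Finset (Finset (EuclideanSpace ℝ (Fin d))) |
      IsTverbergPartition d q X P}.ncard := by
  classical
  have hκ : Fintype.card {x // x ∈ X} = (d + 1) * (q - 1) + 1 := by
    rw [Fintype.card_coe, hcard]
  have hpos : 0 < (d + 1) * (q - 1) := Nat.mul_pos (by omega) (by omega)
  let j : Fin d := ⟨0, hd⟩
  have hnon : (Finset.univ : Finset {x // x ∈ X}).Nonempty := by
    rw [← Finset.card_pos, Finset.card_univ, hκ]; omega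
  obtain ⟨a, -, ha⟩ := Finset.exists_max_image Finset.univ
    (fun k : {x // x ∈ X} => (k : EuclideanSpace ℝ (Fin d)) j) hnon
  have ha' : ∀ k : {x // x ∈ X}, k ≠ a →
      (k : EuclideanSpace ℝ (Fin d)) j < (a : EuclideanSpace ℝ (Fin d)) j := by
    intro k hk
    refine lt_of_le_of_ne (ha k (Finset.mem_univ _)) ?_
    intro h
    have := hgen.injective (a₁ := (k, j)) (a₂ := (a, j)) h
    exact hk (congrArg Prod.fst this)
  obtain ⟨x, hx⟩ := Fintype.exists_ne_of_one_lt_card (by rw [hκ]; omega) a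
  rw [tv_transfer d q X a]
  have hι : Fintype.card (Option {x // x ∈ X}) = (d + 1) * (q - 1) + 2 := by
    rw [Fintype.card_option, hκ]
  have hstar := tv_clone_star (fun k : {x // x ∈ X} => (k : EuclideanSpace ℝ (Fin d))) hgen a
  have hne := tv_clone_ne (fun k : {x // x ∈ X} => (k : EuclideanSpace ℝ (Fin d))) a j ha'
  have h1 := tv_edges _ _ hstar hne hd hq hι (some x) none (by simp)
  have h2 := tv_V_even _ _ hstar hne hd hq hι (some x) none
  have h3 := tv_swap_even _ _ hstar hne hd hq hι (some x) (some a) none (by simp)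
    (by simpa using hx) (by simp) rfl
  rw [Nat.even_add, Nat.even_add] at h1
  exact (h1.2 (h2.mul_left q)).2 h3
end

section
/- Let X be a set of (d+1)(q−1)+1 points in general position in ℝ^d. Then X has at least (q−d)! Tverberg partitions into q parts. -/
lemma tv_card_le (A B : Finset ℝ) (hB : AlgebraicIndepOn ℚ id (B : Set ℝ))
    (h : ∀ b ∈ B, IsAlgebraic (Algebra.adjoin ℚ (A : Set ℝ)) b) : B.card ≤ A.card := by
  have h1 : (AlgebraicIndependent.matroid ℚ ℝ).Indep (B : Set ℝ) :=
    AlgebraicIndependent.matroid_indep_iff.2 hB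
  have h2 : (B : Set ℝ) ⊆ (AlgebraicIndependent.matroid ℚ ℝ).closure (A : Set ℝ) := by
    rw [AlgebraicIndependent.matroid_closure_eq]
    intro b hb
    exact h b hb
  have h3 := h1.encard_le_eRk_of_subset h2
  rw [Matroid.eRk_closure_eq] at h3
  have h4 := h3.trans (Matroid.eRk_le_encard _ _)
  simpa [Set.encard_coe_eq_coe_finsetCard] using h4

/-- Dimension count in general position. -/
lemma tv_dim_count (d : ℕ) (X : Finset (EuclideanSpace ℝ (Fin d)))
    (hgen : AlgebraicIndependent ℚ
      (fun p : {x // x ∈ X} × Fin d => (p.1 : EuclideanSpace ℝ (Fin d)) p.2))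
    (p : EuclideanSpace ℝ (Fin d)) (G : Finset (Finset (EuclideanSpace ℝ (Fin d))))
    (hsub : ∀ S ∈ G, S ⊆ X) (hp : ∀ S ∈ G, p ∈ convexHull ℝ (S : Set (EuclideanSpace ℝ (Fin d))))
    (hdis : (G : Set (Finset (EuclideanSpace ℝ (Fin d)))).PairwiseDisjoint id) :
    ∑ S ∈ G, ((d : ℤ) + 1 - S.card) ≤ d := by
  classical
  have hw : ∀ S ∈ G, ∃ w : EuclideanSpace ℝ (Fin d) → ℝ, ∃ x ∈ S, w x ≠ 0 ∧ ∑ y ∈ S, w y = 1 ∧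
      ∑ y ∈ S, w y • y = p := by
    intro S hS
    obtain ⟨w, -, h1, h2⟩ := Finset.mem_convexHull'.1 (hp S hS)
    obtain ⟨x, hx, hx0⟩ : ∃ x ∈ S, w x ≠ 0 := by
      by_contra! hc
      rw [Finset.sum_eq_zero hc] at h1
      exact zero_ne_one h1
    exact ⟨w, x, hx, hx0, h1, h2⟩
  choose! w x0 hx0 hwx hw1 hw2 using hw
  set A : Finset ℝ := (Finset.univ.image fun j : Fin d => p j) ∪
    G.biUnion fun S => (((S.erase (x0 S)) ×ˢ (Finset.univ : Finset (Fin d))).image fun t => t.1 t.2)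
      ∪ (S.erase (x0 S)).image (w S) with hA
  set B : Finset ℝ := ((G.biUnion id) ×ˢ (Finset.univ : Finset (Fin d))).image fun t => t.1 t.2
    with hB
  have hUX : G.biUnion id ⊆ X := Finset.biUnion_subset.2 hsub
  have hinj := hgen.injective
  have hBcard : B.card = ∑ S ∈ G, S.card * d := by
    rw [hB, Finset.card_image_of_injOn, Finset.card_product, Finset.card_biUnion hdis,
      Finset.sum_mul]
    · simp
    · rintro ⟨a, i⟩ ha ⟨b, j⟩ hb hab
      simp only [Finset.coe_product, Set.mem_prod, Finset.mem_coe] at ha hb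
      have := @hinj (⟨a, hUX ha.1⟩, i) (⟨b, hUX hb.1⟩, j) hab
      simp only [Prod.mk.injEq, Subtype.mk.injEq] at this
      exact Prod.ext this.1 this.2
  have hAcard : A.card ≤ d + ∑ S ∈ G, ((S.card - 1) * d + (S.card - 1)) := by
    refine (Finset.card_union_le _ _).trans (add_le_add ?_ ?_)
    · exact Finset.card_image_le.trans (by simp)
    · refine Finset.card_biUnion_le.trans (Finset.sum_le_sum fun S hS => ?_)
      refine (Finset.card_union_le _ _).trans (add_le_add ?_ ?_)
      · refine Finset.card_image_le.trans ?_
        rw [Finset.card_product, Finset.card_erase_of_mem (hx0 S hS)]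
        simp
      · refine Finset.card_image_le.trans ?_
        rw [Finset.card_erase_of_mem (hx0 S hS)]
  have hBind : AlgebraicIndepOn ℚ id (B : Set ℝ) := by
    have h1 := hgen.coe_range
    refine h1.mono ?_
    intro b hb
    simp only [hB, Finset.coe_image, Set.mem_image, Finset.mem_coe, Finset.mem_product] at hb
    obtain ⟨⟨y, i⟩, hy, rfl⟩ := hb
    exact ⟨(⟨y, hUX hy.1⟩, i), rfl⟩
  have hgenA : ∀ a ∈ A, IsAlgebraic (Algebra.adjoin ℚ (A : Set ℝ)) a := fun a ha =>
    isAlgebraic_algebraMap (⟨a, Algebra.subset_adjoin ha⟩ : Algebra.adjoin ℚ (A : Set ℝ))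
  have hsum : ∀ (s : Finset (EuclideanSpace ℝ (Fin d))) (g : EuclideanSpace ℝ (Fin d) → ℝ),
      (∀ y ∈ s, IsAlgebraic (Algebra.adjoin ℚ (A : Set ℝ)) (g y)) →
      IsAlgebraic (Algebra.adjoin ℚ (A : Set ℝ)) (∑ y ∈ s, g y) := by
    intro s g hg
    exact Finset.sum_induction g _ (fun a b ha hb => ha.add hb) isAlgebraic_zero hg
  have hBA : ∀ b ∈ B, IsAlgebraic (Algebra.adjoin ℚ (A : Set ℝ)) b := by
    intro b hb
    simp only [hB, Finset.mem_image, Finset.mem_product, Finset.mem_biUnion, id] at hb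
    obtain ⟨⟨y, i⟩, ⟨⟨S, hS, hyS⟩, -⟩, rfl⟩ := hb
    have hA1 : ∀ z ∈ S.erase (x0 S), ∀ i, IsAlgebraic (Algebra.adjoin ℚ (A : Set ℝ)) (z i) := by
      intro z hz i
      apply hgenA
      rw [hA]
      refine Finset.mem_union_right _ (Finset.mem_biUnion.2 ⟨S, hS, Finset.mem_union_left _ ?_⟩)
      exact Finset.mem_image.2 ⟨(z, i), by simpa using hz, rfl⟩
    have hA2 : ∀ z ∈ S.erase (x0 S), IsAlgebraic (Algebra.adjoin ℚ (A : Set ℝ)) (w S z) := by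
      intro z hz
      apply hgenA
      rw [hA]
      refine Finset.mem_union_right _ (Finset.mem_biUnion.2 ⟨S, hS, Finset.mem_union_right _ ?_⟩)
      exact Finset.mem_image.2 ⟨z, hz, rfl⟩
    have hA3 : ∀ i, IsAlgebraic (Algebra.adjoin ℚ (A : Set ℝ)) (p i) := by
      intro i
      apply hgenA
      rw [hA]
      exact Finset.mem_union_left _ (Finset.mem_image.2 ⟨i, by simp, rfl⟩)
    by_cases hyx : y = x0 S
    · subst hyx
      have e1 : w S (x0 S) = 1 - ∑ z ∈ S.erase (x0 S), w S z := by
        rw [← hw1 S hS, ← Finset.add_sum_erase _ _ (hx0 S hS)]; ring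
      have e2 : w S (x0 S) * (x0 S) i = p i - ∑ z ∈ S.erase (x0 S), w S z * z i := by
        have := congrArg (fun v : EuclideanSpace ℝ (Fin d) => v i) (hw2 S hS)
        simp only [WithLp.ofLp_sum, Finset.sum_apply, PiLp.smul_apply, smul_eq_mul] at this
        rw [← this, ← Finset.add_sum_erase _ _ (hx0 S hS)]; ring
      have a1 : IsAlgebraic (Algebra.adjoin ℚ (A : Set ℝ)) (w S (x0 S)) := by
        rw [e1]; exact isAlgebraic_one.sub (hsum _ _ hA2)
      have a2 : IsAlgebraic (Algebra.adjoin ℚ (A : Set ℝ)) (w S (x0 S) * (x0 S) i) := by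
        rw [e2]; exact (hA3 i).sub (hsum _ _ fun z hz => (hA2 z hz).mul (hA1 z hz i))
      have e3 : (x0 S) i = (w S (x0 S))⁻¹ * (w S (x0 S) * (x0 S) i) := by
        rw [inv_mul_cancel_left₀ (hwx S hS)]
      show IsAlgebraic _ ((x0 S) i)
      rw [e3]
      exact a1.inv.mul a2
    · exact hA1 y (Finset.mem_erase.2 ⟨hyx, hyS⟩) i
  have key := (tv_card_le A B hBind hBA).trans hAcard
  rw [hBcard] at key
  have key2 : (∑ S ∈ G, (S.card : ℤ) * d) ≤ d + ∑ S ∈ G, (((S.card : ℤ) - 1) * d + (S.card - 1)) := by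
    have : ((∑ S ∈ G, S.card * d : ℕ) : ℤ) ≤
      ((d + ∑ S ∈ G, ((S.card - 1) * d + (S.card - 1)) : ℕ) : ℤ) := by exact_mod_cast key
    push_cast at this
    refine this.trans (le_of_eq ?_)
    congr 1
    refine Finset.sum_congr rfl fun S hS => ?_
    rw [Nat.cast_sub (Finset.card_pos.2 ⟨_, hx0 S hS⟩)]
    simp
  have : ∑ S ∈ G, ((d : ℤ) + 1 - S.card) =
      ∑ S ∈ G, (S.card : ℤ) * d - ∑ S ∈ G, (((S.card : ℤ) - 1) * d + (S.card - 1)) := by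
    rw [← Finset.sum_sub_distrib]
    exact Finset.sum_congr rfl fun S hS => by ring
  linarith


/-- Evenness of the number of complementary pairs, in the form of a second pair. -/
lemma tv_second {α : Type*} [DecidableEq α] (d : ℕ) (hd : 1 ≤ d) (f : Finset α → Prop)
    (Y S0 : Finset α) (hY : Y.card = 2 * (d + 1))
    (hpar : ∀ R ⊆ Y, R.card = d + 2 → ∃ φ : Finset α → ZMod 2, (∀ S, φ S = 1 ↔ f S) ∧
      ∑ y ∈ R, φ (R.erase y) = 0)
    (x : α) (hx : x ∈ S0) (hS0 : S0 ⊆ Y) (hc : S0.card = d + 1) (h1 : f S0) (h2 : f (Y \ S0)) :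
    ∃ S ⊆ Y, S ≠ S0 ∧ x ∈ S ∧ S.card = d + 1 ∧ f S ∧ f (Y \ S) := by
  classical
  let φ : Finset α → ZMod 2 := fun S => if f S then 1 else 0
  have hpar' : ∀ R ⊆ Y, R.card = d + 2 → ∑ y ∈ R, φ (R.erase y) = 0 := by
    intro R hR hRc
    obtain ⟨ψ, h1, h2⟩ := hpar R hR hRc
    have : ψ = φ := by
      funext S
      by_cases hf : f S
      · simp [φ, hf, (h1 S).2 hf]
      · have h3 : ψ S ≠ 1 := fun h => hf ((h1 S).1 h)
        simp only [φ, hf, if_false]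
        revert h3; generalize ψ S = a; revert a; decide
    rw [← this]; exact h2
  let F := (Y.powersetCard (d + 1)).filter fun S => x ∈ S
  have hF : ∀ S, S ∈ F ↔ (S ⊆ Y ∧ S.card = d + 1) ∧ x ∈ S := by
    intro S; simp [F, Finset.mem_powersetCard]
  have hxY : x ∈ Y := hS0 hx
  have hsum : ∑ S ∈ F, φ S * φ (Y \ S) = 0 := by
    have e1 : ∀ S ∈ F, φ S * φ (Y \ S) =
        ∑ y ∈ Y \ S, φ S * φ ((insert x (Y \ S)).erase y) := by
      intro S hS
      rw [hF] at hS
      obtain ⟨⟨hSY, hSc⟩, hxS⟩ := hS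
      have hxn : x ∉ Y \ S := by simp [hxS]
      have := hpar' (insert x (Y \ S)) (Finset.insert_subset hxY Finset.sdiff_subset) (by
        rw [Finset.card_insert_of_notMem hxn, Finset.card_sdiff_of_subset hSY]; omega)
      rw [Finset.sum_insert hxn, Finset.erase_insert hxn] at this
      rw [← Finset.mul_sum, CharTwo.add_eq_zero.1 this]
    rw [Finset.sum_congr rfl e1, Finset.sum_sigma']
    refine Finset.sum_involution (fun t _ => ⟨(insert x (Y \ t.1)).erase t.2, t.2⟩) ?_ ?_ ?_ ?_
    · rintro ⟨S, y⟩ h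
      simp only [Finset.mem_sigma, hF, Finset.mem_sdiff] at h
      obtain ⟨⟨⟨hSY, hSc⟩, hxS⟩, hyY, hyS⟩ := h
      have : (insert x (Y \ (insert x (Y \ S)).erase y)).erase y = S := by
        ext z
        have := @hSY z
        by_cases hzx : z = x <;> by_cases hzy : z = y <;> (simp_all; try tauto)
      simp only [this]
      rw [mul_comm (φ ((insert x (Y \ S)).erase y))]
      exact CharTwo.add_self_eq_zero _
    · rintro ⟨S, y⟩ h - heq
      simp only [Finset.mem_sigma, hF, Finset.mem_sdiff] at h
      obtain ⟨⟨⟨hSY, hSc⟩, hxS⟩, hyY, hyS⟩ := h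
      simp only [Sigma.mk.injEq, heq_eq_eq, and_true] at heq
      have : S ⊆ {x} := by
        intro z hz
        have hz' := hz
        rw [← heq] at hz'
        simp at hz' ⊢
        tauto
      have := Finset.card_le_card this
      simp at this
      omega
    · rintro ⟨S, y⟩ h
      simp only [Finset.mem_sigma, hF, Finset.mem_sdiff] at h ⊢
      obtain ⟨⟨⟨hSY, hSc⟩, hxS⟩, hyY, hyS⟩ := h
      have hxn : x ∉ Y \ S := by simp [hxS]
      refine ⟨⟨⟨?_, ?_⟩, ?_⟩, hyY, by simp⟩
      · exact (Finset.erase_subset _ _).trans (Finset.insert_subset hxY Finset.sdiff_subset)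
      · rw [Finset.card_erase_of_mem (by simp [hyY, hyS]), Finset.card_insert_of_notMem hxn,
          Finset.card_sdiff_of_subset hSY]; omega
      · have : x ≠ y := by rintro rfl; exact hyS hxS
        simp [this]
    · rintro ⟨S, y⟩ h
      simp only [Finset.mem_sigma, hF, Finset.mem_sdiff] at h
      obtain ⟨⟨⟨hSY, hSc⟩, hxS⟩, hyY, hyS⟩ := h
      simp only [Sigma.mk.injEq, heq_eq_eq, and_true]
      ext z
      have := @hSY z
      by_cases hzx : z = x <;> by_cases hzy : z = y <;> (simp_all; try tauto)
  by_contra! hcon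
  have hS0F : S0 ∈ F := (hF _).2 ⟨⟨hS0, hc⟩, hx⟩
  rw [Finset.sum_eq_single S0] at hsum
  · simp [φ, h1, h2] at hsum
  · intro S hS hne
    rw [hF] at hS
    by_cases hfS : f S
    · have := hcon S hS.1.1 hne hS.2 hS.1.2 hfS
      simp [φ, this]
    · simp [φ, hfS]
  · intro h; exact absurd hS0F h

/-- Birch partitions, abstractly. -/
def TvBirch {α : Type*} [DecidableEq α] (d : ℕ) (f : Finset α → Prop) (Y : Finset α)
    (P : Finset (Finset α)) : Prop :=
  (∀ S ∈ P, S.card = d + 1 ∧ f S) ∧ (P : Set (Finset α)).PairwiseDisjoint id ∧ P.biUnion id = Y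

lemma TvBirch.insert {α : Type*} [DecidableEq α] {d : ℕ} {f : Finset α → Prop} {Y S : Finset α}
    {P : Finset (Finset α)} (h : TvBirch d f (Y \ S) P) (hS : S ⊆ Y) (hc : S.card = d + 1)
    (hf : f S) : S ∉ P ∧ TvBirch d f Y (Insert.insert S P) := by
  obtain ⟨h1, h2, h3⟩ := h
  have hd : ∀ T ∈ P, Disjoint S T := by
    intro T hT
    have : T ⊆ Y \ S := by
      rw [← h3]; exact Finset.subset_biUnion_of_mem id hT
    exact Finset.disjoint_left.2 fun a ha hb => (Finset.mem_sdiff.1 (this hb)).2 ha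
  refine ⟨?_, ?_, ?_, ?_⟩
  · intro hSP
    have := hd S hSP
    simp at this
    subst this
    simp at hc
  · intro T hT
    rcases Finset.mem_insert.1 hT with rfl | hT
    · exact ⟨hc, hf⟩
    · exact h1 T hT
  · rw [Finset.coe_insert]
    exact h2.insert fun T hT _ => hd T hT
  · rw [Finset.biUnion_insert, h3]
    exact Finset.union_sdiff_of_subset hS

lemma TvBirch.erase {α : Type*} [DecidableEq α] {d : ℕ} {f : Finset α → Prop} {Y S : Finset α}
    {P : Finset (Finset α)} (h : TvBirch d f Y P) (hS : S ∈ P) :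
    TvBirch d f (Y \ S) (P.erase S) := by
  obtain ⟨h1, h2, h3⟩ := h
  refine ⟨fun T hT => h1 T (Finset.mem_of_mem_erase hT),
    h2.subset (by simp), ?_⟩
  ext z
  rw [← h3]
  simp only [Finset.mem_biUnion, Finset.mem_erase, id, Finset.mem_sdiff]
  constructor
  · rintro ⟨T, ⟨hne, hT⟩, hz⟩
    exact ⟨⟨T, hT, hz⟩, fun hzS => Finset.disjoint_left.1 (h2 hT hS hne) hz hzS⟩
  · rintro ⟨⟨T, hT, hz⟩, hn⟩
    exact ⟨T, ⟨by rintro rfl; exact hn hz, hT⟩, hz⟩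

open Classical in
lemma tv_birch_count {α : Type*} (d : ℕ) (hd : 1 ≤ d) (f : Finset α → Prop) (k : ℕ) :
    ∀ (Y : Finset α)
    (_ : ∀ R ⊆ Y, R.card = d + 2 → ∃ φ : Finset α → ZMod 2, (∀ S, φ S = 1 ↔ f S) ∧
      ∑ y ∈ R, φ (R.erase y) = 0)
    (P : Finset (Finset α)) (_ : TvBirch d f Y P) (_ : P.card = k),
    k.factorial ≤ (Y.powerset.powerset.filter (TvBirch d f Y)).card := by
  have hmem : ∀ (Y : Finset α) (P : Finset (Finset α)),
      P ∈ Y.powerset.powerset.filter (TvBirch d f Y) ↔ TvBirch d f Y P := by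
    intro Y P
    simp only [Finset.mem_filter, Finset.mem_powerset, and_iff_right_iff_imp]
    rintro ⟨-, -, h⟩ S hS
    rw [Finset.mem_powerset, ← h]
    exact Finset.subset_biUnion_of_mem id hS
  induction k with
  | zero =>
    intro Y _ P hP _
    exact Finset.card_pos.2 ⟨P, (hmem Y P).2 hP⟩
  | succ k ih =>
    intro Y hpar P hP hPk
    obtain ⟨F, hF⟩ : P.Nonempty := Finset.card_pos.1 (by omega)
    have hsubY : ∀ S ∈ P, S ⊆ Y := by
      intro S hS
      rw [← hP.2.2]; exact Finset.subset_biUnion_of_mem id hS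
    obtain ⟨x, hx⟩ : F.Nonempty := Finset.card_pos.1 (by rw [(hP.1 F hF).1]; omega)
    have key : ∀ J ∈ P, ∃ G : Finset α, x ∈ G ∧ G ⊆ Y ∧ G.card = d + 1 ∧ f G ∧
        (G ⊆ F ∪ J) ∧ (J ≠ F → (G ∩ J).Nonempty) ∧
        (∃ Q, TvBirch d f (Y \ G) Q ∧ Q.card = k) := by
      intro J hJ
      by_cases hJF : J = F
      · subst hJF
        exact ⟨J, hx, hsubY J hJ, (hP.1 J hJ).1, (hP.1 J hJ).2, by simp, fun h => absurd rfl h,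
          P.erase J, hP.erase hJ, by rw [Finset.card_erase_of_mem hJ]; omega⟩
      · have hdis : Disjoint F J := hP.2.1 hF hJ (Ne.symm hJF)
        have hsd : (F ∪ J) \ F = J := by
          rw [Finset.union_sdiff_left, Finset.sdiff_eq_self_of_disjoint hdis.symm]
        have hUY : F ∪ J ⊆ Y := Finset.union_subset (hsubY F hF) (hsubY J hJ)
        have hUc : (F ∪ J).card = 2 * (d + 1) := by
          rw [Finset.card_union_of_disjoint hdis, (hP.1 F hF).1, (hP.1 J hJ).1]; ring
        obtain ⟨G, hGU, hne, hxG, hGc, hfG, hfG'⟩ := tv_second d hd f (F ∪ J) F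
          hUc (fun R hR => hpar R (hR.trans hUY)) x hx Finset.subset_union_left (hP.1 F hF).1
          (hP.1 F hF).2 (by rw [hsd]; exact (hP.1 J hJ).2)
        refine ⟨G, hxG, hGU.trans hUY, hGc, hfG, hGU, fun _ => ?_, ?_⟩
        · by_contra hcon
          rw [Finset.not_nonempty_iff_eq_empty] at hcon
          apply hne
          apply Finset.eq_of_subset_of_card_le
          · intro z hz
            rcases Finset.mem_union.1 (hGU hz) with h | h
            · exact h
            · have : z ∈ G ∩ J := Finset.mem_inter.2 ⟨hz, h⟩
              simp [hcon] at this
          · rw [hGc, (hP.1 F hF).1]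
        · have hb := (hP.erase hF).erase (S := J) (Finset.mem_erase.2 ⟨hJF, hJ⟩)
          have e : (Y \ F) \ J = (Y \ G) \ ((F ∪ J) \ G) := by
            ext z
            have := @hGU z
            simp only [Finset.mem_sdiff, Finset.mem_union] at this ⊢
            tauto
          rw [e] at hb
          have := hb.insert (Finset.sdiff_subset_sdiff hUY le_rfl) (by
            rw [Finset.card_sdiff_of_subset hGU]; omega) hfG'
          refine ⟨_, this.2, ?_⟩
          rw [Finset.card_insert_of_notMem this.1,
            Finset.card_erase_of_mem (Finset.mem_erase.2 ⟨hJF, hJ⟩), Finset.card_erase_of_mem hF]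
          have : 1 < P.card := Finset.one_lt_card.2 ⟨J, hJ, F, hF, hJF⟩
          omega
    choose! G hxG hGY hGc hfG hGU hGJ hQ using key
    have hGinj : ∀ I ∈ P, ∀ J ∈ P, G I = G J → I = J := by
      have aux : ∀ I ∈ P, ∀ J ∈ P, J ≠ F → G I = G J → I = J := by
        intro I hI J hJ hJF hG
        obtain ⟨z, hz⟩ := hGJ J hJ hJF
        rw [Finset.mem_inter] at hz
        have hz1 := hz.1
        rw [← hG] at hz1
        by_contra hne
        rcases Finset.mem_union.1 (hGU I hI hz1) with h | h
        · exact Finset.disjoint_left.1 (hP.2.1 hJ hF hJF) hz.2 h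
        · exact Finset.disjoint_left.1 (hP.2.1 hI hJ hne) h hz.2
      intro I hI J hJ hG
      by_cases hJF : J = F
      · by_cases hIF : I = F
        · rw [hIF, hJF]
        · exact (aux J hJ I hI hIF hG.symm).symm
      · exact aux I hI J hJ hJF hG
    let B : Finset α → Finset (Finset (Finset α)) := fun Y =>
      Y.powerset.powerset.filter (TvBirch d f Y)
    have hB : ∀ Y P, P ∈ B Y ↔ TvBirch d f Y P := hmem
    have hle : (P.biUnion fun J => (B (Y \ G J)).image (Insert.insert (G J))) ⊆ B Y := by
      intro R hR
      simp only [Finset.mem_biUnion, Finset.mem_image] at hR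
      obtain ⟨J, hJ, Q, hQ, rfl⟩ := hR
      rw [hB] at hQ ⊢
      exact (hQ.insert (hGY J hJ) (hGc J hJ) (hfG J hJ)).2
    refine le_trans ?_ (Finset.card_le_card hle)
    rw [Finset.card_biUnion]
    · have : ∀ J ∈ P, k.factorial ≤ ((B (Y \ G J)).image (Insert.insert (G J))).card := by
        intro J hJ
        rw [Finset.card_image_of_injOn]
        · obtain ⟨Q, hQ1, hQ2⟩ := hQ J hJ
          exact ih (Y \ G J) (fun R hR => hpar R (hR.trans Finset.sdiff_subset)) Q hQ1 hQ2
        · intro Q1 h1 Q2 h2 h12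
          have h1' := (((hB _ _).1 h1).insert (hGY J hJ) (hGc J hJ) (hfG J hJ)).1
          have h2' := (((hB _ _).1 h2).insert (hGY J hJ) (hGc J hJ) (hfG J hJ)).1
          rw [← Finset.erase_insert h1', ← Finset.erase_insert h2']
          exact congrArg (fun s => Finset.erase s (G J)) h12
      refine le_trans ?_ (Finset.sum_le_sum this)
      rw [Finset.sum_const, hPk, Nat.factorial_succ, smul_eq_mul]
    · intro I hI J hJ hIJ
      refine Finset.disjoint_left.2 ?_
      intro R hR1 hR2
      simp only [Finset.mem_image] at hR1 hR2
      obtain ⟨Q1, hQ1, rfl⟩ := hR1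
      obtain ⟨Q2, hQ2, h⟩ := hR2
      have b1 := (((hB _ _).1 hQ1).insert (hGY I hI) (hGc I hI) (hfG I hI)).2
      have hGJmem : G J ∈ Insert.insert (G I) Q1 := by rw [← h]; simp
      have hne : G I ≠ G J := fun h => hIJ (hGinj I hI J hJ h)
      exact Finset.disjoint_left.1 (b1.2.1 (by simp) hGJmem hne) (hxG I hI) (hxG J hJ)


/-- Among `d+2` points, generic with respect to `p`, either none or exactly two of the
`(d+1)`-subsets contain `p` in their convex hull. -/
lemma tv_parity (d : ℕ) [DecidableEq (EuclideanSpace ℝ (Fin d))]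
    (p : EuclideanSpace ℝ (Fin d)) (R : Finset (EuclideanSpace ℝ (Fin d)))
    (hR : R.card = d + 2)
    (hg : ∀ T ⊆ R, T.card ≤ d → p ∉ convexHull ℝ (T : Set (EuclideanSpace ℝ (Fin d)))) :
    ∃ φ : Finset (EuclideanSpace ℝ (Fin d)) → ZMod 2,
      (∀ S, φ S = 1 ↔ p ∈ convexHull ℝ (S : Set (EuclideanSpace ℝ (Fin d)))) ∧
      ∑ y ∈ R, φ (R.erase y) = 0 := by
  classical
  refine ⟨fun S => if p ∈ convexHull ℝ (S : Set (EuclideanSpace ℝ (Fin d))) then 1 else 0,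
    fun S => by by_cases h : p ∈ convexHull ℝ (S : Set (EuclideanSpace ℝ (Fin d))) <;> simp [h], ?_⟩
  by_cases hex : ∃ y ∈ R, p ∈ convexHull ℝ ((R.erase y : Finset _) : Set (EuclideanSpace ℝ (Fin d)))
  swap
  · push Not at hex
    exact Finset.sum_eq_zero fun y hy => if_neg (hex y hy)
  obtain ⟨y0, hy0, hpy0⟩ := hex
  set S := R.erase y0 with hS
  have hSc : S.card = d + 1 := by rw [hS, Finset.card_erase_of_mem hy0]; omega
  have hSR : S ⊆ R := Finset.erase_subset _ _
  have hRS : insert y0 S = R := Finset.insert_erase hy0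
  have hyS : y0 ∉ S := Finset.notMem_erase _ _
  -- affine independence
  have hind : AffineIndependent ℝ ((↑) : S → EuclideanSpace ℝ (Fin d)) := by
    by_contra hni
    obtain ⟨⟨y, hy⟩, hp⟩ := Caratheodory.mem_convexHull_erase hni hpy0
    have hy : y ∈ S := hy
    exact hg _ ((Finset.erase_subset _ _).trans hSR)
      (by rw [Finset.card_erase_of_mem hy]; omega) hp
  have hind' : ∀ c : EuclideanSpace ℝ (Fin d) → ℝ, ∑ x ∈ S, c x = 0 → ∑ x ∈ S, c x • x = 0 →
      ∀ x ∈ S, c x = 0 := by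
    intro c h1 h2 x hx
    have := affineIndependent_iff.1 hind Finset.univ (fun x => c x)
      (by rw [← h1]; exact Finset.sum_coe_sort S c)
      (by rw [← h2]; exact Finset.sum_coe_sort S (fun x => c x • x)) ⟨x, hx⟩ (Finset.mem_univ _)
    exact this
  -- weights of y0
  obtain ⟨b, hb1, hb2⟩ : ∃ b : EuclideanSpace ℝ (Fin d) → ℝ, ∑ x ∈ S, b x = 1 ∧
      ∑ x ∈ S, b x • x = y0 := by
    have htop : affineSpan ℝ (Set.range ((↑) : S → EuclideanSpace ℝ (Fin d))) = ⊤ := by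
      rw [hind.affineSpan_eq_top_iff_card_eq_finrank_add_one]
      simp [hSc]
    have hy : y0 ∈ affineSpan ℝ (Set.range ((↑) : S → EuclideanSpace ℝ (Fin d))) := by
      rw [htop]; trivial
    obtain ⟨w, hw1, hw2⟩ := eq_affineCombination_of_mem_affineSpan_of_fintype hy
    rw [Finset.affineCombination_eq_linear_combination _ _ _ hw1] at hw2
    refine ⟨fun x => if h : x ∈ S then w ⟨x, h⟩ else 0, ?_, ?_⟩
    · rw [← hw1, ← Finset.sum_coe_sort S]
      exact Finset.sum_congr rfl fun x _ => by simp
    · rw [hw2, ← Finset.sum_coe_sort S]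
      exact Finset.sum_congr rfl fun x _ => by simp
  obtain ⟨a, ha0, ha1, ha2⟩ := Finset.mem_convexHull'.1 hpy0
  -- generic: weights positive
  have hpos : ∀ (w : EuclideanSpace ℝ (Fin d) → ℝ), (∀ x ∈ R, 0 ≤ w x) → ∑ x ∈ R, w x = 1 →
      ∑ x ∈ R, w x • x = p → ∀ x ∈ R, ∀ y ∈ R, x ≠ y → w x = 0 → w y ≠ 0 := by
    intro w h0 h1 h2 x hx y hy hxy hwx hwy
    refine hg ((R.erase x).erase y) ((Finset.erase_subset _ _).trans (Finset.erase_subset _ _)) ?_ ?_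
    · rw [Finset.card_erase_of_mem (Finset.mem_erase.2 ⟨hxy.symm, hy⟩), Finset.card_erase_of_mem hx]
      omega
    · refine Finset.mem_convexHull'.2 ⟨w, fun z hz =>
        h0 z (Finset.mem_of_mem_erase (Finset.mem_of_mem_erase hz)), ?_, ?_⟩
      · rw [Finset.sum_erase _ hwy, Finset.sum_erase _ hwx, h1]
      · rw [Finset.sum_erase _ (by simp [hwy]), Finset.sum_erase _ (by simp [hwx]), h2]
  -- a extended
  have hapos : ∀ x ∈ S, 0 < a x := by
    intro x hx
    refine lt_of_le_of_ne (ha0 x hx) fun h => ?_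
    refine hg (S.erase x) ((Finset.erase_subset _ _).trans hSR) ?_ ?_
    · rw [Finset.card_erase_of_mem hx]; omega
    · refine Finset.mem_convexHull'.2 ⟨a, fun z hz => ha0 z (Finset.mem_of_mem_erase hz), ?_, ?_⟩
      · rw [Finset.sum_erase _ h.symm, ha1]
      · rw [Finset.sum_erase _ (by simp [← h]), ha2]
  -- form of all weights
  have hform : ∀ (w : EuclideanSpace ℝ (Fin d) → ℝ), ∑ x ∈ R, w x = 1 →
      ∑ x ∈ R, w x • x = p → ∀ x ∈ S, w x = a x - w y0 * b x := by
    intro w h1 h2 x hx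
    rw [← hRS, Finset.sum_insert hyS] at h1 h2
    have := hind' (fun x => w x - (a x - w y0 * b x)) (by
      rw [Finset.sum_sub_distrib, Finset.sum_sub_distrib, ← Finset.mul_sum, ha1, hb1]
      linarith) (by
      simp only [sub_smul, mul_smul]
      rw [Finset.sum_sub_distrib, Finset.sum_sub_distrib, ← Finset.smul_sum, ha2, hb2, ← h2]
      abel) x hx
    linarith
  obtain ⟨x1, hx1, hmin⟩ := Finset.exists_min_image (S.filter fun x => 0 < b x)
    (fun x => a x / b x) (by
      by_contra hne
      rw [Finset.not_nonempty_iff_eq_empty, Finset.filter_eq_empty_iff] at hne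
      have : ∑ x ∈ S, b x ≤ 0 := Finset.sum_nonpos fun x hx => not_lt.1 (hne hx)
      linarith)
  rw [Finset.mem_filter] at hx1
  obtain ⟨hx1S, hbx1⟩ := hx1
  set t := a x1 / b x1 with ht
  have htpos : 0 < t := div_pos (hapos x1 hx1S) hbx1
  have hx1y : x1 ≠ y0 := fun h => hyS (h ▸ hx1S)
  -- weights of the second simplex
  let w1 : EuclideanSpace ℝ (Fin d) → ℝ := fun x => if x = y0 then t else a x - t * b x
  have hw1S : ∀ x ∈ S, w1 x = a x - t * b x := fun x hx =>
    if_neg (fun h : x = y0 => hyS (h ▸ hx))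
  have hw1y : w1 y0 = t := if_pos rfl
  have hw1sum : ∑ x ∈ R, w1 x = 1 := by
    rw [← hRS, Finset.sum_insert hyS, Finset.sum_congr rfl hw1S, Finset.sum_sub_distrib,
      ← Finset.mul_sum, ha1, hb1, hw1y]; ring
  have hw1p : ∑ x ∈ R, w1 x • x = p := by
    rw [← hRS, Finset.sum_insert hyS, Finset.sum_congr rfl fun x hx => by rw [hw1S x hx], hw1y]
    simp only [sub_smul, mul_smul]
    rw [Finset.sum_sub_distrib, ← Finset.smul_sum, ha2, hb2]; abel
  have hw1x1 : w1 x1 = 0 := by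
    rw [hw1S x1 hx1S, ht]; field_simp; ring
  have hw1nn : ∀ x ∈ R, 0 ≤ w1 x := by
    intro x hx
    rw [← hRS, Finset.mem_insert] at hx
    rcases hx with rfl | hx
    · rw [hw1y]; exact htpos.le
    · rw [hw1S x hx]
      by_cases hb : 0 < b x
      · have := hmin x (Finset.mem_filter.2 ⟨hx, hb⟩)
        rw [le_div_iff₀ hb] at this
        linarith
      · have := hapos x hx
        nlinarith
  have hpx1 : p ∈ convexHull ℝ ((R.erase x1 : Finset _) : Set (EuclideanSpace ℝ (Fin d))) := by
    refine Finset.mem_convexHull'.2 ⟨w1, fun z hz => hw1nn z (Finset.mem_of_mem_erase hz), ?_, ?_⟩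
    · rw [Finset.sum_erase _ hw1x1, hw1sum]
    · rw [Finset.sum_erase _ (by simp [hw1x1]), hw1p]
  have huniq : ∀ x2 ∈ R, x2 ≠ y0 →
      p ∈ convexHull ℝ ((R.erase x2 : Finset _) : Set (EuclideanSpace ℝ (Fin d))) → x2 = x1 := by
    intro x2 hx2 hne hp2
    obtain ⟨v, hv0, hv1, hv2⟩ := Finset.mem_convexHull'.1 hp2
    let w : EuclideanSpace ℝ (Fin d) → ℝ := fun x => if x = x2 then 0 else v x
    have hwx2 : w x2 = 0 := if_pos rfl
    have hwe : ∀ x ∈ R.erase x2, w x = v x := fun x hx => if_neg (Finset.ne_of_mem_erase hx)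
    have hw0 : ∀ x ∈ R, 0 ≤ w x := by
      intro x hx
      by_cases h : x = x2
      · rw [h, hwx2]
      · rw [hwe x (Finset.mem_erase.2 ⟨h, hx⟩)]; exact hv0 x (Finset.mem_erase.2 ⟨h, hx⟩)
    have hw1' : ∑ x ∈ R, w x = 1 := by
      rw [← Finset.sum_erase R hwx2, Finset.sum_congr rfl hwe, hv1]
    have hw2' : ∑ x ∈ R, w x • x = p := by
      rw [← Finset.sum_erase R (a := x2) (by simp [hwx2]),
        Finset.sum_congr rfl fun x hx => by rw [hwe x hx], hv2]
    have hx2S : x2 ∈ S := Finset.mem_erase.2 ⟨hne, hx2⟩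
    have f1 := hform w hw1' hw2' x1 hx1S
    have f2 := hform w hw1' hw2' x2 hx2S
    rw [hwx2] at f2
    have hwy : 0 ≤ w y0 := hw0 y0 hy0
    have hb2 : 0 < b x2 := by
      by_contra hb
      have := hapos x2 hx2S
      nlinarith
    have hm := hmin x2 (Finset.mem_filter.2 ⟨hx2S, hb2⟩)
    have e2 : a x2 / b x2 = w y0 := by
      rw [div_eq_iff hb2.ne']; linarith
    rw [e2] at hm
    have hwx1 : 0 ≤ w x1 := hw0 x1 (hSR hx1S)
    have hle : w y0 ≤ t := by
      rw [ht, le_div_iff₀ hbx1]; linarith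
    have heq : w y0 = t := le_antisymm hle hm
    have hz : w x1 = 0 := by
      rw [f1, heq, ht]; field_simp; ring
    by_contra hxx
    exact hpos w hw0 hw1' hw2' x2 hx2 x1 (hSR hx1S) hxx hwx2 hz
  rw [Finset.sum_ite, Finset.sum_const_zero, add_zero]
  have hfil : (R.filter fun y => p ∈ convexHull ℝ ((R.erase y : Finset _) :
      Set (EuclideanSpace ℝ (Fin d)))) = {y0, x1} := by
    ext z
    simp only [Finset.mem_filter, Finset.mem_insert, Finset.mem_singleton]
    constructor
    · rintro ⟨hz, hpz⟩
      by_cases h : z = y0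
      · exact Or.inl h
      · exact Or.inr (huniq z hz h hpz)
    · rintro (rfl | rfl)
      · exact ⟨hy0, hpy0⟩
      · exact ⟨hSR hx1S, hpx1⟩
  rw [hfil, Finset.sum_const, Finset.card_pair hx1y.symm]
  decide


/-- Colourful Caratheodory theorem (Barany). -/
lemma tv_colorful {E ι κ : Type*} [NormedAddCommGroup E] [InnerProductSpace ℝ E]
    [FiniteDimensional ℝ E] [Fintype ι] [Finite κ] [Nonempty κ] (s : ι → κ → E)
    (hcard : Module.finrank ℝ E < Fintype.card ι)
    (h0 : ∀ i, (0 : E) ∈ convexHull ℝ (Set.range (s i))) :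
    ∃ f : ι → κ, (0 : E) ∈ convexHull ℝ (Set.range fun i => s i (f i)) := by
  classical
  let C : (ι → κ) → Set E := fun f => convexHull ℝ (Set.range fun i => s i (f i))
  have hι : Nonempty ι := Fintype.card_pos_iff.1 (by omega)
  have hmin : ∀ f, ∃ z ∈ C f, ∀ y ∈ C f, ‖z‖ ≤ ‖y‖ := by
    intro f
    have hc : IsCompact (C f) := Set.Finite.isCompact_convexHull ℝ (Set.finite_range _)
    have hne : (C f).Nonempty := convexHull_nonempty_iff.2 (Set.range_nonempty _)
    obtain ⟨z, hz, h⟩ := hc.exists_isMinOn hne continuous_norm.continuousOn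
    exact ⟨z, hz, fun y hy => h hy⟩
  choose Z hZ hZmin using hmin
  obtain ⟨f, hf⟩ := Finite.exists_min (fun f => ‖Z f‖)
  refine ⟨f, ?_⟩
  by_contra hcon
  set z := Z f with hz
  have hz0 : z ≠ 0 := fun h => hcon (h ▸ hZ f)
  have hzz : 0 < inner ℝ z z := real_inner_self_pos.2 hz0
  -- separating lemma
  have hsep : ∀ y, inner ℝ z y < inner ℝ z z →
      ∃ u ∈ segment ℝ z y, ‖u‖ < ‖z‖ := by
    intro y hy
    by_contra! hcc
    have hK : Convex ℝ (segment ℝ z y) := convex_segment z y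
    have : ‖(0 : E) - z‖ = ⨅ w : segment ℝ z y, ‖(0 : E) - w‖ := by
      have : Nonempty (segment ℝ z y) := ⟨⟨z, left_mem_segment ℝ z y⟩⟩
      apply le_antisymm
      · refine le_ciInf fun w => ?_
        simpa using hcc w w.2
      · exact ciInf_le ⟨0, by rintro _ ⟨w, rfl⟩; positivity⟩
          (⟨z, left_mem_segment ℝ z y⟩ : segment ℝ z y)
    have h2 := (norm_eq_iInf_iff_real_inner_le_zero hK (left_mem_segment ℝ z y)).1 this y
      (right_mem_segment ℝ z y)
    rw [zero_sub, inner_neg_left, inner_sub_right] at h2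
    linarith
  have hge : ∀ i, inner ℝ z z ≤ inner ℝ z (s i (f i)) := by
    intro i
    by_contra! hlt
    obtain ⟨u, hu, hul⟩ := hsep _ hlt
    have huC : u ∈ C f := (convex_convexHull ℝ _).segment_subset (hZ f)
      (subset_convexHull ℝ _ ⟨i, rfl⟩) hu
    exact absurd (hZmin f u huC) (not_le.2 hul)
  obtain ⟨τ, hτ, v, w, hv, hind, hwpos, hw1, hwz⟩ := eq_pos_convex_span_of_mem_convexHull (hZ f)
  have hveq : ∀ j, inner ℝ z (v j) = inner ℝ z z := by
    have hge' : ∀ j, 0 ≤ w j * (inner ℝ z (v j) - inner ℝ z z) := by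
      intro j
      obtain ⟨i, hi⟩ := hv ⟨j, rfl⟩
      have := hge i
      simp only at hi
      rw [hi] at this
      exact mul_nonneg (hwpos j).le (by linarith)
    have hsum : ∑ j, w j * (inner ℝ z (v j) - inner ℝ z z) = 0 := by
      simp only [mul_sub]
      have hzw : inner ℝ z z = ∑ j, w j * inner ℝ z (v j) := by
        calc inner ℝ z z = inner ℝ z (∑ j, w j • v j) := by rw [hwz]
          _ = _ := by simp [inner_sum, inner_smul_right]
      rw [Finset.sum_sub_distrib, ← Finset.sum_mul, hw1, one_mul, sub_eq_zero, ← hzw]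
    intro j
    have := (Finset.sum_eq_zero_iff_of_nonneg fun j _ => hge' j).1 hsum j (Finset.mem_univ j)
    rcases mul_eq_zero.1 this with h | h
    · exact absurd h (hwpos j).ne'
    · linarith
  have hlin : LinearIndependent ℝ v := by
    rw [Fintype.linearIndependent_iff]
    intro g hg j
    have h1 : ∑ j, g j = 0 := by
      have := congrArg (fun x => inner ℝ z x) hg
      simp only [inner_sum, inner_smul_right, hveq, inner_zero_right] at this
      rw [← Finset.sum_mul] at this
      exact (mul_eq_zero.1 this).resolve_right hzz.ne'
    exact affineIndependent_iff.1 hind Finset.univ g h1 hg j (Finset.mem_univ j)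
  have hτc : Fintype.card τ < Fintype.card ι := hlin.fintype_card_le_finrank.trans_lt hcard
  have hv' : ∀ j, ∃ i, s i (f i) = v j := fun j => hv ⟨j, rfl⟩
  choose g hg using hv'
  obtain ⟨i, hi⟩ : ∃ i, ∀ j, g j ≠ i := by
    by_contra! hsurj
    exact absurd (Fintype.card_le_of_surjective g hsurj) (not_le.2 hτc)
  obtain ⟨k, hk⟩ : ∃ k, inner ℝ z (s i k) ≤ 0 := by
    by_contra! hpos
    have hconv : Convex ℝ {x : E | 0 < inner ℝ z x} := by
      exact convex_halfSpace_gt (f := fun x => inner ℝ z x)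
        ⟨fun x y => inner_add_right _ _ _, fun c x => inner_smul_right _ _ _⟩ 0
    have hsub : convexHull ℝ (Set.range (s i)) ⊆ {x : E | 0 < inner ℝ z x} :=
      convexHull_min (by rintro _ ⟨k, rfl⟩; exact hpos k) hconv
    have := hsub (h0 i)
    simp at this
  obtain ⟨u, hu, hul⟩ := hsep (s i k) (by linarith)
  have hzC : z ∈ C (Function.update f i k) := by
    rw [hz, ← hwz]
    refine (convex_convexHull ℝ _).sum_mem (fun j _ => (hwpos j).le) hw1 fun j _ => ?_
    refine subset_convexHull ℝ _ ⟨g j, ?_⟩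
    simp only [Function.update_of_ne (hi j)]
    exact hg j
  have huC : u ∈ C (Function.update f i k) := by
    refine (convex_convexHull ℝ _).segment_subset hzC (subset_convexHull ℝ _ ⟨i, ?_⟩) hu
    simp
  have := hZmin _ u huC
  have := hf (Function.update f i k)
  linarith

/-- Tverberg's theorem. -/
lemma tv_tverberg (d m : ℕ) {ι : Type*} [Fintype ι] (x : ι → EuclideanSpace ℝ (Fin d))
    (hcard : (d + 1) * m < Fintype.card ι) :
    ∃ (f : ι → Option (Fin m)) (p : EuclideanSpace ℝ (Fin d)),
      ∀ k, p ∈ convexHull ℝ (x '' {i | f i = k}) := by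
  classical
  -- lifted points, indexed by Option (Fin d)
  let y : ι → Option (Fin d) → ℝ := fun i b => b.elim 1 (fun j => x i j)
  let v : Option (Fin m) → Fin m → ℝ := fun k a => k.elim (-1) (fun k' => if k' = a then 1 else 0)
  have hv : ∀ a, ∑ k, v k a = 0 := by
    intro a
    rw [Fintype.sum_option]
    simp [v]
  let s : ι → Option (Fin m) → EuclideanSpace ℝ (Fin m × Option (Fin d)) := fun i k =>
    WithLp.toLp 2 fun t => v k t.1 * y i t.2
  have hs0 : ∀ i, (0 : EuclideanSpace ℝ (Fin m × Option (Fin d))) ∈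
      convexHull ℝ (Set.range (s i)) := by
    intro i
    have hsum : ∑ k, ((m : ℝ) + 1)⁻¹ • s i k = 0 := by
      rw [← Finset.smul_sum]
      have : ∑ k, s i k = 0 := by
        ext t
        simp only [WithLp.ofLp_sum, Finset.sum_apply, s, ← Finset.sum_mul, hv]
        simp
      rw [this, smul_zero]
    rw [← hsum]
    refine (convex_convexHull ℝ _).sum_mem (fun k _ => by positivity) ?_ fun k _ =>
      subset_convexHull ℝ _ ⟨k, rfl⟩
    simp
    field_simp
  obtain ⟨f, hf⟩ := tv_colorful s (by
    rw [finrank_euclideanSpace, Fintype.card_prod, Fintype.card_option, Fintype.card_fin,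
      Fintype.card_fin, mul_comm]; exact hcard) hs0
  rw [convexHull_range_eq_exists_affineCombination] at hf
  obtain ⟨S, l, hl0, hl1, hl⟩ := hf
  rw [Finset.affineCombination_eq_linear_combination _ _ _ hl1] at hl
  have hcoord : ∀ a b, ∑ i ∈ S, l i * (v (f i) a * y i b) = 0 := by
    intro a b
    have := congrArg (fun u : EuclideanSpace ℝ (Fin m × Option (Fin d)) => u (a, b)) hl
    simpa [s, WithLp.ofLp_sum, Finset.sum_apply] using this
  -- block sums
  let W : Option (Fin m) → Option (Fin d) → ℝ := fun k b =>
    ∑ i ∈ S with f i = k, l i * y i b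
  have hW : ∀ k b, W k b = W none b := by
    intro k b
    cases k with
    | none => rfl
    | some a =>
      have h := hcoord a b
      have e : ∀ i ∈ S, l i * (v (f i) a * y i b) =
          (if f i = some a then l i * y i b else 0) - (if f i = none then l i * y i b else 0) := by
        intro i _
        rcases hfi : f i with _ | k
        · simp [v]
        · by_cases hk : k = a <;> simp [v, hk]
      rw [Finset.sum_congr rfl e, Finset.sum_sub_distrib, ← Finset.sum_filter,
        ← Finset.sum_filter] at h
      simp only [W]
      linarith
  have htot : ∑ k, W k none = 1 := by
    simp only [W]
    rw [Finset.sum_fiberwise]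
    simpa [y] using hl1
  have hc : ((m : ℝ) + 1) * W none none = 1 := by
    have h := htot
    rw [Finset.sum_congr rfl fun k _ => hW k none] at h
    simpa using h
  have hcpos : 0 < W none none := by
    have : (0 : ℝ) < (m : ℝ) + 1 := by positivity
    by_contra! h
    nlinarith
  refine ⟨f, WithLp.toLp 2 fun j => (W none none)⁻¹ * W none (some j), fun k => ?_⟩
  have e : (WithLp.toLp 2 fun j => (W none none)⁻¹ * W none (some j) : EuclideanSpace ℝ (Fin d)) =
      ∑ i ∈ S with f i = k, ((W none none)⁻¹ * l i) • x i := by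
    ext j
    rw [WithLp.ofLp_sum, Finset.sum_apply]
    simp only [PiLp.smul_apply, smul_eq_mul]
    rw [← hW k (some j)]
    simp only [W, y, Option.elim, Finset.mul_sum, mul_assoc]
  rw [e]
  refine (convex_convexHull ℝ _).sum_mem (fun i hi => ?_) ?_ fun i hi => ?_
  · exact mul_nonneg (inv_nonneg.2 hcpos.le) (hl0 i (Finset.mem_filter.1 hi).1)
  · rw [← Finset.mul_sum]
    have : ∑ i ∈ S with f i = k, l i = W none none := by
      rw [← hW k none]; simp [W, y]
    rw [this, inv_mul_cancel₀ hcpos.ne']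
  · exact subset_convexHull ℝ _ ⟨i, (Finset.mem_filter.1 hi).2, rfl⟩

/-- A Tverberg partition of a set in general position, with all parts of size at most `d+1`. -/
lemma tv_exists (d m : ℕ) (X : Finset (EuclideanSpace ℝ (Fin d)))
    (hcard : X.card = (d + 1) * m + 1)
    (hgen : AlgebraicIndependent ℚ
      (fun p : {x // x ∈ X} × Fin d => (p.1 : EuclideanSpace ℝ (Fin d)) p.2))
    [DecidableEq (EuclideanSpace ℝ (Fin d))] :
    ∃ (P : Finset (Finset (EuclideanSpace ℝ (Fin d)))) (p : EuclideanSpace ℝ (Fin d)),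
      P.card = m + 1 ∧ (P : Set (Finset (EuclideanSpace ℝ (Fin d)))).PairwiseDisjoint id ∧
      P.biUnion id = X ∧ ∀ S ∈ P, S.card ≤ d + 1 ∧
        p ∈ convexHull ℝ (S : Set (EuclideanSpace ℝ (Fin d))) := by
  obtain ⟨f, p, hp⟩ := tv_tverberg d m (fun x : {x // x ∈ X} => (x : EuclideanSpace ℝ (Fin d)))
    (by rw [Fintype.card_coe, hcard]; omega)
  have hT : ∀ k, ∃ T : Finset (EuclideanSpace ℝ (Fin d)),
      (∀ x ∈ T, ∃ h : x ∈ X, f ⟨x, h⟩ = k) ∧ T.card ≤ d + 1 ∧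
        p ∈ convexHull ℝ (T : Set (EuclideanSpace ℝ (Fin d))) := by
    intro k
    have := hp k
    rw [convexHull_eq_union] at this
    simp only [Set.mem_iUnion] at this
    obtain ⟨T, hT, hind, hpT⟩ := this
    refine ⟨T, ?_, ?_, hpT⟩
    · intro x hx
      obtain ⟨y, hy, rfl⟩ := hT hx
      exact ⟨y.2, hy⟩
    · have h1 := hind.card_le_finrank_succ
      have h2 : Module.finrank ℝ (vectorSpan ℝ
        (Set.range ((↑) : T → EuclideanSpace ℝ (Fin d)))) ≤ d := by
        refine (Submodule.finrank_le _).trans ?_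
        simp
      rw [Fintype.card_coe] at h1
      omega
  choose T hTf hTc hTp using hT
  have hne : ∀ k, (T k).Nonempty := fun k => by
    have := convexHull_nonempty_iff.1 ⟨p, hTp k⟩
    exact_mod_cast this
  have hdis : ∀ k l, k ≠ l → Disjoint (T k) (T l) := by
    intro k l hkl
    refine Finset.disjoint_left.2 fun x hx hy => hkl ?_
    obtain ⟨h, h1⟩ := hTf k x hx
    obtain ⟨h', h2⟩ := hTf l x hy
    rw [← h1, ← h2]
  have hinj : Function.Injective T := by
    intro k l h
    by_contra hkl
    have := hdis k l hkl
    rw [h, disjoint_self] at this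
    exact (hne l).ne_empty this
  set P := Finset.univ.image T with hP
  have hPd : (P : Set (Finset (EuclideanSpace ℝ (Fin d)))).PairwiseDisjoint id := by
    intro S hS S' hS' hne
    simp only [hP, Finset.coe_image, Finset.coe_univ, Set.image_univ, Set.mem_range] at hS hS'
    obtain ⟨k, rfl⟩ := hS
    obtain ⟨l, rfl⟩ := hS'
    exact hdis k l fun h => hne (by rw [h])
  have hPX : ∀ S ∈ P, S ⊆ X := by
    intro S hS
    simp only [hP, Finset.mem_image, Finset.mem_univ, true_and] at hS
    obtain ⟨k, rfl⟩ := hS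
    intro x hx
    exact (hTf k x hx).1
  have hPp : ∀ S ∈ P, S.card ≤ d + 1 ∧
      p ∈ convexHull ℝ (S : Set (EuclideanSpace ℝ (Fin d))) := by
    intro S hS
    simp only [hP, Finset.mem_image, Finset.mem_univ, true_and] at hS
    obtain ⟨k, rfl⟩ := hS
    exact ⟨hTc k, hTp k⟩
  have hPc : P.card = m + 1 := by
    rw [hP, Finset.card_image_of_injective _ hinj]; simp
  refine ⟨P, p, hPc, hPd, ?_, hPp⟩
  have hcount := tv_dim_count d X hgen p P hPX (fun S hS => (hPp S hS).2) hPd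
  apply Finset.eq_of_subset_of_card_le (Finset.biUnion_subset.2 hPX)
  have hbc : (P.biUnion id).card = ∑ S ∈ P, S.card := Finset.card_biUnion hPd
  change X.card ≤ (P.biUnion id).card
  rw [hbc, hcard]
  rw [Finset.sum_sub_distrib, Finset.sum_const, hPc] at hcount
  simp only [nsmul_eq_mul] at hcount
  have : (((d + 1) * m + 1 : ℕ) : ℤ) ≤ ((∑ S ∈ P, S.card : ℕ) : ℤ) := by
    push_cast at hcount ⊢
    linarith
  exact_mod_cast this

theorem tverberg_partitions_lower_bound (d q : ℕ) (hd : 1 ≤ d) (hq : 2 ≤ q)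
    (X : Finset (EuclideanSpace ℝ (Fin d))) (hcard : X.card = (d + 1) * (q - 1) + 1)
    (hgen : AlgebraicIndependent ℚ
      (fun p : {x // x ∈ X} × Fin d => (p.1 : EuclideanSpace ℝ (Fin d)) p.2)) :
    Nat.factorial (q - d) ≤ {P : Finset (Finset (EuclideanSpace ℝ (Fin d))) |
      IsTverbergPartition d q X P}.ncard := by
  classical
  obtain ⟨m, rfl⟩ : ∃ m, q = m + 1 := ⟨q - 1, by omega⟩
  rw [Nat.add_sub_cancel] at hcard
  obtain ⟨P, p, hPc, hPd, hPX, hPp⟩ := tv_exists d m X hcard hgen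
  set F := P.filter fun S => S.card = d + 1 with hF
  set N := P.filter fun S => ¬ S.card = d + 1 with hN
  set Y := F.biUnion id with hY
  have hsubX : ∀ S ∈ P, S ⊆ X := by
    intro S hS
    rw [← hPX]; exact Finset.subset_biUnion_of_mem id hS
  have hFP : F ⊆ P := Finset.filter_subset _ _
  have hNP : N ⊆ P := Finset.filter_subset _ _
  have hFNc : F.card + N.card = m + 1 := by
    rw [← hPc]; exact Finset.card_filter_add_card_filter_not _
  have hFN : F ∪ N = P := Finset.filter_union_filter_not_eq _ _
  have hYX : Y ⊆ X := Finset.biUnion_subset.2 fun S hS => hsubX S (hFP hS)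
  have hsumP : ∑ S ∈ P, ((d : ℤ) + 1 - S.card) = d := by
    have h1 : (∑ S ∈ P, S.card) = (d + 1) * m + 1 := by
      rw [← hcard, ← hPX, Finset.card_biUnion hPd]; rfl
    have h2 : ((∑ S ∈ P, S.card : ℕ) : ℤ) = (((d + 1) * m + 1 : ℕ) : ℤ) := by rw [h1]
    rw [Finset.sum_sub_distrib, Finset.sum_const, hPc]
    push_cast at h2 ⊢
    rw [h2]
    simp only [nsmul_eq_mul]
    push_cast
    ring
  have hsumN : ∑ S ∈ N, ((d : ℤ) + 1 - S.card) = d := by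
    refine Eq.trans ?_ hsumP
    refine Finset.sum_subset hNP fun S hS hSN => ?_
    have : S.card = d + 1 := by
      by_contra h
      exact hSN (Finset.mem_filter.2 ⟨hS, h⟩)
    rw [this]; push_cast; ring
  have hNcard : N.card ≤ d := by
    have : ∑ S ∈ N, (1 : ℤ) ≤ ∑ S ∈ N, ((d : ℤ) + 1 - S.card) := by
      refine Finset.sum_le_sum fun S hS => ?_
      have h1 := (hPp S (hNP hS)).1
      have h2 := (Finset.mem_filter.1 hS).2
      have : S.card ≤ d := by omega
      have : (S.card : ℤ) ≤ d := by exact_mod_cast this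
      linarith
    rw [hsumN] at this
    simp at this
    exact_mod_cast this
  have hNY : ∀ S ∈ N, Disjoint S Y := by
    intro S hS
    refine (Finset.disjoint_biUnion_right _ _ _).2 fun S' hS' => ?_
    refine hPd (hNP hS) (hFP hS') ?_
    rintro rfl
    exact (Finset.mem_filter.1 hS).2 (Finset.mem_filter.1 hS').2
  have hgenp : ∀ T ⊆ Y, T.card ≤ d →
      p ∉ convexHull ℝ (T : Set (EuclideanSpace ℝ (Fin d))) := by
    intro T hTY hTc hpT
    have hTne : T.Nonempty := by
      have := convexHull_nonempty_iff.1 ⟨p, hpT⟩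
      exact_mod_cast this
    have hTN : T ∉ N := by
      intro h
      obtain ⟨x, hx⟩ := hTne
      exact Finset.disjoint_left.1 (hNY T h) hx (hTY hx)
    have := tv_dim_count d X hgen p (insert T N) (by
      intro S hS
      rcases Finset.mem_insert.1 hS with rfl | hS
      · exact hTY.trans hYX
      · exact hsubX S (hNP hS)) (by
      intro S hS
      rcases Finset.mem_insert.1 hS with rfl | hS
      · exact hpT
      · exact (hPp S (hNP hS)).2) (by
      rw [Finset.coe_insert]
      refine (hPd.subset (by exact_mod_cast hNP)).insert fun S hS _ => ?_
      exact ((hNY S hS).mono_right hTY).symm)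
    rw [Finset.sum_insert hTN, hsumN] at this
    have h2 : (T.card : ℤ) ≤ d := by exact_mod_cast hTc
    linarith
  have hbirch : TvBirch d (fun S => p ∈ convexHull ℝ (S : Set (EuclideanSpace ℝ (Fin d)))) Y F :=
    ⟨fun S hS => ⟨(Finset.mem_filter.1 hS).2, (hPp S (hFP hS)).2⟩,
      hPd.subset (by exact_mod_cast hFP), rfl⟩
  have hcnt := tv_birch_count d hd
    (fun S => p ∈ convexHull ℝ (S : Set (EuclideanSpace ℝ (Fin d)))) F.card Y
    (fun R hR hRc => by
      obtain ⟨φ, h1, h2⟩ := tv_parity d p R hRc fun T hT => hgenp T (hT.trans hR)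
      refine ⟨φ, h1, ?_⟩
      convert h2) F (by convert hbirch) rfl
  refine (Nat.factorial_le (by omega : m + 1 - d ≤ F.card)).trans (hcnt.trans ?_)
  -- the injection
  have hcardBirch : ∀ Q, TvBirch d
      (fun S => p ∈ convexHull ℝ (S : Set (EuclideanSpace ℝ (Fin d)))) Y Q →
      Q.card * (d + 1) = Y.card := by
    rintro Q ⟨h1, h2, h3⟩
    have hbc : (Q.biUnion id).card = ∑ S ∈ Q, S.card := Finset.card_biUnion h2
    rw [← h3, hbc]
    rw [Finset.sum_congr rfl fun S hS => (h1 S hS).1, Finset.sum_const, smul_eq_mul]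
  have hQN : ∀ Q, TvBirch d
      (fun S => p ∈ convexHull ℝ (S : Set (EuclideanSpace ℝ (Fin d)))) Y Q → Disjoint Q N := by
    intro Q hQ
    refine Finset.disjoint_left.2 fun S hS hSN => ?_
    exact (Finset.mem_filter.1 hSN).2 (hQ.1 S hS).1
  rw [← Set.ncard_coe_finset]
  refine Set.ncard_le_ncard_of_injOn (fun Q => Q ∪ N) ?_ ?_ ?_
  · intro Q hQ
    have hQ : TvBirch d (fun S => p ∈ convexHull ℝ (S : Set (EuclideanSpace ℝ (Fin d)))) Y Q := by
      convert (Finset.mem_filter.1 (Finset.mem_coe.1 hQ)).2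
    have hall : ∀ S ∈ Q ∪ N, p ∈ convexHull ℝ (S : Set (EuclideanSpace ℝ (Fin d))) := by
      intro S hS
      rcases Finset.mem_union.1 hS with hS | hS
      · exact (hQ.1 S hS).2
      · exact (hPp S (hNP hS)).2
    have hQY : ∀ S ∈ Q, S ⊆ Y := by
      intro S hS
      rw [← hQ.2.2]; exact Finset.subset_biUnion_of_mem id hS
    have hdis : ((Q ∪ N : Finset _) : Set (Finset (EuclideanSpace ℝ (Fin d)))).PairwiseDisjoint
        id := by
      intro S hS S' hS' hne
      rcases Finset.mem_union.1 (Finset.mem_coe.1 hS) with hS | hS <;>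
        rcases Finset.mem_union.1 (Finset.mem_coe.1 hS') with hS' | hS'
      · exact hQ.2.1 hS hS' hne
      · exact ((hNY S' hS').mono_right (hQY S hS)).symm
      · exact (hNY S hS).mono_right (hQY S' hS')
      · exact hPd (hNP hS) (hNP hS') hne
    refine ⟨?_, ?_, ?_, ⟨p, ?_⟩⟩
    · rw [Finset.card_union_of_disjoint (hQN Q hQ), ← hFNc]
      have h1 := hcardBirch Q hQ
      rw [← hcardBirch F hbirch] at h1
      rw [Nat.eq_of_mul_eq_mul_right (by omega) h1]
    · intro S hS
      rcases Finset.mem_union.1 hS with hS | hS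
      · exact (hQY S hS).trans hYX
      · exact hsubX S (hNP hS)
    · intro x hx
      obtain ⟨S, hS, hxS⟩ : ∃ S ∈ Q ∪ N, x ∈ S := by
        rw [← hPX, Finset.mem_biUnion] at hx
        obtain ⟨S, hS, hxS⟩ := hx
        rw [← hFN, Finset.mem_union] at hS
        rcases hS with hS | hS
        · have hxY : x ∈ Y := Finset.mem_biUnion.2 ⟨S, hS, hxS⟩
          rw [← hQ.2.2, Finset.mem_biUnion] at hxY
          obtain ⟨S', hS', hxS'⟩ := hxY
          exact ⟨S', Finset.mem_union_left _ hS', hxS'⟩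
        · exact ⟨S, Finset.mem_union_right _ hS, hxS⟩
      refine ⟨S, ⟨hS, hxS⟩, ?_⟩
      rintro S' ⟨hS', hxS'⟩
      by_contra hne
      exact Finset.disjoint_left.1 (hdis hS' hS hne) hxS' hxS
    · simp only [Set.mem_iInter]
      exact hall
  · intro Q hQ Q' hQ' h
    have hQ := hQN Q (by convert (Finset.mem_filter.1 (Finset.mem_coe.1 hQ)).2)
    have hQ' := hQN Q' (by convert (Finset.mem_filter.1 (Finset.mem_coe.1 hQ')).2)
    have h : Q ∪ N = Q' ∪ N := h
    rw [← Finset.union_sdiff_cancel_right hQ, h, Finset.union_sdiff_cancel_right hQ']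
  · refine (X.powerset.powerset.finite_toSet).subset ?_
    intro Q hQ
    simp only [Finset.mem_coe, Finset.mem_powerset]
    intro S hS
    exact Finset.mem_powerset.2 (hQ.2.1 S hS)
end
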